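/- Let F and L be number fields (finite extensions of ℚ), and for a number field K let G_K = Gal(K̄/K) denote its absolute Galois group with the Krull (profinite) topology. Then the natural map from Isom(F, L), the set of field isomorphisms F → L, to Isom(G_F, G_L)/Inn(G_L), the set of continuous isomorphisms of topological groups G_F → G_L taken modulo composition with inner automorphisms of G_L, is a bijection. In particular, two number fields with isomorphic absolute Galois groups (as topological groups) are isomorphic as fields. -/

import Mathlib

/-!
STATEMENT 1 (Neukirch–Uchida): for number fields `F`, `L`, the natural map from
`Isom(F, L)` to `Isom(G_F, G_L)/Inn(G_L)` is a bijection; in particular two number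
fields with isomorphic absolute Galois groups (as topological groups) are isomorphic.

The natural map is encoded by its graph `natGaloisRel`: a field isomorphism `σ : F ≃ L`
is related to the class (modulo inner automorphisms of `G_L`) of the continuous
isomorphism `G_F → G_L`, `g ↦ ψ ∘ g ∘ ψ⁻¹`, for `ψ : F̄ ≃ L̄` any extension of `σ` to
the algebraic closures.  The bijectivity of the natural map is then expressed by:
the relation is the graph of a bijection (in particular, the class does not depend
on the choice of `ψ`, i.e. the map is well defined).
-/

/-- The absolute Galois group `G_K = Gal(K̄/K)` of a field `K`, with its Krull
(profinite) topology. -/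
abbrev absGaloisGroup (K : Type*) [Field K] :=
  AlgebraicClosure K ≃ₐ[K] AlgebraicClosure K

/-- An isomorphism of topological groups (a continuous group isomorphism with
continuous inverse). -/
structure ContinuousGroupIso (G H : Type*) [Group G] [Group H] [TopologicalSpace G]
    [TopologicalSpace H] extends G ≃* H where
  continuous_toFun : Continuous toFun
  continuous_invFun : Continuous invFun

/-- Two continuous isomorphisms `G → H` are equivalent iff they differ by composition
with an inner automorphism of `H`. -/
def innEquiv (G H : Type*) [Group G] [Group H] [TopologicalSpace G] [TopologicalSpace H] :
    Setoid (ContinuousGroupIso G H) where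
  r e₁ e₂ := ∃ h : H, ∀ g : G, e₂.toMulEquiv g = h * e₁.toMulEquiv g * h⁻¹
  iseqv := by
    refine ⟨fun e => ⟨1, by simp⟩, ?_, ?_⟩
    · rintro e₁ e₂ ⟨h, hh⟩
      exact ⟨h⁻¹, fun g => by rw [hh g]; group⟩
    · rintro e₁ e₂ e₃ ⟨h, hh⟩ ⟨h', hh'⟩
      exact ⟨h' * h, fun g => by rw [hh' g, hh g]; group⟩

/-- `Isom(G_F, G_L)/Inn(G_L)` : continuous isomorphisms of the absolute Galois groups,
modulo inner automorphisms of `G_L`. -/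
abbrev GaloisIsomClasses (F L : Type*) [Field F] [Field L] :=
  Quotient (innEquiv (absGaloisGroup F) (absGaloisGroup L))

/-- The graph of the natural map `Isom(F, L) → Isom(G_F, G_L)/Inn(G_L)` :
`σ` is related to the class of the continuous isomorphism `g ↦ ψ ∘ g ∘ ψ⁻¹`, where
`ψ : F̄ ≃ L̄` is any extension of `σ` to the algebraic closures. -/
def natGaloisRel (F L : Type*) [Field F] [Field L]
    (σ : F ≃+* L) (c : GaloisIsomClasses F L) : Prop :=
  ∃ ψ : AlgebraicClosure F ≃+* AlgebraicClosure L,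
    (∀ a : F, ψ (algebraMap F (AlgebraicClosure F) a)
        = algebraMap L (AlgebraicClosure L) (σ a)) ∧
    ∃ e : ContinuousGroupIso (absGaloisGroup F) (absGaloisGroup L),
      (∀ (g : absGaloisGroup F) (z : AlgebraicClosure L),
        e.toMulEquiv g z = ψ (g (ψ.symm z))) ∧
      c = ⟦e⟧

set_option linter.unusedSectionVars false

namespace NU

section Rigid

variable {K : Type*} [Field K]

theorem isSquare_of_mul_sq {a x b : K} (ha : IsSquare a) (hb : b ≠ 0) (h : a = x * b ^ 2) :
    IsSquare x := by
  obtain ⟨r, rfl⟩ := ha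
  refine ⟨r / b, ?_⟩
  field_simp
  rw [← h]; ring

/-- A field is rigid if for every nonsquare `a`, the element `1 - a` is in the union of the
square classes of `1` and `a`. -/
structure IsRigid (K : Type*) [Field K] : Prop where
  neg_one : IsSquare (-1 : K)
  one_sub : ∀ a : K, ¬ IsSquare a → IsSquare (1 - a) ∨ IsSquare (a * (1 - a))

/-- The nonsquares `x` such that `1 + x` is a square. -/
def SmallNonsquare (x : K) : Prop := ¬ IsSquare x ∧ IsSquare (1 + x)

local notation "P" => SmallNonsquare

theorem ne_zero_of_not_isSquare {x : K} (h : ¬ IsSquare x) : x ≠ 0 := by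
  rintro rfl; exact h (IsSquare.zero)

theorem IsRigid.neg (hr : IsRigid K) {x : K} (h : IsSquare x) : IsSquare (-x) := by
  simpa using hr.neg_one.mul h

theorem IsRigid.neg_iff (hr : IsRigid K) {x : K} : IsSquare (-x) ↔ IsSquare x :=
  ⟨fun h => by simpa using hr.neg h, hr.neg⟩

theorem IsRigid.one_add (hr : IsRigid K) {x : K} (h : ¬ IsSquare x) :
    IsSquare (1 + x) ∨ IsSquare (x * (1 + x)) := by
  have := hr.one_sub (-x) (by rwa [hr.neg_iff])
  simp only [sub_neg_eq_add, neg_mul] at this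
  rwa [hr.neg_iff] at this

theorem IsRigid.one_add_ne (hr : IsRigid K) {x : K} (h : ¬ IsSquare x) : 1 + x ≠ 0 := by
  intro h0
  apply h
  rw [show x = -1 by linear_combination h0]
  exact hr.neg_one

theorem isSquare_inv_iff' {x : K} : IsSquare x⁻¹ ↔ IsSquare x := by simp

theorem IsRigid.add (hr : IsRigid K) {x y : K} (h : ¬ IsSquare (x * y)) :
    IsSquare (x * (x + y)) ∨ IsSquare (y * (x + y)) := by
  have h0 := ne_zero_of_not_isSquare h
  have hx : x ≠ 0 := left_ne_zero_of_mul h0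
  have hy : y ≠ 0 := right_ne_zero_of_mul h0
  have h1 : ¬ IsSquare (y / x) := fun h2 =>
    h (isSquare_of_mul_sq h2 (inv_ne_zero hx) (by field_simp))
  rcases hr.one_add h1 with h2 | h2
  · exact .inl (isSquare_of_mul_sq h2 (inv_ne_zero hx) (by field_simp))
  · exact .inr (isSquare_of_mul_sq h2 (inv_ne_zero hx) (by field_simp))

theorem IsRigid.small_or_inv (hr : IsRigid K) {x : K} (h : ¬ IsSquare x) : P x ∨ P x⁻¹ := by
  have hx := ne_zero_of_not_isSquare h
  rcases hr.one_add h with h2 | h2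
  · exact .inl ⟨h, h2⟩
  · exact .inr ⟨by simpa using h, isSquare_of_mul_sq h2 hx (by field_simp; ring)⟩

theorem SmallNonsquare.ne_zero {x : K} (h : P x) : x ≠ 0 := ne_zero_of_not_isSquare h.1

theorem IsRigid.not_small_inv (hr : IsRigid K) {x : K} (h : P x) : ¬ P x⁻¹ := by
  intro h2
  have hx := h.ne_zero
  have h3 := hr.one_add_ne h.1
  exact h.1 (isSquare_of_mul_sq (h.2.mul h2.2) (mul_ne_zero h3 (inv_ne_zero hx))
    (by field_simp; ring))

theorem not_small_inv_of_mul (hr : IsRigid K) {x y : K} (h : P x) (h2 : P y) (e : x * y = 1) :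
    False := by
  rw [eq_inv_of_mul_eq_one_right e] at h2
  exact hr.not_small_inv h h2

theorem IsRigid.small_neg_mul (hr : IsRigid K) {x y : K} (hx : P x) (hy : P y)
    (hxy : ¬ IsSquare (x * y)) : P (-(x * y)) := by
  have key : ∀ x y : K, P x → P y → ¬ IsSquare (x * y) →
      IsSquare (1 - x * y) ∨ IsSquare (x * (1 - x * y)) := by
    intro x y hx hy hxy
    have n1 := hr.one_add_ne hx.1
    have n2 := hr.one_add_ne hy.1
    have h1 : ¬ IsSquare ((1 + x) * (-(x * (1 + y)))) := by
      intro h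
      exact hx.1 (isSquare_of_mul_sq ((h.mul hr.neg_one).mul (hx.2.mul hy.2))
        (mul_ne_zero n1 n2) (by ring))
    rcases hr.add h1 with h | h
    · exact .inl (isSquare_of_mul_sq (h.mul hx.2) n1 (by ring))
    · exact .inr (isSquare_of_mul_sq ((h.mul hr.neg_one).mul hy.2) n2 (by ring))
  refine ⟨by rwa [hr.neg_iff], ?_⟩
  have n : 1 - x * y ≠ 0 := fun h => hxy ⟨1, by linear_combination -h⟩
  rw [← sub_eq_add_neg]
  rcases key x y hx hy hxy with h | h
  · exact h
  rcases key y x hy hx (by rwa [mul_comm]) with h' | h'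
  · rwa [mul_comm] at h'
  · exact absurd (isSquare_of_mul_sq (h.mul h') n (by ring)) hxy

theorem IsRigid.isSquare_mul_of_quadruple (hr : IsRigid K) {x y z w : K} (hx : P x) (hy : P y)
    (hz : P z) (hw : P w) (e : x * y * z * w = 1) : IsSquare (x * y) := by
  by_contra h
  have h' : ¬ IsSquare (z * w) := by
    intro h2
    refine h (isSquare_of_mul_sq h2 (mul_ne_zero hz.ne_zero hw.ne_zero) ?_)
    linear_combination (-z * w) * e
  exact not_small_inv_of_mul hr (hr.small_neg_mul hx hy h) (hr.small_neg_mul hz hw h')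
    (by linear_combination e)

/-- A nonsquare class stable under a shift of all other classes. -/
def SpecialClass (c s : K) : Prop :=
  ¬ IsSquare c ∧ IsSquare (s * c) ∧ s ≠ 0 ∧ ∀ x, P x → ¬ IsSquare (c * x) → P (s * x) ∧ P (s⁻¹ * x)

theorem IsRigid.special_of_quadruple (hr : IsRigid K) {c x y z w : K} (hx : P x) (hy : P y)
    (hz : P z) (hw : P w) (e : x * y * z * w = 1) (hc : IsSquare (c * x)) (hcn : ¬ IsSquare c) :
    SpecialClass c (-x) := by
  have hx0 := hx.ne_zero
  have hy0 := hy.ne_zero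
  have hz0 := hz.ne_zero
  have hw0 := hw.ne_zero
  have hc0 := ne_zero_of_not_isSquare hcn
  have exy := hr.isSquare_mul_of_quadruple hx hy hz hw e
  have exz := hr.isSquare_mul_of_quadruple hx hz hy hw (by rw [← e]; ring)
  have exw := hr.isSquare_mul_of_quadruple hx hw hz hy (by rw [← e]; ring)
  refine ⟨hcn, ?_, neg_ne_zero.2 hx0, fun r hrP hrc => ⟨?_, ?_⟩⟩
  · rw [neg_mul, hr.neg_iff, mul_comm]; exact hc
  · rw [neg_mul]
    refine hr.small_neg_mul hx hrP fun h => hrc ?_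
    exact isSquare_of_mul_sq (h.mul hc) hx0 (by ring)
  · have e2 : (-x)⁻¹ * r = -(y * (-(z * (-(w * r))))) := by
      rw [inv_neg, eq_comm, inv_eq_of_mul_eq_one_right (b := y * z * w) (by rw [← e]; ring)]
      ring
    rw [e2]
    have hw1 : P (-(w * r)) := hr.small_neg_mul hw hrP fun h => hrc
      (isSquare_of_mul_sq ((h.mul hc).mul exw) (mul_ne_zero hx0 hw0) (by ring))
    have hz1 : P (-(z * (-(w * r)))) := hr.small_neg_mul hz hw1 fun h => hrP.1
      (isSquare_of_mul_sq (((h.mul hr.neg_one).mul exz).mul exw)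
        (mul_ne_zero hx0 (mul_ne_zero hz0 hw0)) (by ring))
    exact hr.small_neg_mul hy hz1 fun h => hrc
      (isSquare_of_mul_sq ((((h.mul exz).mul exw).mul exy).mul hc)
        (mul_ne_zero hx0 (mul_ne_zero hx0 (mul_ne_zero hy0 (mul_ne_zero hz0 hw0)))) (by ring))

theorem SpecialClass.inv {c s : K} (h : SpecialClass c s) : SpecialClass c s⁻¹ := by
  obtain ⟨h1, h2, h3, h4⟩ := h
  refine ⟨h1, isSquare_of_mul_sq h2 h3 (by field_simp), inv_ne_zero h3, fun x hx hcx => ?_⟩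
  rw [inv_inv]
  exact (h4 x hx hcx).symm

theorem SpecialClass.not_isSquare {c s : K} (h : SpecialClass c s) : ¬ IsSquare s := fun h2 =>
  h.1 (isSquare_of_mul_sq (h2.mul h.2.1) h.2.2.1 (by ring))

theorem IsRigid.special_unique (hr : IsRigid K) {u s c t : K} (hu : SpecialClass u s)
    (hc : SpecialClass c t) : IsSquare (u * c) := by
  by_contra hn
  obtain ⟨s, hu, hs⟩ : ∃ s, SpecialClass u s ∧ P s := by
    rcases hr.small_or_inv hu.not_isSquare with h | h
    exacts [⟨s, hu, h⟩, ⟨s⁻¹, hu.inv, h⟩]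
  obtain ⟨t, hc, ht⟩ : ∃ t, SpecialClass c t ∧ P t := by
    rcases hr.small_or_inv hc.not_isSquare with h | h
    exacts [⟨t, hc, h⟩, ⟨t⁻¹, hc.inv, h⟩]
  have hs0 := hs.ne_zero
  have ht0 := ht.ne_zero
  have hu0 := ne_zero_of_not_isSquare hu.1
  have hc0 := ne_zero_of_not_isSquare hc.1
  have h1 := (hu.2.2.2 t ht fun h =>
    hn (isSquare_of_mul_sq (h.mul hc.2.1) ht0 (by ring))).2
  have h2 := (hc.2.2.2 s hs fun h =>
    hn (isSquare_of_mul_sq (h.mul hu.2.1) hs0 (by ring))).2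
  exact not_small_inv_of_mul hr h1 h2 (by field_simp)

/-- A square class containing every special class. -/
structure IsPivot (u : K) : Prop where
  ne_zero : u ≠ 0
  alt : u = 1 ∧ (∀ c s : K, ¬ SpecialClass c s) ∨ ∃ s, SpecialClass u s
  sub : ∀ c s : K, SpecialClass c s → IsSquare (u * c)

theorem IsRigid.exists_pivot (hr : IsRigid K) : ∃ u : K, IsPivot u := by
  by_cases h : ∃ u s : K, SpecialClass u s
  · obtain ⟨u, s, h⟩ := h
    exact ⟨u, ne_zero_of_not_isSquare h.1, .inr ⟨s, h⟩, fun c t hc => hr.special_unique h hc⟩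
  · push Not at h
    exact ⟨1, one_ne_zero, .inl ⟨rfl, h⟩, fun c s hc => absurd hc (h c s)⟩

/-- The subgroup generated by the squares and the pivot, as a predicate. -/
def InH (u x : K) : Prop := IsSquare x ∨ IsSquare (u * x)

/-- The elements of the maximal ideal lying outside of the exceptional subgroup. -/
def OMinus (u x : K) : Prop := P x ∧ ¬ IsSquare (u * x)

/-- The elements of the exceptional subgroup preserving `OMinus`. -/
def OPlus (u h : K) : Prop := h ≠ 0 ∧ InH u h ∧ ∀ x, OMinus u x → OMinus u (h * x)

variable {u : K}

theorem OMinus.ne_zero {x : K} (h : OMinus u x) : x ≠ 0 := h.1.ne_zero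

theorem OMinus.not_inH {x : K} (h : OMinus u x) : ¬ InH u x := by
  rintro (h2 | h2)
  exacts [h.1.1 h2, h.2 h2]

theorem InH.mul {x y : K} (hu : u ≠ 0) (hx : InH u x) (hy : InH u y) : InH u (x * y) := by
  rcases hx with hx | hx <;> rcases hy with hy | hy
  · exact .inl (hx.mul hy)
  · exact .inr (by rw [mul_left_comm]; exact hx.mul hy)
  · exact .inr (by rw [← mul_assoc]; exact hx.mul hy)
  · exact .inl (isSquare_of_mul_sq (hx.mul hy) hu (by ring))

theorem InH.inv {x : K} (hx : InH u x) : InH u x⁻¹ := by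
  by_cases h : x = 0
  · simpa [h] using hx
  · rcases hx with hx | hx
    · exact .inl (by simpa using hx)
    · exact .inr (isSquare_of_mul_sq hx h (by field_simp))

theorem inH_inv_iff {x : K} : InH u x⁻¹ ↔ InH u x :=
  ⟨fun h => by simpa using h.inv, InH.inv⟩

theorem InH.mul_iff {x y : K} (hu : u ≠ 0) (hx0 : x ≠ 0) (hx : InH u x) :
    InH u (x * y) ↔ InH u y := by
  refine ⟨fun h => ?_, fun h => hx.mul hu h⟩
  have := hx.inv.mul hu h
  rwa [inv_mul_cancel_left₀ hx0] at this

theorem IsRigid.oMinus_or (hr : IsRigid K) {x : K} (h : ¬ InH u x) :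
    OMinus u x ∨ OMinus u x⁻¹ := by
  have h' : ¬ InH u x⁻¹ := by rwa [inH_inv_iff]
  simp only [InH, not_or] at h h'
  exact (hr.small_or_inv h.1).imp (fun h2 => ⟨h2, h.2⟩) (fun h2 => ⟨h2, h'.2⟩)

theorem IsRigid.oMinus_of_not (hr : IsRigid K) {x : K} (h : ¬ InH u x) (h2 : ¬ OMinus u x) :
    OMinus u x⁻¹ := (hr.oMinus_or h).resolve_left h2

theorem not_quadruple (hr : IsRigid K) (hu : IsPivot u) {x y z w : K} (hx : OMinus u x)
    (hy : P y) (hz : P z) (hw : P w) (e : x * y * z * w = 1) : False :=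
  hx.2 (hu.sub _ _ (hr.special_of_quadruple hx.1 hy hz hw e ⟨x, rfl⟩ hx.1.1))

theorem OMinus.neg (hr : IsRigid K) (hu : IsPivot u) {x : K} (hx : OMinus u x) :
    OMinus u (-x) := by
  have h1 : ¬ IsSquare (-x) := by rw [hr.neg_iff]; exact hx.1.1
  refine ⟨?_, by rw [mul_neg, hr.neg_iff]; exact hx.2⟩
  refine (hr.small_or_inv h1).resolve_right fun h => ?_
  have := hx.ne_zero
  exact not_quadruple hr hu hx h hx.1 h (by field_simp)

theorem OMinus.mul (hr : IsRigid K) (hu : IsPivot u) {x y : K} (hx : OMinus u x)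
    (hy : OMinus u y) (h : ¬ InH u (x * y)) : OMinus u (x * y) := by
  simp only [InH, not_or] at h
  have h1 : OMinus u (-(x * y)) :=
    ⟨hr.small_neg_mul hx.1 hy.1 h.1, by rw [mul_neg, hr.neg_iff]; exact h.2⟩
  simpa using h1.neg hr hu

theorem OMinus.inv_not (hr : IsRigid K) {x : K} (hx : OMinus u x) : ¬ OMinus u x⁻¹ :=
  fun h => hr.not_small_inv hx.1 h.1

/-- The underlying set of the valuation ring of a rigid field. -/
def RigidRing (u x : K) : Prop := x = 0 ∨ OMinus u x ∨ OPlus u x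

theorem OPlus.mul (hu : IsPivot u) {x y : K} (hx : OPlus u x) (hy : OPlus u y) :
    OPlus u (x * y) :=
  ⟨mul_ne_zero hx.1 hy.1, hx.2.1.mul hu.ne_zero hy.2.1, fun z hz => by
    rw [mul_assoc]; exact hx.2.2 _ (hy.2.2 _ hz)⟩

theorem OMinus.mul_oPlus (hr : IsRigid K) (hu : IsPivot u) {x y : K} (hx : OMinus u x)
    (hy : OMinus u y) (h : InH u (x * y)) : OPlus u (x * y) := by
  have h0 := mul_ne_zero hx.ne_zero hy.ne_zero
  refine ⟨h0, h, fun z hz => ?_⟩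
  have hn : ¬ InH u (x * y * z) := by
    rw [h.mul_iff hu.ne_zero h0]; exact hz.not_inH
  by_contra hc
  have := hr.oMinus_of_not hn hc
  exact not_quadruple hr hu hx hy.1 hz.1 (hr.oMinus_of_not hn hc).1
    (mul_inv_cancel₀ (mul_ne_zero h0 hz.ne_zero))

theorem RigidRing.mul (hr : IsRigid K) (hu : IsPivot u) {x y : K} (hx : RigidRing u x)
    (hy : RigidRing u y) : RigidRing u (x * y) := by
  rcases hx with rfl | hx | hx
  · simp [RigidRing]
  all_goals rcases hy with rfl | hy | hy
  · simp [RigidRing]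
  · by_cases h : InH u (x * y)
    · exact .inr (.inr (hx.mul_oPlus hr hu hy h))
    · exact .inr (.inl (hx.mul hr hu hy h))
  · exact .inr (.inl (by rw [mul_comm]; exact hy.2.2 _ hx))
  · simp [RigidRing]
  · exact .inr (.inl (hx.2.2 _ hy))
  · exact .inr (.inr (hx.mul hu hy))

theorem exists_of_not_oPlus (hr : IsRigid K) (hu : IsPivot u) {h : K} (h0 : h ≠ 0) (hH : InH u h)
    (hn : ¬ OPlus u h) : ∃ x, OMinus u x ∧ OMinus u (h * x)⁻¹ := by
  have : ¬ ∀ x, OMinus u x → OMinus u (h * x) := fun h2 => hn ⟨h0, hH, h2⟩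
  push Not at this
  obtain ⟨x, hx, hx2⟩ := this
  exact ⟨x, hx, hr.oMinus_of_not (by rw [hH.mul_iff hu.ne_zero h0]; exact hx.not_inH) hx2⟩

theorem RigidRing.or_inv (hr : IsRigid K) (hu : IsPivot u) (x : K) :
    RigidRing u x ∨ RigidRing u x⁻¹ := by
  by_cases hx0 : x = 0
  · simp [RigidRing, hx0]
  by_cases hH : InH u x
  · by_contra hc
    simp only [RigidRing, not_or] at hc
    obtain ⟨y, hy, hy2⟩ := exists_of_not_oPlus hr hu hx0 hH hc.1.2.2
    obtain ⟨z, hz, hz2⟩ := exists_of_not_oPlus hr hu (inv_ne_zero hx0) hH.inv hc.2.2.2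
    have := hy.ne_zero
    have := hz.ne_zero
    exact not_quadruple hr hu hy hy2.1 hz.1 hz2.1 (by field_simp)
  · exact (hr.oMinus_or hH).imp (fun h => .inr (.inl h)) (fun h => .inr (.inl h))

theorem IsPivot.oPlus_neg_one (hr : IsRigid K) (hu : IsPivot u) : OPlus u (-1) :=
  ⟨by simp, .inl hr.neg_one, fun x hx => by simpa using hx.neg hr hu⟩

theorem OMinus.one_add (hr : IsRigid K) (hu : IsPivot u) {x : K} (hx : OMinus u x) :
    OPlus u (1 + x) := by
  have h0 := hr.one_add_ne hx.1.1
  have hH : InH u (1 + x) := .inl hx.1.2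
  have key : ∀ z, OMinus u z → ¬ IsSquare (x * z) → P ((1 + x) * z) := by
    intro z hz hxz
    have hns : ¬ IsSquare ((1 + x) * z) := fun h =>
      hz.1.1 (isSquare_of_mul_sq (h.mul hx.1.2) h0 (by ring))
    refine ⟨hns, ?_⟩
    have n1 := hr.one_add_ne hns
    have n2 := hr.one_add_ne hz.1.1
    have hz0 := hz.ne_zero
    have e : 1 + (1 + x) * z = (1 + z) + x * z := by ring
    have h1 : ¬ IsSquare ((1 + z) * (x * z)) := fun h =>
      hxz (isSquare_of_mul_sq (h.mul hz.1.2) n2 (by ring))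
    rcases hr.one_add hns with h2 | h2
    · exact h2
    rcases hr.add h1 with h3 | h3
    · rw [e]
      exact isSquare_of_mul_sq (h3.mul hz.1.2) n2 (by ring)
    · exact absurd (isSquare_of_mul_sq ((h2.mul h3).mul hx.1.2)
        (mul_ne_zero h0 (mul_ne_zero n1 hz0)) (by rw [e]; ring)) hx.1.1
  refine ⟨h0, hH, fun z hz => ?_⟩
  have hnH : ¬ InH u ((1 + x) * z) := by
    rw [hH.mul_iff hu.ne_zero h0]; exact hz.not_inH
  have hz0 := hz.ne_zero
  have hx0 := hx.ne_zero
  by_cases hxz : IsSquare (x * z)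
  swap
  · exact ⟨key z hz hxz, fun h => hnH (.inr h)⟩
  rcases hu.alt with ⟨rfl, hsp⟩ | ⟨s, hs⟩
  · by_contra hc
    have hw := hr.oMinus_of_not hnH hc
    refine hsp z z ⟨hz.1.1, ⟨z, rfl⟩, hz0, fun c hcP hzc => ?_⟩
    have hcM : OMinus 1 c := ⟨hcP, by simpa using hcP.1⟩
    have hc0 := hcP.ne_zero
    refine ⟨(hz.mul hr hu hcM (by simpa [InH] using hzc)).1, ?_⟩
    have h1 : OMinus 1 ((1 + x) * c) := by
      have h2 : P ((1 + x) * c) := key c hcM fun h =>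
        hzc (isSquare_of_mul_sq (h.mul hxz) hx0 (by ring))
      exact ⟨h2, by simpa using h2.1⟩
    have h3 : (1 + x) * c * ((1 + x) * z)⁻¹ = z⁻¹ * c := by field_simp
    have h4 : ¬ InH 1 (z⁻¹ * c) := by
      simp only [InH, one_mul, or_self]
      exact fun h => hzc (isSquare_of_mul_sq h (inv_ne_zero hz0) (by field_simp))
    have := h1.mul hr hu hw (by rwa [h3])
    rw [h3] at this
    exact this.1
  · have hu0 := hu.ne_zero
    have hs0 := hs.2.2.1
    have hz' : OMinus u (s⁻¹ * z) := by
      refine ⟨(hs.2.2.2 z hz.1 hz.2).2, fun h => hz.1.1 ?_⟩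
      exact isSquare_of_mul_sq (h.mul hs.2.1) hu0 (by field_simp)
    have h1 : P ((1 + x) * (s⁻¹ * z)) := key _ hz' fun h => hs.not_isSquare
      (isSquare_of_mul_sq (h.mul hxz) (mul_ne_zero (inv_ne_zero hs0) (mul_ne_zero hx0 hz0))
        (by field_simp))
    have h2 : ¬ IsSquare (u * ((1 + x) * (s⁻¹ * z))) := fun h => hz'.2
      (isSquare_of_mul_sq (h.mul hx.1.2) h0 (by ring))
    have h3 := (hs.2.2.2 _ h1 h2).1
    rw [show s * ((1 + x) * (s⁻¹ * z)) = (1 + x) * z by field_simp] at h3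
    exact ⟨h3, fun h => hnH (.inr h)⟩

theorem OMinus.one_add_inv (hr : IsRigid K) (hu : IsPivot u) {x : K} (hx : OMinus u x) :
    OPlus u (1 + x)⁻¹ := by
  have h0 := hr.one_add_ne hx.1.1
  have h1 : 1 + -x * (1 + x)⁻¹ = (1 + x)⁻¹ := by field_simp; ring
  have hy : OMinus u (-x * (1 + x)⁻¹) := by
    refine ⟨⟨fun h => hx.1.1 ?_, ?_⟩, fun h => hx.2 ?_⟩
    · exact isSquare_of_mul_sq ((h.mul hr.neg_one).mul hx.1.2) one_ne_zero (by field_simp)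
    · rw [h1, isSquare_inv_iff']; exact hx.1.2
    · exact isSquare_of_mul_sq ((h.mul hr.neg_one).mul hx.1.2) one_ne_zero (by field_simp)
  rw [← h1]
  exact hy.one_add hr hu

theorem OPlus.one_add (hr : IsRigid K) (hu : IsPivot u) {x : K} (hx : OPlus u x) :
    RigidRing u (1 + x) := by
  by_cases h0 : 1 + x = 0
  · exact .inl h0
  by_cases hH : InH u (1 + x)
  · by_contra hc
    simp only [RigidRing, not_or] at hc
    obtain ⟨z, hz, hy⟩ := exists_of_not_oPlus hr hu h0 hH hc.2.2
    have hq := hx.2.2 z hz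
    have hq' := (hz.one_add_inv hr hu).2.2 _ hq
    have n1 := hr.one_add_ne hz.1.1
    have hz0 := hz.ne_zero
    have h1 : IsSquare ((1 + z) * (1 + (1 + z)⁻¹ * (x * z))) := hz.1.2.mul hq'.1.2
    have h3 := hr.one_add_ne hy.1.1
    refine hy.1.1 (isSquare_of_mul_sq (h1.mul hy.1.2) (b := (1 + x) * z * (1 + ((1 + x) * z)⁻¹))
      (mul_ne_zero (mul_ne_zero h0 hz0) h3) ?_)
    field_simp
    ring
  · refine .inr (.inl ?_)
    by_contra hc
    have hy := hr.oMinus_of_not hH hc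
    have h1 := hx.2.2 _ hy
    have h2 := (hy.neg hr hu).1.2
    rw [show x * (1 + x)⁻¹ = 1 + -(1 + x)⁻¹ by field_simp; ring] at h1
    exact h1.1.1 h2

theorem RigidRing.add (hr : IsRigid K) (hu : IsPivot u) {x y : K} (hx : RigidRing u x)
    (hy : RigidRing u y) : RigidRing u (x + y) := by
  have one : ∀ x, RigidRing u x → RigidRing u (1 + x) := by
    rintro x (rfl | hx | hx)
    · refine .inr (.inr ⟨by simp, .inl (by simp), fun z hz => by simpa using hz⟩)
    · exact .inr (.inr (hx.one_add hr hu))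
    · exact hx.one_add hr hu
  by_cases hx0 : x = 0
  · simpa [hx0]
  by_cases hy0 : y = 0
  · simpa [hy0]
  rcases RigidRing.or_inv hr hu (x * y⁻¹) with h | h
  · rw [show x + y = y * (1 + x * y⁻¹) by field_simp; ring]
    exact hy.mul hr hu (one _ h)
  · rw [show x + y = x * (1 + (x * y⁻¹)⁻¹) by field_simp]
    exact hx.mul hr hu (one _ h)

/-- The valuation ring of a rigid field. -/
def rigidValuationSubring (hr : IsRigid K) (hu : IsPivot u) : ValuationSubring K where
  carrier := {x | RigidRing u x}
  mul_mem' := fun ha hb => RigidRing.mul hr hu ha hb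
  one_mem' := .inr (.inr ⟨by simp, .inl (by simp), fun z hz => by simpa using hz⟩)
  add_mem' := fun ha hb => RigidRing.add hr hu ha hb
  zero_mem' := .inl rfl
  neg_mem' := fun {x} hx => by
    have := RigidRing.mul hr hu (.inr (.inr (hu.oPlus_neg_one hr))) hx
    simpa using this
  mem_or_inv_mem' := RigidRing.or_inv hr hu

/-- A rigid field with at least four square classes carries a nontrivial valuation ring all of
whose `1`-units are squares. -/
theorem IsRigid.exists_valuationSubring (hr : IsRigid K) {a b : K} (ha : ¬ IsSquare a)
    (hb : ¬ IsSquare b) (hab : ¬ IsSquare (a * b)) :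
    ∃ A : ValuationSubring K, A ≠ ⊤ ∧ ∀ x ∈ A, x⁻¹ ∉ A → IsSquare (1 + x) := by
  obtain ⟨u, hu⟩ := hr.exists_pivot
  refine ⟨rigidValuationSubring hr hu, ?_, ?_⟩
  · obtain ⟨x, hx⟩ : ∃ x, ¬ InH u x := by
      by_contra hc
      push Not at hc
      rcases hc a with h | h
      · exact ha h
      rcases hc b with h' | h'
      · exact hb h'
      exact hab (isSquare_of_mul_sq (h.mul h') hu.ne_zero (by ring))
    obtain ⟨x, hx⟩ : ∃ x, OMinus u x :=
      (hr.oMinus_or hx).elim (fun h => ⟨x, h⟩) (fun h => ⟨_, h⟩)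
    intro h
    have h1 : x⁻¹ ∈ rigidValuationSubring hr hu := by rw [h]; trivial
    rcases h1 with h1 | h1 | h1
    · exact hx.ne_zero (by simpa using h1)
    · exact hx.inv_not hr h1
    · exact hx.not_inH (inH_inv_iff.1 h1.2.1)
  · rintro x (rfl | hx | hx) hxi
    · simp
    · exact hx.1.2
    · have hxn : ¬ OPlus u x⁻¹ := fun h => hxi (.inr (.inr h))
      obtain ⟨z, hz, hq⟩ := exists_of_not_oPlus hr hu (inv_ne_zero hx.1) hx.2.1.inv hxn
      have hz0 := hz.ne_zero
      have hx0 := hx.1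
      set q := (x⁻¹ * z)⁻¹ with hqd
      have e : x = z * q := by rw [hqd]; field_simp
      have n1 := hr.one_add_ne hq.1.1
      have n2 := hr.one_add_ne (hz.neg hr hu).1.1
      have h1 : ¬ IsSquare ((1 + -z) * (z * (1 + q))) := fun h => hz.1.1
        (isSquare_of_mul_sq ((h.mul hq.1.2).mul (hz.neg hr hu).1.2) (mul_ne_zero n1 n2) (by ring))
      have e2 : (1 + -z) + (z * (1 + q)) = 1 + x := by rw [e]; ring
      have h2 := hr.add h1
      rw [e2] at h2
      rcases h2 with h2 | h2
      · exact isSquare_of_mul_sq (h2.mul (hz.neg hr hu).1.2) n2 (by ring)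
      · exfalso
        have h3 : IsSquare (z * (1 + x)) := isSquare_of_mul_sq (h2.mul hq.1.2) n1 (by ring)
        have h5 : RigidRing u (1 + x) := hx.one_add hr hu
        have h4 : 1 + x ≠ 0 := by
          intro h4
          apply hxn
          rw [show x = -1 by linear_combination h4]
          simpa using hu.oPlus_neg_one hr
        rcases h5 with h5 | h5 | h5
        · exact h4 h5
        · have h6 := ((h5.neg hr hu).one_add_inv hr hu).mul hu (hu.oPlus_neg_one hr)
          rw [show (1 + -(1 + x))⁻¹ * -1 = x⁻¹ by rw [show 1 + -(1 + x) = -x by ring]; simp] at h6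
          exact hxn h6
        · rcases h5.2.1 with h7 | h7
          · exact hz.1.1 (isSquare_of_mul_sq (h3.mul h7) h4 (by ring))
          · exact hz.2 (isSquare_of_mul_sq (h3.mul h7) h4 (by ring))

end Rigid

open NumberField IsDedekindDomain
open scoped Pointwise

section Places

variable {Ω : Type*} [Field Ω] [CharZero Ω] [Algebra.IsAlgebraic ℚ Ω] [IsAlgClosed Ω]

theorem isGalois_rat : IsGalois ℚ Ω := by
  have : Normal ℚ Ω := normal_iff.2 fun x =>
    ⟨(Algebra.IsAlgebraic.isAlgebraic x).isIntegral, IsAlgClosed.splits _⟩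
  exact ⟨⟩

attribute [local instance] isGalois_rat

theorem valuation_smul_le_iff {g : Ω ≃ₐ[ℚ] Ω} {O : ValuationSubring Ω} (hg : g • O = O) (x : Ω) :
    O.valuation (g x) ≤ 1 ↔ O.valuation x ≤ 1 := by
  rw [O.valuation_le_one_iff, O.valuation_le_one_iff]
  nth_rewrite 1 [← hg]
  exact ValuationSubring.smul_mem_pointwise_smul_iff

theorem valuation_lt_iff_inv {K : Type*} [Field K] (O : ValuationSubring K) {x : K} (hx : x ≠ 0) :
    O.valuation x < 1 ↔ ¬ O.valuation x⁻¹ ≤ 1 := by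
  rw [map_inv₀, not_le, one_lt_inv₀ (by simpa [zero_lt_iff] using hx)]

theorem valuation_smul_lt_iff {g : Ω ≃ₐ[ℚ] Ω} {O : ValuationSubring Ω} (hg : g • O = O) (x : Ω) :
    O.valuation (g x) < 1 ↔ O.valuation x < 1 := by
  by_cases hx : x = 0
  · simp [hx]
  · rw [valuation_lt_iff_inv O hx, valuation_lt_iff_inv O (by simpa using hx), ← map_inv₀,
      valuation_smul_le_iff hg]

/-- Two valuation rings agreeing on membership have compatible valuations. -/
theorem valuation_lt_of_le_iff {K : Type*} [Field K] {O O' : ValuationSubring K} {x : K}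
    (h : x⁻¹ ∈ O ↔ x⁻¹ ∈ O') : O.valuation x < 1 ↔ O'.valuation x < 1 := by
  by_cases hx : x = 0
  · simp [hx]
  · rw [valuation_lt_iff_inv O hx, valuation_lt_iff_inv O' hx, O.valuation_le_one_iff,
      O'.valuation_le_one_iff, h]

theorem mem_of_isIntegral {K : Type*} [Field K] (O : ValuationSubring K) {x : K}
    (hx : IsIntegral ℤ x) : x ∈ O := by
  have h : IsIntegral O x := hx.tower_top
  obtain ⟨y, rfl⟩ := IsIntegrallyClosed.algebraMap_eq_of_integral h
  exact y.2

theorem valuation_int_le {K : Type*} [Field K] (O : ValuationSubring K) (x : 𝓞 K) :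
    O.valuation (x : K) ≤ 1 :=
  (O.valuation_le_one_iff _).2 (mem_of_isIntegral O x.2)

/-- The prime ideal of the ring of integers under a place. -/
def primeUnder {K : Type*} [Field K] (O : ValuationSubring K) : Ideal (𝓞 K) where
  carrier := {x | O.valuation (x : K) < 1}
  add_mem' := fun {a b} ha hb => (O.valuation.map_add a b).trans_lt (max_lt ha hb)
  zero_mem' := by simp
  smul_mem' := fun c x hx => by
    simp only [Set.mem_ofPred_eq, smul_eq_mul, map_mul]
    exact mul_lt_one_of_nonneg_of_lt_one_right (valuation_int_le O c) zero_le hx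

theorem mem_primeUnder {K : Type*} [Field K] {O : ValuationSubring K} {x : 𝓞 K} :
    x ∈ primeUnder O ↔ O.valuation (x : K) < 1 := Iff.rfl

instance {K : Type*} [Field K] (O : ValuationSubring K) : (primeUnder O).IsPrime := by
  refine ⟨fun h => ?_, fun {x y} h => ?_⟩
  · have := (Ideal.eq_top_iff_one _).1 h
    simp [mem_primeUnder] at this
  · simp only [mem_primeUnder, map_mul] at h ⊢
    by_contra! hc
    exact absurd h (not_lt.2 (one_le_mul hc.1 hc.2))

theorem exists_heightOneSpectrum {K : Type*} [Field K] [NumberField K] {O : ValuationSubring K}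
    (hO : O ≠ ⊤) : ∃ P : HeightOneSpectrum (𝓞 K), P.asIdeal = primeUnder O ∧
      ∀ x : K, O.valuation x ≤ 1 ↔ P.valuation K x ≤ 1 := by
  have hne : primeUnder O ≠ ⊥ := by
    intro h
    apply hO
    rw [eq_top_iff]
    intro x _
    obtain ⟨a, b, hb, rfl⟩ := IsFractionRing.div_surjective (A := 𝓞 K) x
    have hb0 : b ≠ 0 := nonZeroDivisors.ne_zero hb
    have : b ∉ primeUnder O := by rwa [h]
    rw [mem_primeUnder, not_lt] at this
    rw [← O.valuation_le_one_iff, map_div₀]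
    exact div_le_one_of_le₀ ((valuation_int_le O a).trans this) zero_le
  let P : HeightOneSpectrum (𝓞 K) := ⟨primeUnder O, inferInstance, hne⟩
  have key : ∀ x : K, P.valuation K x ≤ 1 → O.valuation x ≤ 1 := by
    intro x hx
    obtain ⟨n, d, h⟩ := HeightOneSpectrum.exists_primeCompl_mul_eq_of_integer P x hx
    have hd : ¬ O.valuation ((d : 𝓞 K) : K) < 1 := d.2
    have h1 : O.valuation ((d : 𝓞 K) : K) = 1 := le_antisymm (valuation_int_le O _) (not_lt.1 hd)
    have h2 := congrArg O.valuation h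
    rw [map_mul] at h2
    erw [h1] at h2
    rw [mul_one] at h2
    rw [h2]
    exact valuation_int_le O n
  have key2 : ∀ x : K, P.valuation K x < 1 → O.valuation x < 1 := by
    intro x hx
    obtain ⟨n, d, h⟩ := HeightOneSpectrum.exists_primeCompl_mul_eq_of_integer P x hx.le
    have hd : ¬ O.valuation ((d : 𝓞 K) : K) < 1 := d.2
    have h1 : O.valuation ((d : 𝓞 K) : K) = 1 := le_antisymm (valuation_int_le O _) (not_lt.1 hd)
    have h2 := congrArg O.valuation h
    rw [map_mul] at h2
    erw [h1] at h2
    rw [mul_one] at h2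
    rw [h2]
    have h3 := congrArg (P.valuation K) h
    rw [map_mul] at h3
    have h4 : P.valuation K (algebraMap (𝓞 K) K n) < 1 := by
      rw [← h3]
      exact mul_lt_one_of_nonneg_of_lt_one_left zero_le hx (P.valuation_le_one _)
    rw [P.valuation_lt_one_iff_mem] at h4
    exact h4
  refine ⟨P, rfl, fun x => ⟨fun h => ?_, key x⟩⟩
  by_contra hc
  have hx : x ≠ 0 := by rintro rfl; simp at hc
  have := key2 x⁻¹ (by rw [map_inv₀]; exact inv_lt_one_of_one_lt₀ (not_le.1 hc))
  rw [valuation_lt_iff_inv O (inv_ne_zero hx), inv_inv] at this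
  exact this h

/-- The restriction of a place to an intermediate field. -/
def restrictPlace (O : ValuationSubring Ω) (E : IntermediateField ℚ Ω) : ValuationSubring E :=
  O.comap (algebraMap E Ω)

theorem mem_restrictPlace {O : ValuationSubring Ω} {E : IntermediateField ℚ Ω} {x : E} :
    x ∈ restrictPlace O E ↔ (x : Ω) ∈ O := Iff.rfl

theorem restrictPlace_le {O : ValuationSubring Ω} {E : IntermediateField ℚ Ω} {x : E} :
    (restrictPlace O E).valuation x ≤ 1 ↔ O.valuation (x : Ω) ≤ 1 := by
  rw [ValuationSubring.valuation_le_one_iff, ValuationSubring.valuation_le_one_iff]; rfl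

theorem restrictPlace_lt {O : ValuationSubring Ω} {E : IntermediateField ℚ Ω} {x : E} :
    (restrictPlace O E).valuation x < 1 ↔ O.valuation (x : Ω) < 1 := by
  by_cases hx : x = 0
  · simp [hx]
  · rw [valuation_lt_iff_inv _ hx, valuation_lt_iff_inv O (by simpa using hx), restrictPlace_le]
    simp

theorem restrictPlace_ne_top {O : ValuationSubring Ω} (hO : O ≠ ⊤) (E : IntermediateField ℚ Ω) :
    restrictPlace O E ≠ ⊤ := by
  intro h
  apply hO
  rw [eq_top_iff]
  intro x _
  have hE : ∀ y : E, (y : Ω) ∈ O := fun y => by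
    rw [← mem_restrictPlace, h]; trivial
  have : IsIntegral ℚ x := (Algebra.IsAlgebraic.isAlgebraic x).isIntegral
  let φ : ℚ →+* O := (algebraMap ℚ Ω).codRestrict O.toSubring fun q => hE (algebraMap ℚ E q)
  obtain ⟨p, hp, hp2⟩ := this
  have h2 : IsIntegral O x := ⟨p.map φ, hp.map _, by
    rw [Polynomial.eval₂_map]; exact hp2⟩
  obtain ⟨y, rfl⟩ := IsIntegrallyClosed.algebraMap_eq_of_integral h2
  exact y.2

theorem valuation_eq_one_iff_inv {K : Type*} [Field K] (O : ValuationSubring K) {x : K} :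
    O.valuation x = 1 ↔ x ≠ 0 ∧ O.valuation x ≤ 1 ∧ O.valuation x⁻¹ ≤ 1 := by
  by_cases hx : x = 0
  · simp [hx]
  have h : O.valuation x⁻¹ ≤ 1 ↔ ¬ O.valuation x < 1 := by
    rw [valuation_lt_iff_inv O hx, not_not]
  rw [h, not_lt, le_antisymm_iff]
  simp [hx]

section NumberField

variable {O : ValuationSubring Ω} (E : IntermediateField ℚ Ω) [FiniteDimensional ℚ E]

theorem numberField_of_finiteDimensional : NumberField E where
  to_charZero := inferInstance
  to_finiteDimensional := by convert (inferInstance : FiniteDimensional ℚ E)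

attribute [local instance] numberField_of_finiteDimensional

theorem exists_prime_place (hO : O ≠ ⊤) : ∃ P : HeightOneSpectrum (𝓞 E),
    P.asIdeal = primeUnder (restrictPlace O E) ∧
      (∀ x : E, O.valuation (x : Ω) ≤ 1 ↔ P.valuation E x ≤ 1) ∧
      (∀ x : E, O.valuation (x : Ω) < 1 ↔ P.valuation E x < 1) ∧
      (∀ x : E, O.valuation (x : Ω) = 1 ↔ P.valuation E x = 1) := by
  obtain ⟨P, h1, h2⟩ := exists_heightOneSpectrum (restrictPlace_ne_top hO E)
  have h3 : ∀ x : E, O.valuation (x : Ω) ≤ 1 ↔ P.valuation E x ≤ 1 := fun x => by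
    rw [← h2, restrictPlace_le]
  have h4 : ∀ x : E, O.valuation (x : Ω) < 1 ↔ P.valuation E x < 1 := fun x => by
    by_cases hx : x = 0
    · simp [hx]
    rw [valuation_lt_iff_inv O (by simpa using hx), ← IntermediateField.coe_inv, h3, not_le,
      map_inv₀, one_lt_inv₀ (by simpa [zero_lt_iff] using hx)]
  refine ⟨P, h1, h3, h4, fun x => ?_⟩
  rw [eq_iff_le_not_lt, eq_iff_le_not_lt, h3, h4]

theorem exists_uniformizer (hO : O ≠ ⊤) : ∃ π ∈ E, π ≠ 0 ∧ O.valuation π < 1 ∧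
    ∀ x ∈ E, x ≠ 0 → ∃ n : ℤ, O.valuation (x * π ^ n) = 1 := by
  obtain ⟨P, -, -, h2, h3⟩ := exists_prime_place E hO
  obtain ⟨π, hπ⟩ := P.valuation_exists_uniformizer E
  have h0 : π ≠ 0 := by rintro rfl; rw [map_zero] at hπ; exact WithZero.exp_ne_zero hπ.symm
  refine ⟨π, π.2, by simpa using h0, ?_, fun x hx hx0 => ?_⟩
  · rw [h2, hπ, ← WithZero.exp_zero, WithZero.exp_lt_exp]; simp
  · have hne : P.valuation E ⟨x, hx⟩ ≠ 0 := by
      rw [Valuation.ne_zero_iff]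
      exact fun h => hx0 (congrArg Subtype.val h)
    refine ⟨WithZero.log (P.valuation E ⟨x, hx⟩), ?_⟩
    have := (h3 (⟨x, hx⟩ * π ^ (WithZero.log (P.valuation E ⟨x, hx⟩)))).2 (by
      rw [map_mul, map_zpow₀, hπ, ← WithZero.exp_zsmul]
      nth_rewrite 1 [← WithZero.exp_log hne]
      rw [← WithZero.exp_add]
      simp)
    have e : (((⟨x, hx⟩ : E) * π ^ (WithZero.log (P.valuation E ⟨x, hx⟩)) : E) : Ω) =
        x * (π : Ω) ^ (WithZero.log (P.valuation E ⟨x, hx⟩)) := by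
      have := map_zpow₀ (algebraMap E Ω) π (WithZero.log (P.valuation E ⟨x, hx⟩))
      exact congrArg (x * ·) this
    rwa [e] at this

/-- The residue field is finite, so its units are the powers of one element. -/
theorem exists_residue_generator (hO : O ≠ ⊤) : ∃ ζ ∈ E, O.valuation ζ = 1 ∧
    ∀ x ∈ E, O.valuation x = 1 → ∃ k : ℕ, O.valuation (x - ζ ^ k) < 1 := by
  obtain ⟨P, h0, -, h2, h3⟩ := exists_prime_place E hO
  have := P.isMaximal
  let k := 𝓞 E ⧸ P.asIdeal
  let : Field k := Ideal.Quotient.field _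
  have : Finite k := Ideal.finiteQuotientOfFreeOfNeBot _ P.ne_bot
  obtain ⟨g, hg⟩ := IsCyclic.exists_generator (α := kˣ)
  obtain ⟨ζ, hζ⟩ := Ideal.Quotient.mk_surjective (g : k)
  have hu : ∀ a : 𝓞 E, a ∉ P.asIdeal ↔ O.valuation ((a : E) : Ω) = 1 := fun a => by
    rw [h3, HeightOneSpectrum.valuation_eq_one_iff_notMem]
  refine ⟨ζ, (ζ : E).2, ?_, fun x hx hx1 => ?_⟩
  · rw [← hu, ← Ideal.Quotient.eq_zero_iff_mem, hζ]
    exact g.ne_zero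
  · obtain ⟨n, d, h⟩ := HeightOneSpectrum.exists_primeCompl_mul_eq_of_integer P (⟨x, hx⟩ : E)
      ((h3 ⟨x, hx⟩).1 hx1).le
    have hd := (hu _).1 d.2
    have h' : x * (((d : 𝓞 E) : E) : Ω) = ((n : E) : Ω) := congrArg Subtype.val h
    have hn : O.valuation ((n : E) : Ω) = 1 := by rw [← h', map_mul, hx1, hd, one_mul]
    have hd' : (Ideal.Quotient.mk P.asIdeal d : k) ≠ 0 := by
      rw [Ne, Ideal.Quotient.eq_zero_iff_mem]; exact d.2
    have hn' : (Ideal.Quotient.mk P.asIdeal n : k) ≠ 0 := by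
      rw [Ne, Ideal.Quotient.eq_zero_iff_mem]; exact (hu n).2 hn
    obtain ⟨m, hm⟩ := (mem_powers_iff_mem_zpowers (x := g)).2
      (hg (Units.mk0 _ hn' / Units.mk0 _ hd'))
    refine ⟨m, ?_⟩
    have hm' : (Ideal.Quotient.mk P.asIdeal (n - d * ζ ^ m) : k) = 0 := by
      have : (g : k) ^ m = Ideal.Quotient.mk P.asIdeal n / Ideal.Quotient.mk P.asIdeal d := by
        simpa using congrArg Units.val hm
      rw [map_sub, map_mul, map_pow, hζ, this]
      rw [mul_div_cancel₀ _ hd', sub_self]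
    rw [Ideal.Quotient.eq_zero_iff_mem, ← P.valuation_lt_one_iff_mem (K := E), ← h2] at hm'
    have e : x - ((ζ : E) : Ω) ^ m =
        (((algebraMap (𝓞 E) E (n - d * ζ ^ m) : E)) : Ω) / (((d : 𝓞 E) : E) : Ω) := by
      have hd0 : (((d : 𝓞 E) : E) : Ω) ≠ 0 := by
        intro h; rw [h] at hd; simp at hd
      rw [eq_div_iff hd0]
      push_cast [map_sub, map_mul, map_pow]
      rw [← h']; ring
    rw [e, map_div₀, hd, div_one]
    exact hm'

end NumberField

end Places

section Approximation

variable {Ω : Type*} [Field Ω] [CharZero Ω] [Algebra.IsAlgebraic ℚ Ω] [IsAlgClosed Ω]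

attribute [local instance] isGalois_rat numberField_of_finiteDimensional

/-- Weak approximation at finitely many places of a number field. -/
theorem exists_approx {O : ValuationSubring Ω} (E : IntermediateField ℚ Ω) [FiniteDimensional ℚ E]
    (hO : O ≠ ⊤) (S : Finset (ValuationSubring Ω))
    (hS : ∀ O' ∈ S, O' ≠ ⊤ ∧ ∃ x ∈ E, ¬ (x ∈ O ↔ x ∈ O')) (x : Ω) (hx : x ∈ E) :
    ∃ e ∈ E, O.valuation ((e - 1) * x) < 1 ∧ ∀ O' ∈ S, O'.valuation (e * x) < 1 := by
  classical
  let Q : ValuationSubring Ω → Ideal (𝓞 E) := fun O' => primeUnder (restrictPlace O' E)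
  have hN : ∀ O' : ValuationSubring Ω, O' ≠ ⊤ → ∃ N : ℕ, ∀ n, N ≤ n → ∀ b ∈ Q O' ^ n,
      O'.valuation (((b : 𝓞 E) : E) * x) < 1 := by
    intro O' hO'
    obtain ⟨P, h0, -, h2, -⟩ := exists_prime_place E hO'
    by_cases hx0 : x = 0
    · exact ⟨0, fun n _ b _ => by simp [hx0]⟩
    have hne : P.valuation E ⟨x, hx⟩ ≠ 0 := by
      rw [Valuation.ne_zero_iff]
      exact fun h => hx0 (congrArg Subtype.val h)
    refine ⟨(WithZero.log (P.valuation E ⟨x, hx⟩)).toNat + 1, fun n hn b hb => ?_⟩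
    have hb' : P.valuation E b ≤ WithZero.exp (-(n : ℤ)) := by
      rw [HeightOneSpectrum.valuation_of_algebraMap]
      exact (P.intValuation_le_pow_iff_mem b n).2 (by rwa [h0])
    have := (h2 (b * ⟨x, hx⟩)).2 (by
      rw [map_mul]
      refine (mul_le_mul_left hb' _).trans_lt ?_
      have h5 : P.valuation E ⟨x, hx⟩ = WithZero.exp (WithZero.log (P.valuation E ⟨x, hx⟩)) :=
        (WithZero.exp_log hne).symm
      rw [h5, ← WithZero.exp_add, ← WithZero.exp_zero, WithZero.exp_lt_exp]
      have := Int.self_le_toNat (WithZero.log (P.valuation E ⟨x, hx⟩))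
      omega)
    exact this
  have hne : ∀ O' ∈ S, Q O' ≠ Q O := by
    intro O' hO' h
    obtain ⟨hO', y, hy, hyn⟩ := hS O' hO'
    obtain ⟨P, h0, h1, -⟩ := exists_prime_place E hO
    obtain ⟨P', h0', h1', -⟩ := exists_prime_place E hO'
    have : P = P' := HeightOneSpectrum.ext (by rw [h0, h0']; exact h.symm)
    subst this
    apply hyn
    rw [← O.valuation_le_one_iff, ← O'.valuation_le_one_iff]
    exact (h1 ⟨y, hy⟩).trans (h1' ⟨y, hy⟩).symm
  have hT : ∀ O' ∈ insert O S, O' ≠ ⊤ := by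
    intro O' h
    rcases Finset.mem_insert.1 h with rfl | h
    exacts [hO, (hS _ h).1]
  choose! N hN using hN
  let M := (insert O S).sup N
  have hp : ∀ I ∈ (insert O S).image Q, Prime I := by
    intro I hI
    obtain ⟨O', h, rfl⟩ := Finset.mem_image.1 hI
    obtain ⟨P, h0, -⟩ := exists_prime_place E (hT O' h)
    change Prime (primeUnder _)
    rw [← h0]
    exact P.prime
  obtain ⟨y, hy⟩ := IsDedekindDomain.exists_forall_sub_mem_ideal (s := (insert O S).image Q) id
    (fun _ => M) hp (fun i _ j _ h => h) (fun i => if i.1 = Q O then 1 else 0)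
  refine ⟨((y : E) : Ω), (y : E).2, ?_, fun O' hO' => ?_⟩
  · have h1 := hy (Q O) (Finset.mem_image_of_mem _ (Finset.mem_insert_self _ _))
    simp only [if_true, id] at h1
    have := hN O hO M (Finset.le_sup (Finset.mem_insert_self _ _)) _ h1
    simpa using this
  · have h1 := hy (Q O') (Finset.mem_image_of_mem _ (Finset.mem_insert_of_mem hO'))
    simp only [hne O' hO', if_false, id, sub_zero] at h1
    exact hN O' (hS _ hO').1 M (Finset.le_sup (Finset.mem_insert_of_mem hO')) _ h1

/-- A place is determined by its prime in the ring of all algebraic integers. -/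
theorem le_of_primeUnder_eq {O O' : ValuationSubring Ω} (hO : O ≠ ⊤)
    (h : primeUnder O = primeUnder O') : O ≤ O' := by
  intro x hx
  let E : IntermediateField ℚ Ω := IntermediateField.adjoin ℚ {x}
  have : FiniteDimensional ℚ E :=
    IntermediateField.adjoin.finiteDimensional (Algebra.IsAlgebraic.isAlgebraic x).isIntegral
  have hxE : x ∈ E := IntermediateField.mem_adjoin_simple_self ℚ x
  obtain ⟨P, h0, h1, -, h3⟩ := exists_prime_place E hO
  obtain ⟨n, d, e⟩ := HeightOneSpectrum.exists_primeCompl_mul_eq_of_integer P (⟨x, hxE⟩ : E)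
    ((h1 _).1 ((O.valuation_le_one_iff _).2 hx))
  have e' : x * (((d : 𝓞 E) : E) : Ω) = ((n : E) : Ω) := congrArg Subtype.val e
  have hd : (((d : 𝓞 E) : E) : Ω) ∈ O ∧ ¬ O.valuation (((d : 𝓞 E) : E) : Ω) < 1 := by
    have := d.2
    rw [← restrictPlace_lt]
    refine ⟨mem_of_isIntegral O ?_, ?_⟩
    · exact (d : 𝓞 E).2.map (IsScalarTower.toAlgHom ℤ E Ω)
    · intro h'
      have h6 : (d : 𝓞 E) ∈ primeUnder (restrictPlace O E) := h'
      exact d.2 (h0.ge h6)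
  have hInt : ∀ a : 𝓞 E, IsIntegral ℤ (((a : E) : Ω)) := fun a =>
    a.2.map (IsScalarTower.toAlgHom ℤ E Ω)
  have hd' : ¬ O'.valuation (((d : 𝓞 E) : E) : Ω) < 1 := fun h' => hd.2
    (by
      have : (⟨_, hInt d⟩ : 𝓞 Ω) ∈ primeUnder O' := h'
      rw [← h] at this
      exact this)
  have h1' : O'.valuation (((d : 𝓞 E) : E) : Ω) = 1 :=
    le_antisymm ((O'.valuation_le_one_iff _).2 (mem_of_isIntegral O' (hInt d))) (not_lt.1 hd')
  rw [← O'.valuation_le_one_iff]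
  have := congrArg O'.valuation e'
  rw [map_mul, h1', mul_one] at this
  rw [this, O'.valuation_le_one_iff]
  exact mem_of_isIntegral O' (hInt n)

theorem eq_of_primeUnder_eq {O O' : ValuationSubring Ω} (hO : O ≠ ⊤) (hO' : O' ≠ ⊤)
    (h : primeUnder O = primeUnder O') : O = O' :=
  le_antisymm (le_of_primeUnder_eq hO h) (le_of_primeUnder_eq hO' h.symm)

theorem smul_ne_top {O : ValuationSubring Ω} (hO : O ≠ ⊤) (g : Ω ≃ₐ[ℚ] Ω) : g • O ≠ ⊤ := by
  intro h
  apply hO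
  rw [eq_top_iff]
  intro x _
  have : g • x ∈ g • O := by rw [h]; trivial
  exact ValuationSubring.smul_mem_pointwise_smul_iff.1 this

theorem isOpen_stabilizer (x : Ω) : IsOpen (MulAction.stabilizer (Ω ≃ₐ[ℚ] Ω) x : Set (Ω ≃ₐ[ℚ] Ω)) := by
  have : FiniteDimensional ℚ (IntermediateField.adjoin ℚ {x}) :=
    IntermediateField.adjoin.finiteDimensional (Algebra.IsAlgebraic.isAlgebraic x).isIntegral
  refine Subgroup.isOpen_mono (H₁ := (IntermediateField.adjoin ℚ {x}).fixingSubgroup) ?_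
    (IntermediateField.fixingSubgroup_isOpen _)
  intro g hg
  exact hg ⟨x, IntermediateField.mem_adjoin_simple_self ℚ x⟩

theorem valuation_smul {g : Ω ≃ₐ[ℚ] Ω} {O : ValuationSubring Ω} (x : Ω) :
    (g • O).valuation (g x) ≤ 1 ↔ O.valuation x ≤ 1 := by
  rw [ValuationSubring.valuation_le_one_iff, ValuationSubring.valuation_le_one_iff]
  exact ValuationSubring.smul_mem_pointwise_smul_iff

theorem valuation_smul_lt {g : Ω ≃ₐ[ℚ] Ω} {O : ValuationSubring Ω} (x : Ω) :
    (g • O).valuation (g x) < 1 ↔ O.valuation x < 1 := by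
  by_cases hx : x = 0
  · simp [hx]
  · rw [valuation_lt_iff_inv _ (by simpa using hx), valuation_lt_iff_inv O hx, ← map_inv₀,
      valuation_smul]

/-- The Galois group of a field acts transitively on the places above a given one. -/
theorem exists_smul_eq {O O' : ValuationSubring Ω} (E : IntermediateField ℚ Ω)
    (hO : O ≠ ⊤) (hO' : O' ≠ ⊤) (h : ∀ x ∈ E, x ∈ O ↔ x ∈ O') :
    ∃ g ∈ E.fixingSubgroup, g • O = O' := by
  let Γ := E.fixingSubgroup
  have hcl : IsClosed (E.fixingSubgroup : Set (Ω ≃ₐ[ℚ] Ω)) := InfiniteGalois.fixingSubgroup_isClosed E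
  have : CompactSpace Γ := isCompact_iff_compactSpace.1 hcl.isCompact
  let : TopologicalSpace (𝓞 Ω) := ⊥
  have : DiscreteTopology (𝓞 Ω) := ⟨rfl⟩
  have : ContinuousSMul Γ (𝓞 Ω) := by
    rw [continuousSMul_iff_stabilizer_isOpen]
    intro x
    have := (isOpen_stabilizer (x : Ω)).preimage (continuous_subtype_val : Continuous (Subtype.val : Γ → _))
    convert this using 1
    ext g
    simp only [SetLike.mem_coe, MulAction.mem_stabilizer_iff, Set.mem_preimage]
    exact Subtype.ext_iff
  have : SMulCommClass Γ (𝓞 E) (𝓞 Ω) := by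
    refine ⟨fun g a b => Subtype.ext ?_⟩
    change g.1 (((a : E) : Ω) * (b : Ω)) = ((a : E) : Ω) * g.1 (b : Ω)
    rw [map_mul]
    congr 1
    exact g.2 (a : E)
  have : Algebra.IsInvariant (𝓞 E) (𝓞 Ω) Γ := by
    refine ⟨fun b hb => ?_⟩
    have h1 : (b : Ω) ∈ E := by
      rw [← InfiniteGalois.fixedField_fixingSubgroup E]
      intro g
      exact congrArg Subtype.val (hb g)
    have h2 : IsIntegral ℤ (⟨b, h1⟩ : E) := by
      have := b.2
      exact (isIntegral_algHom_iff (IsScalarTower.toAlgHom ℤ E Ω)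
        (algebraMap E Ω).injective).1 this
    exact ⟨⟨_, h2⟩, Subtype.ext rfl⟩
  obtain ⟨g, hg⟩ := Algebra.IsInvariant.exists_smul_of_under_eq_of_profinite (A := 𝓞 E) (G := Γ)
    (primeUnder O) (primeUnder O') (by
      ext x
      change O.valuation ((x : E) : Ω) < 1 ↔ O'.valuation ((x : E) : Ω) < 1
      exact valuation_lt_of_le_iff (h _ (inv_mem (x : E).2)))
  refine ⟨g.1, g.2, eq_of_primeUnder_eq (smul_ne_top hO _) hO' ?_⟩
  rw [hg]
  ext x
  rw [Ideal.mem_pointwise_smul_iff_inv_smul_mem]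
  change (g.1 • O).valuation (x : Ω) < 1 ↔ O.valuation ((g.1)⁻¹ (x : Ω)) < 1
  rw [← valuation_smul_lt (g := g.1) (O := O) ((g.1)⁻¹ (x : Ω))]
  rw [show g.1 ((g.1)⁻¹ (x : Ω)) = x from AlgEquiv.apply_symm_apply g.1 _]

end Approximation

section Density

variable {Ω : Type*} [Field Ω] [CharZero Ω] [Algebra.IsAlgebraic ℚ Ω] [IsAlgClosed Ω]

attribute [local instance] isGalois_rat numberField_of_finiteDimensional

/-- An element fixed by the decomposition group of a place over `E` is approximated by elements
of `E`. -/
theorem exists_near {O : ValuationSubring Ω} (E : IntermediateField ℚ Ω) [FiniteDimensional ℚ E]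
    (hO : O ≠ ⊤) {y c : Ω} (hc : c ∈ E)
    (hy : ∀ g ∈ E.fixingSubgroup, g • O = O → g y = y) :
    ∃ f ∈ E, O.valuation ((y - f) * c) < 1 := by
  classical
  let E' : IntermediateField E Ω := IntermediateField.adjoin E {y}
  have hyE' : y ∈ E' := IntermediateField.mem_adjoin_simple_self E y
  have hfin : FiniteDimensional E E' :=
    IntermediateField.adjoin.finiteDimensional (Algebra.IsAlgebraic.isAlgebraic y).isIntegral
  let E1 : IntermediateField ℚ Ω := E'.restrictScalars ℚ
  have hfin1 : FiniteDimensional ℚ E1 := by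
    have : FiniteDimensional ℚ E' := FiniteDimensional.trans ℚ E E'
    exact this
  have hlift : ∀ σ : E' →ₐ[E] Ω, ∃ g ∈ E.fixingSubgroup, ∀ x : E', g x = σ x := by
    intro σ
    obtain ⟨φ, hφ⟩ := IntermediateField.exists_algHom_of_splits (F := E) (E := Ω) (K := Ω)
      (fun s => ⟨(Algebra.IsAlgebraic.isAlgebraic s).isIntegral, IsAlgClosed.splits _⟩) σ
    let ψ : Ω ≃ₐ[E] Ω := AlgEquiv.ofBijective φ (Algebra.IsAlgebraic.algHom_bijective φ)
    refine ⟨ψ.restrictScalars ℚ, fun x => ψ.commutes x, fun x => ?_⟩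
    exact DFunLike.congr_fun hφ x
  choose L hLE hL using hlift
  let S : Finset (ValuationSubring Ω) :=
    ((Finset.univ : Finset (E' →ₐ[E] Ω)).erase E'.val).image fun σ => (L σ)⁻¹ • O
  obtain ⟨e, he, h1, h2⟩ := exists_approx (O := O) E1 hO S (by
    intro O' hO'
    obtain ⟨σ, hσ, rfl⟩ := Finset.mem_image.1 hO'
    refine ⟨smul_ne_top hO _, ?_⟩
    by_contra! hcon
    obtain ⟨h, hh, hh2⟩ := exists_smul_eq E1 hO (smul_ne_top hO (L σ)⁻¹) hcon
    have hfix : (L σ * h) • O = O := by rw [mul_smul, hh2, smul_inv_smul]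
    have hE : ∀ x ∈ E, x ∈ E1 := fun x hx => E'.algebraMap_mem ⟨x, hx⟩
    have := hy (L σ * h) (mul_mem (hLE σ) fun x => hh ⟨x, hE x x.2⟩) hfix
    have hyσ : σ ⟨y, hyE'⟩ = y := by
      rw [← hL]
      have h3 : h y = y := hh ⟨y, hyE'⟩
      rwa [AlgEquiv.mul_apply, h3] at this
    refine (Finset.mem_erase.1 hσ).1 ?_
    exact IntermediateField.algHom_ext_of_eq_adjoin _ (S := E') (s := {y}) rfl (by
      rintro x rfl
      exact hyσ)) (y * c) (E1.mul_mem hyE' (E'.algebraMap_mem ⟨c, hc⟩))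
  let z : E' := ⟨e * y, E'.mul_mem he hyE'⟩
  have htr := trace_eq_sum_embeddings (K := E) (L := E') Ω (x := z)
  refine ⟨(Algebra.trace E E' z : E), (Algebra.trace E E' z).2, ?_⟩
  have htr' : ((Algebra.trace E E' z : E) : Ω) = e * y + ∑ σ ∈ 
      (Finset.univ : Finset (E' →ₐ[E] Ω)).erase E'.val, σ z := by
    change algebraMap E Ω _ = _
    rw [htr, ← Finset.add_sum_erase Finset.univ _ (Finset.mem_univ E'.val)]
    rfl
  rw [htr', show (y - (e * y + ∑ σ ∈ 
      (Finset.univ : Finset (E' →ₐ[E] Ω)).erase E'.val, σ z)) * c = -((e - 1) * (y * c)) +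
      -(∑ σ ∈ (Finset.univ : Finset (E' →ₐ[E] Ω)).erase E'.val, σ z * c) by
    rw [← Finset.sum_mul]; ring]
  refine (O.valuation.map_add _ _).trans_lt (max_lt (by rwa [Valuation.map_neg]) ?_)
  rw [Valuation.map_neg]
  refine Valuation.map_sum_lt _ one_ne_zero fun σ hσ => ?_
  have h3 := h2 _ (Finset.mem_image_of_mem _ hσ)
  rw [← valuation_smul_lt (g := L σ), smul_inv_smul] at h3
  have h4 : (L σ) (e * (y * c)) = σ z * c := by
    have : L σ c = c := hLE σ ⟨c, hc⟩
    rw [← hL, ← mul_assoc, map_mul, this]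
  rwa [h4] at h3

end Density

section OneUnits

variable {K : Type*} [Field K] {O : ValuationSubring K}

theorem valuation_eq_one_of_near {x y : K} (hy : O.valuation y = 1) (h : O.valuation (x - y) < 1) :
    O.valuation x = 1 := by
  have := Valuation.map_add_eq_of_lt_right O.valuation (x := x - y) (y := y) (by rwa [hy])
  rwa [sub_add_cancel, hy] at this

theorem valuation_eq_one_of_near_one {x : K} (h : O.valuation (x - 1) < 1) : O.valuation x = 1 :=
  valuation_eq_one_of_near (map_one _) h

theorem near_one_mul {x y : K} (hx : O.valuation (x - 1) < 1) (hy : O.valuation (y - 1) < 1) :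
    O.valuation (x * y - 1) < 1 := by
  rw [show x * y - 1 = (x - 1) * y + (y - 1) by ring]
  refine (O.valuation.map_add _ _).trans_lt (max_lt ?_ hy)
  rwa [map_mul, valuation_eq_one_of_near_one hy, mul_one]

theorem near_one_pow {x : K} (hx : O.valuation (x - 1) < 1) (n : ℕ) :
    O.valuation (x ^ n - 1) < 1 := by
  induction n with
  | zero => simp
  | succ n ih => rw [pow_succ]; exact near_one_mul ih hx

theorem near_one_inv {x : K} (hx : O.valuation (x - 1) < 1) : O.valuation (x⁻¹ - 1) < 1 := by
  have h1 := valuation_eq_one_of_near_one hx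
  have h0 : x ≠ 0 := by rintro rfl; simp at h1
  rw [show x⁻¹ - 1 = -((x - 1) / x) by field_simp; ring, Valuation.map_neg, map_div₀, h1, div_one]
  exact hx

theorem near_one_div {x y : K} (hy : O.valuation y = 1) (h : O.valuation (x - y) < 1) :
    O.valuation (x / y - 1) < 1 := by
  have h0 : y ≠ 0 := by rintro rfl; simp at hy
  rw [show x / y - 1 = (x - y) / y by field_simp, map_div₀, hy, div_one]
  exact h

theorem near_trans {x y z : K} (h : O.valuation (x - y) < 1) (h' : O.valuation (y - z) < 1) :
    O.valuation (x - z) < 1 := by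
  rw [show x - z = (x - y) + (y - z) by ring]
  exact (O.valuation.map_add _ _).trans_lt (max_lt h h')

theorem near_symm {x y : K} (h : O.valuation (x - y) < 1) : O.valuation (y - x) < 1 := by
  rwa [Valuation.map_sub_swap]

theorem near_mul {x y x' y' : K} (hx : O.valuation x ≤ 1) (hy' : O.valuation y' ≤ 1)
    (h : O.valuation (x - x') < 1) (h' : O.valuation (y - y') < 1) :
    O.valuation (x * y - x' * y') < 1 := by
  rw [show x * y - x' * y' = x * (y - y') + (x - x') * y' by ring]
  refine (O.valuation.map_add _ _).trans_lt (max_lt ?_ ?_) <;> rw [map_mul]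
  · exact mul_lt_one_of_nonneg_of_lt_one_right hx zero_le h'
  · exact mul_lt_one_of_nonneg_of_lt_one_left zero_le h hy'

theorem root_near_one_unique {l : ℕ} (hl : O.valuation (l : K) = 1) {y z : K}
    (hy : O.valuation (y - 1) < 1) (hz : O.valuation (z - 1) < 1) (h : y ^ l = z ^ l) : y = z := by
  have hz1 := valuation_eq_one_of_near_one hz
  have hz0 : z ≠ 0 := by rintro rfl; simp at hz1
  set ζ := y * z⁻¹ with hζ
  have hζ1 : O.valuation (ζ - 1) < 1 := near_one_mul hy (near_one_inv hz)
  have hζl : ζ ^ l = 1 := by rw [hζ, mul_pow, h, inv_pow, mul_inv_cancel₀ (pow_ne_zero _ hz0)]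
  have hg := mul_neg_geom_sum ζ l
  rw [hζl, sub_self, mul_eq_zero] at hg
  rcases hg with hg | hg
  · have : ζ = 1 := (sub_eq_zero.1 hg).symm
    rw [hζ, mul_inv_eq_one₀ hz0] at this
    exact this
  · exfalso
    have h2 : O.valuation (∑ i ∈ Finset.range l, (ζ ^ i - 1)) < 1 :=
      Valuation.map_sum_lt _ one_ne_zero fun i _ => near_one_pow hζ1 i
    rw [Finset.sum_sub_distrib, hg, zero_sub, Valuation.map_neg] at h2
    simp only [Finset.sum_const, Finset.card_range, nsmul_eq_mul, mul_one] at h2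
    exact absurd hl h2.ne

theorem exists_root_near_one [IsAlgClosed K] {l : ℕ} (hl : l ≠ 0) {x : K}
    (hx : O.valuation (x - 1) < 1) : ∃ y, y ^ l = x ∧ O.valuation (y - 1) < 1 := by
  let p : Polynomial K := Polynomial.X ^ l - Polynomial.C x
  have hp : p.Monic := Polynomial.monic_X_pow_sub_C x hl
  have hs := (IsAlgClosed.splits p).eval_eq_prod_roots_of_monic hp 1
  have h1 : p.eval 1 = 1 - x := by simp [p]
  by_contra! hc
  have : ∀ r ∈ p.roots, 1 ≤ O.valuation (1 - r) := by
    intro r hr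
    have hr' : r ^ l = x := by
      have := (Polynomial.mem_roots hp.ne_zero).1 hr
      simpa [p, sub_eq_zero] using this
    rw [Valuation.map_sub_swap]
    exact hc r hr'
  have h2 : 1 ≤ O.valuation ((p.roots.map fun r => 1 - r).prod) := by
    rw [map_multiset_prod, Multiset.map_map]
    refine Multiset.prod_induction (fun a => 1 ≤ a) _ (fun a b ha hb => one_le_mul ha hb) le_rfl ?_
    intro a ha
    obtain ⟨r, hr, rfl⟩ := Multiset.mem_map.1 ha
    exact this r hr
  rw [← hs, h1, Valuation.map_sub_swap] at h2
  exact absurd hx (not_lt.2 h2)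

end OneUnits

section Basic

variable {Ω : Type*} [Field Ω] [CharZero Ω] [Algebra.IsAlgebraic ℚ Ω] [IsAlgClosed Ω]

attribute [local instance] isGalois_rat numberField_of_finiteDimensional

theorem exists_resChar {O : ValuationSubring Ω} (hO : O ≠ ⊤) :
    ∃ p : ℕ, p.Prime ∧ O.valuation (p : Ω) < 1 := by
  by_contra! hc
  have hle : ∀ n : ℕ, O.valuation (n : Ω) ≤ 1 := fun n =>
    (O.valuation_le_one_iff _).2 (natCast_mem O n)
  have h1 : ∀ n : ℕ, n ≠ 0 → O.valuation (n : Ω) = 1 := by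
    intro n hn
    induction n using Nat.recOnMul with
    | zero => exact absurd rfl hn
    | one => simp
    | prime p hp => exact le_antisymm (hle p) (hc p hp)
    | mul a b ha hb =>
      push_cast
      rw [map_mul, ha (by rintro rfl; simp at hn), hb (by rintro rfl; simp at hn), one_mul]
  refine restrictPlace_ne_top hO (⊥ : IntermediateField ℚ Ω) (eq_top_iff.2 fun x _ => ?_)
  obtain ⟨q, hq⟩ := IntermediateField.mem_bot.1 x.2
  rw [mem_restrictPlace, ← O.valuation_le_one_iff, ← hq]
  change O.valuation (algebraMap ℚ Ω q) ≤ 1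
  rw [eq_ratCast, Rat.cast_def, map_div₀, h1 _ q.den_ne_zero, div_one, O.valuation_le_one_iff]
  exact intCast_mem O _

theorem resChar_unique {O : ValuationSubring Ω} {p q : ℕ} (hp : p.Prime) (hq : q.Prime)
    (h : O.valuation (p : Ω) < 1) (h' : O.valuation (q : Ω) < 1) : p = q := by
  by_contra hne
  have hco : IsCoprime (p : ℤ) (q : ℤ) := Nat.isCoprime_iff_coprime.2 ((Nat.coprime_primes hp hq).2 hne)
  obtain ⟨a, b, e⟩ := hco
  have e' : (a : Ω) * p + b * q = 1 := by exact_mod_cast congrArg (Int.cast (R := Ω)) e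
  have hle : ∀ n : ℤ, O.valuation (n : Ω) ≤ 1 := fun n =>
    (O.valuation_le_one_iff _).2 (intCast_mem O n)
  have : O.valuation (1 : Ω) < 1 := by
    rw [← e']
    refine (O.valuation.map_add _ _).trans_lt (max_lt ?_ ?_) <;> rw [map_mul]
    · exact mul_lt_one_of_nonneg_of_lt_one_right (hle _) zero_le h
    · exact mul_lt_one_of_nonneg_of_lt_one_right (hle _) zero_le h'
  simp at this

theorem valuation_prime_eq_one {O : ValuationSubring Ω} {p q : ℕ} (hp : p.Prime) (hq : q.Prime)
    (h : O.valuation (p : Ω) < 1) (hne : q ≠ p) : O.valuation (q : Ω) = 1 := by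
  refine le_antisymm ((O.valuation_le_one_iff _).2 (natCast_mem O q)) (not_lt.1 fun h' => hne ?_)
  exact resChar_unique hq hp h' h

/-- Valuation rings extend along field extensions. -/
theorem exists_extension (E : IntermediateField ℚ Ω) (A : ValuationSubring E) :
    ∃ O : ValuationSubring Ω, ∀ x : E, (x : Ω) ∈ O ↔ x ∈ A := by
  let φ : A →+* Ω := (algebraMap E Ω).comp A.subtype
  have hφ : Function.Injective φ := (algebraMap E Ω).injective.comp Subtype.val_injective
  let ψ : A ≃+* φ.range := RingEquiv.ofLeftInverse (Function.leftInverse_invFun hφ)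
  let I : Ideal φ.range := (IsLocalRing.maximalIdeal A).map ψ.toRingHom
  have hI : I ≠ ⊤ := by
    intro h
    have h2 : I.comap ψ.toRingHom = IsLocalRing.maximalIdeal A :=
      Ideal.comap_map_of_bijective _ ψ.bijective
    rw [h, Ideal.comap_top] at h2
    exact (IsLocalRing.maximalIdeal.isMaximal A).ne_top h2.symm
  obtain ⟨O, h1, h2⟩ := Ideal.image_subset_nonunits_valuationSubring I hI
  refine ⟨O, fun x => ⟨fun h => ?_, fun h => h1 ⟨⟨x, h⟩, rfl⟩⟩⟩
  by_contra hx
  have hx' : x⁻¹ ∈ A := (A.mem_or_inv_mem x).resolve_left hx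
  have hx0 : x ≠ 0 := by rintro rfl; exact hx A.zero_mem
  have hm : (⟨x⁻¹, hx'⟩ : A) ∈ IsLocalRing.maximalIdeal A := by
    rw [IsLocalRing.mem_maximalIdeal, mem_nonunits_iff]
    intro hu
    obtain ⟨b, hb⟩ := isUnit_iff_exists_inv.1 hu
    have : (b : E) = x := by
      have := congrArg Subtype.val hb
      change x⁻¹ * (b : E) = 1 at this
      rw [inv_mul_eq_one₀ hx0] at this
      exact this.symm
    exact hx (this ▸ b.2)
  have h3 : ((x⁻¹ : E) : Ω) ∈ O.nonunits := h2 ⟨ψ ⟨x⁻¹, hx'⟩, Ideal.mem_map_of_mem _ hm, rfl⟩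
  rw [ValuationSubring.mem_nonunits_iff, valuation_lt_iff_inv O (by simpa using hx0)] at h3
  apply h3
  rw [IntermediateField.coe_inv, inv_inv, O.valuation_le_one_iff]
  exact h

end Basic

section Kummer

variable {Ω : Type*} [Field Ω] [CharZero Ω] [Algebra.IsAlgebraic ℚ Ω] [IsAlgClosed Ω]

attribute [local instance] isGalois_rat numberField_of_finiteDimensional

theorem mem_of_fixes {U : Subgroup (Ω ≃ₐ[ℚ] Ω)} (hU : IsClosed (U : Set (Ω ≃ₐ[ℚ] Ω)))
    {g : Ω ≃ₐ[ℚ] Ω} (h : ∀ x : Ω, (∀ u ∈ U, u x = x) → g x = x) : g ∈ U := by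
  have := InfiniteGalois.fixingSubgroup_fixedField (k := ℚ) (K := Ω) ⟨U, hU⟩
  change (IntermediateField.fixedField U).fixingSubgroup = U at this
  rw [← this]
  exact fun x => h x fun u hu => x.2 ⟨u, hu⟩

theorem isClosed_stabilizer (x : Ω) :
    IsClosed (MulAction.stabilizer (Ω ≃ₐ[ℚ] Ω) x : Set (Ω ≃ₐ[ℚ] Ω)) :=
  Subgroup.isClosed_of_isOpen _ (isOpen_stabilizer x)

theorem mem_stabilizer {x : Ω} {g : Ω ≃ₐ[ℚ] Ω} :
    g ∈ MulAction.stabilizer (Ω ≃ₐ[ℚ] Ω) x ↔ g x = x := Iff.rfl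

theorem isClosed_decomposition (O : ValuationSubring Ω) :
    IsClosed (MulAction.stabilizer (Ω ≃ₐ[ℚ] Ω) O : Set (Ω ≃ₐ[ℚ] Ω)) := by
  have : (MulAction.stabilizer (Ω ≃ₐ[ℚ] Ω) O : Set (Ω ≃ₐ[ℚ] Ω)) =
      ⋂ x : Ω, {g | g x ∈ O ↔ x ∈ O} := by
    ext g
    simp only [SetLike.mem_coe, MulAction.mem_stabilizer_iff, Set.mem_iInter, Set.mem_ofPred_eq]
    constructor
    · intro h x
      nth_rewrite 1 [← h]
      exact ValuationSubring.smul_mem_pointwise_smul_iff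
    · intro h
      ext x
      rw [ValuationSubring.mem_pointwise_smul_iff_inv_smul_mem, ← h (g⁻¹ • x)]
      exact iff_of_eq (congrArg (· ∈ O) (AlgEquiv.apply_symm_apply g x))
  rw [this]
  refine isClosed_iInter fun x => ?_
  rw [← isOpen_compl_iff, isOpen_iff_mem_nhds]
  intro g hg
  refine Filter.mem_of_superset ((isOpen_stabilizer x).leftCoset g |>.mem_nhds
    ⟨1, one_mem _, mul_one g⟩) ?_
  rintro _ ⟨s, hs, rfl⟩
  have : (g • s : Ω ≃ₐ[ℚ] Ω) x = g x := congrArg g hs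
  simp only [Set.mem_compl_iff, Set.mem_ofPred_eq] at hg ⊢
  rwa [this]

/-- Quadratic extensions are generated by a square root. -/
theorem exists_sqrt_of_index_two {U V : Subgroup (Ω ≃ₐ[ℚ] Ω)}
    (hV : IsClosed (V : Set (Ω ≃ₐ[ℚ] Ω))) (hVU : V ≤ U) (h : V.relIndex U = 2) :
    ∃ y : Ω, y ≠ 0 ∧ (∀ v ∈ V, v y = y) ∧ ∀ u ∈ U, u ∉ V → u y = -y := by
  have hmul : ∀ a ∈ U, ∀ b ∈ U, a * b ∈ V ↔ (a ∈ V ↔ b ∈ V) := fun a ha b hb =>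
    Subgroup.mul_mem_iff_of_index_two (a := (⟨a, ha⟩ : U)) (b := ⟨b, hb⟩) h
  obtain ⟨g, hgU, hgV⟩ : ∃ g ∈ U, g ∉ V := by
    by_contra! hc
    rw [Subgroup.relIndex_eq_one.2 hc] at h
    norm_num at h
  obtain ⟨w, hw, hgw⟩ : ∃ w : Ω, (∀ v ∈ V, v w = w) ∧ g w ≠ w := by
    by_contra! hc
    exact hgV (mem_of_fixes hV hc)
  have key : ∀ u ∈ U, u ∉ V → u w = g w ∧ u (g w) = w := by
    intro u hu huV
    have h1 : g⁻¹ * u ∈ V := (hmul _ (inv_mem hgU) _ hu).2 (by simp [hgV, huV])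
    have h2 : u * g ∈ V := (hmul _ hu _ hgU).2 (by simp [hgV, huV])
    refine ⟨?_, hw _ h2⟩
    have := congrArg g (hw _ h1)
    rwa [AlgEquiv.mul_apply, show g (g⁻¹ (u w)) = u w from AlgEquiv.apply_symm_apply g _] at this
  refine ⟨w - g w, sub_ne_zero.2 hgw.symm, fun v hv => ?_, fun u hu huV => ?_⟩
  · have h1 : g⁻¹ * (v * g) ∈ V := by
      rw [hmul _ (inv_mem hgU) _ (mul_mem (hVU hv) hgU), hmul _ (hVU hv) _ hgU]
      simp [hv]
    have := congrArg g (hw _ h1)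
    rw [AlgEquiv.mul_apply, show ∀ x, g (g⁻¹ x) = x from AlgEquiv.apply_symm_apply g] at this
    rw [map_sub, hw v hv]
    congr 1
  · rw [map_sub, (key u hu huV).1, (key u hu huV).2]; ring

theorem index_two_of_sqrt {U : Subgroup (Ω ≃ₐ[ℚ] Ω)} {y : Ω} (hy0 : y ≠ 0)
    (h : ∀ u ∈ U, u y = y ∨ u y = -y) (hne : ∃ u ∈ U, u y ≠ y) :
    (U ⊓ MulAction.stabilizer (Ω ≃ₐ[ℚ] Ω) y).relIndex U = 2 := by
  obtain ⟨g, hg, hgy⟩ := hne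
  have hgy' := (h g hg).resolve_left hgy
  have hny : -y ≠ y := by
    intro h
    rw [neg_eq_iff_add_eq_zero, ← two_mul] at h
    simp [hy0] at h
  rw [Subgroup.relIndex_eq_two_iff]
  refine ⟨g, hg, fun b hb => ?_⟩
  have h1 : b * g ∈ U ⊓ MulAction.stabilizer (Ω ≃ₐ[ℚ] Ω) y ↔ b y = -y := by
    rw [Subgroup.mem_inf, mem_stabilizer, AlgEquiv.mul_apply, hgy', map_neg, neg_eq_iff_eq_neg]
    exact and_iff_right (mul_mem hb hg)
  have h2 : b ∈ U ⊓ MulAction.stabilizer (Ω ≃ₐ[ℚ] Ω) y ↔ b y = y := by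
    rw [Subgroup.mem_inf, mem_stabilizer]
    exact and_iff_right hb
  rw [h1, h2]
  rcases h b hb with e | e <;> rw [e]
  · exact Or.inr ⟨rfl, hny.symm⟩
  · exact Or.inl ⟨rfl, hny⟩

theorem sq_fixed {U : Subgroup (Ω ≃ₐ[ℚ] Ω)} {y : Ω} (h : ∀ u ∈ U, u (y ^ 2) = y ^ 2) :
    ∀ u ∈ U, u y = y ∨ u y = -y := fun u hu => by
  have := h u hu
  rw [map_pow] at this
  exact sq_eq_sq_iff_eq_or_eq_neg.1 this

end Kummer

/-- Group-theoretic conditions on a closed subgroup which characterise decomposition groups: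
every closed subgroup of finite index has at least two subgroups of index two, and is stable under
the formation of iterated quadratic extensions. -/
def LocalType {G : Type*} [Group G] [TopologicalSpace G] (H : Subgroup G) : Prop :=
  ∀ U ≤ H, IsClosed (U : Set G) → U.relIndex H ≠ 0 →
    (∃ V₁ ≤ U, ∃ V₂ ≤ U, IsClosed (V₁ : Set G) ∧ IsClosed (V₂ : Set G) ∧ V₁.relIndex U = 2 ∧
      V₂.relIndex U = 2 ∧ V₁ ≠ V₂) ∧
    ∀ V ≤ U, IsClosed (V : Set G) → V.relIndex U = 2 → ∀ W ≤ V, IsClosed (W : Set G) →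
      W.relIndex V = 2 → ∀ u ∈ U, ∀ w ∈ W, u * w * u⁻¹ ∈ W

section Rigid

variable {Ω : Type*} [Field Ω] [CharZero Ω] [Algebra.IsAlgebraic ℚ Ω] [IsAlgClosed Ω]

attribute [local instance] isGalois_rat numberField_of_finiteDimensional

theorem isSquare_fixedField {U : Subgroup (Ω ≃ₐ[ℚ] Ω)} {x : IntermediateField.fixedField U} :
    IsSquare x ↔ ∃ y : Ω, (∀ u ∈ U, u y = y) ∧ y ^ 2 = x := by
  constructor
  · rintro ⟨y, rfl⟩
    exact ⟨y, fun u hu => y.2 ⟨u, hu⟩, by rw [sq]; rfl⟩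
  · rintro ⟨y, h1, h2⟩
    exact ⟨⟨y, fun u => h1 u.1 u.2⟩, Subtype.ext (by rw [← h2, sq]; rfl)⟩

theorem fixedField_fixes {U : Subgroup (Ω ≃ₐ[ℚ] Ω)} (x : IntermediateField.fixedField U) :
    ∀ u ∈ U, u (x : Ω) = x := fun u hu => x.2 ⟨u, hu⟩

theorem exists_sqrt_of_normal {U : Subgroup (Ω ≃ₐ[ℚ] Ω)} (hU : IsClosed (U : Set (Ω ≃ₐ[ℚ] Ω)))
    (hN : ∀ V ≤ U, IsClosed (V : Set (Ω ≃ₐ[ℚ] Ω)) → V.relIndex U = 2 → ∀ W ≤ V,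
      IsClosed (W : Set (Ω ≃ₐ[ℚ] Ω)) → W.relIndex V = 2 → ∀ u ∈ U, ∀ w ∈ W, u * w * u⁻¹ ∈ W)
    {y : Ω} (ha : ∀ u ∈ U, u (y ^ 2) = y ^ 2) (hy : ∃ u ∈ U, u y ≠ y) :
    ∃ z : Ω, (∀ u ∈ U, u z = z) ∧ (z ^ 2 = 1 - y ^ 2 ∨ z ^ 2 = y ^ 2 * (1 - y ^ 2)) := by
  have hy0 : y ≠ 0 := by rintro rfl; simp at hy
  have hpm := sq_fixed ha
  have hi := index_two_of_sqrt hy0 hpm hy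
  obtain ⟨g, hgU, hgy⟩ := hy
  replace hgy := (hpm g hgU).resolve_left hgy
  have hny : -y ≠ y := by
    intro h
    rw [neg_eq_iff_add_eq_zero, ← two_mul] at h
    simp [hy0] at h
  have hgi : ∀ x, g (g⁻¹ x) = x := AlgEquiv.apply_symm_apply g
  have hgi' : ∀ x, g⁻¹ (g x) = x := AlgEquiv.symm_apply_apply g
  have hgy' : g⁻¹ y = -y := by
    have := congrArg (fun x => -(g⁻¹ x)) hgy
    simp only [hgi', map_neg, neg_neg] at this
    exact this.symm
  set V := U ⊓ MulAction.stabilizer (Ω ≃ₐ[ℚ] Ω) y with hV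
  have hVm : ∀ s ∈ U, s ∈ V ↔ s y = y := fun s hs => by
    rw [hV, Subgroup.mem_inf, mem_stabilizer]; exact and_iff_right hs
  have hVc : IsClosed (V : Set (Ω ≃ₐ[ℚ] Ω)) := hU.inter (isClosed_stabilizer y)
  obtain ⟨w, hw⟩ := IsAlgClosed.exists_pow_nat_eq (1 + y) (n := 2) (by norm_num)
  have hgw : (g w) ^ 2 = 1 - y := by rw [← map_pow, hw, map_add, map_one, hgy]; ring
  have hw1 : ∀ s ∈ V, s w = w ∨ s w = -w := sq_fixed fun s hs => by
    rw [hw, map_add, map_one, (hVm s hs.1).1 hs]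
  have hw2 : ∀ s ∈ V, s (g w) = g w ∨ s (g w) = -g w := sq_fixed fun s hs => by
    rw [hgw, map_sub, map_one, (hVm s hs.1).1 hs]
  have hconj : ∀ s ∈ V, g⁻¹ * s * g ∈ V := fun s hs => by
    rw [hVm _ (mul_mem (mul_mem (inv_mem hgU) hs.1) hgU)]
    rw [AlgEquiv.mul_apply, AlgEquiv.mul_apply, hgy, map_neg, (hVm s hs.1).1 hs, map_neg, hgy',
      neg_neg]
  have key : ∀ s ∈ V, s w = w ↔ s (g w) = g w := by
    intro s hs
    have e : s (g w) = g w ↔ (g⁻¹ * s * g) w = w := by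
      rw [AlgEquiv.mul_apply, AlgEquiv.mul_apply]
      constructor
      · intro h; rw [h, hgi']
      · intro h; have := congrArg g h; rwa [hgi] at this
    rw [e]
    by_cases hall : ∀ s ∈ V, s w = w
    · simp only [hall s hs, hall _ (hconj s hs)]
    · push Not at hall
      have hw0 : w ≠ 0 := by rintro rfl; simp at hall
      have hWi := index_two_of_sqrt hw0 hw1 hall
      have hWc : IsClosed ((V ⊓ MulAction.stabilizer (Ω ≃ₐ[ℚ] Ω) w : Subgroup _) : Set (Ω ≃ₐ[ℚ] Ω)) :=
        hVc.inter (isClosed_stabilizer w)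
      have hn := hN V inf_le_left hVc hi _ inf_le_left hWc hWi
      constructor
      · intro h
        have := (hn g⁻¹ (inv_mem hgU) s ⟨hs, h⟩).2
        rwa [inv_inv] at this
      · intro h
        have := (hn g hgU _ ⟨hconj s hs, h⟩).2
        rw [show g * (g⁻¹ * s * g) * g⁻¹ = s by group] at this
        exact this
  have hz : ∀ s ∈ V, s (w * g w) = w * g w := by
    intro s hs
    rw [map_mul]
    by_cases h : s w = w
    · rw [h, (key s hs).1 h]
    · rw [(hw1 s hs).resolve_left h, (hw2 s hs).resolve_left (mt (key s hs).2 h), neg_mul_neg]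
  have hz2 : (w * g w) ^ 2 = 1 - y ^ 2 := by rw [mul_pow, hw, hgw]; ring
  have hext : ∀ z, (∀ s ∈ V, s z = z) → g z = z → ∀ u ∈ U, u z = z := by
    intro z h1 h2 u hu
    by_cases huy : u y = y
    · exact h1 u ((hVm u hu).2 huy)
    · have h3 : g⁻¹ * u ∈ V := by
        rw [hVm _ (mul_mem (inv_mem hgU) hu), AlgEquiv.mul_apply, (hpm u hu).resolve_left huy,
          map_neg, hgy', neg_neg]
      have := congrArg g (h1 _ h3)
      rwa [AlgEquiv.mul_apply, hgi, h2] at this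
  have hgg : g * g ∈ V := by
    rw [hVm _ (mul_mem hgU hgU), AlgEquiv.mul_apply, hgy, map_neg, hgy, neg_neg]
  rcases hw1 _ hgg with h | h <;> rw [AlgEquiv.mul_apply] at h
  · exact ⟨w * g w, hext _ hz (by rw [map_mul, h, mul_comm]), Or.inl hz2⟩
  · refine ⟨y * (w * g w), hext _ (fun s hs => ?_) ?_, Or.inr ?_⟩
    · rw [map_mul, hz s hs, (hVm s hs.1).1 hs]
    · rw [map_mul, map_mul, h, hgy]; ring
    · rw [mul_pow, hz2]

theorem LocalType.isRigid {H U : Subgroup (Ω ≃ₐ[ℚ] Ω)} (h : LocalType H) {i : Ω} (hi : i ^ 2 = -1)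
    (hiH : ∀ g ∈ H, g i = i) (hUH : U ≤ H) (hU : IsClosed (U : Set (Ω ≃ₐ[ℚ] Ω)))
    (hf : U.relIndex H ≠ 0) : IsRigid (IntermediateField.fixedField U) := by
  refine ⟨isSquare_fixedField.2 ⟨i, fun u hu => hiH u (hUH hu), by simpa using hi⟩, fun a ha => ?_⟩
  obtain ⟨y, hy⟩ := IsAlgClosed.exists_pow_nat_eq (a : Ω) (n := 2) (by norm_num)
  have hne : ∃ u ∈ U, u y ≠ y := by
    by_contra! hc
    exact ha (isSquare_fixedField.2 ⟨y, hc, hy⟩)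
  obtain ⟨z, hz, hz2⟩ := exists_sqrt_of_normal hU (h U hUH hU hf).2
    (by rw [hy]; exact fixedField_fixes a) hne
  rw [hy] at hz2
  refine hz2.imp (fun e => isSquare_fixedField.2 ⟨z, hz, by simpa using e⟩)
    (fun e => isSquare_fixedField.2 ⟨z, hz, by simpa using e⟩)

theorem LocalType.exists_not_isSquare {H U : Subgroup (Ω ≃ₐ[ℚ] Ω)} (h : LocalType H)
    (hUH : U ≤ H) (hU : IsClosed (U : Set (Ω ≃ₐ[ℚ] Ω))) (hf : U.relIndex H ≠ 0) :
    ∃ a b : IntermediateField.fixedField U, ¬ IsSquare a ∧ ¬ IsSquare b ∧ ¬ IsSquare (a * b) := by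
  obtain ⟨V, hV, V', hV', hVc, hVc', hi, hi', hne⟩ := (h U hUH hU hf).1
  have aux : ∀ V ≤ U, IsClosed (V : Set (Ω ≃ₐ[ℚ] Ω)) → V.relIndex U = 2 → ∃ y : Ω,
      (∀ u ∈ U, u (y ^ 2) = y ^ 2) ∧ (∀ u ∈ U, u ∈ V ↔ u y = y) ∧ (∀ u ∈ U, u y = y ∨ u y = -y)
        ∧ ∃ u ∈ U, u y ≠ y := by
    intro V hV hVc hi
    obtain ⟨y, hy0, h1, h2⟩ := exists_sqrt_of_index_two hVc hV hi
    have hny : -y ≠ y := by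
      intro h
      rw [neg_eq_iff_add_eq_zero, ← two_mul] at h
      simp [hy0] at h
    have h3 : ∀ u ∈ U, u y = y ∨ u y = -y := fun u hu => by
      by_cases huV : u ∈ V
      exacts [Or.inl (h1 u huV), Or.inr (h2 u hu huV)]
    refine ⟨y, fun u hu => ?_, fun u hu => ⟨h1 u, fun h => ?_⟩, h3, ?_⟩
    · rw [map_pow]; rcases h3 u hu with e | e <;> rw [e]; ring
    · by_contra huV
      exact hny ((h2 u hu huV).symm.trans h)
    · by_contra! hc
      have : V.relIndex U = 1 := Subgroup.relIndex_eq_one.2 fun u hu => by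
        by_contra huV
        exact hny ((h2 u hu huV).symm.trans (hc u hu))
      omega
  obtain ⟨y, h1, h2, h3, h4⟩ := aux V hV hVc hi
  obtain ⟨y', h1', h2', h3', h4'⟩ := aux V' hV' hVc' hi'
  have nsq : ∀ (t : Ω) (ht : ∀ u ∈ U, u (t ^ 2) = t ^ 2), (∃ u ∈ U, u t ≠ t) →
      ¬ IsSquare (⟨t ^ 2, fun u => ht u.1 u.2⟩ : IntermediateField.fixedField U) := by
    rintro t ht ⟨u, hu, hut⟩ hs
    obtain ⟨z, hz, hzt⟩ := isSquare_fixedField.1 hs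
    rcases sq_eq_sq_iff_eq_or_eq_neg.1 hzt with rfl | rfl
    · exact hut (hz u hu)
    · have := hz u hu
      rw [map_neg, neg_inj] at this
      exact hut this
  refine ⟨⟨y ^ 2, fun u => h1 u.1 u.2⟩, ⟨y' ^ 2, fun u => h1' u.1 u.2⟩, nsq y h1 h4, nsq y' h1' h4', ?_⟩
  have h5 : ∀ u ∈ U, u ((y * y') ^ 2) = (y * y') ^ 2 := fun u hu => by
    rw [mul_pow, map_mul, h1 u hu, h1' u hu]
  have := nsq (y * y') h5 (by
    by_contra! hc
    apply hne
    ext u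
    by_cases hu : u ∈ U
    · rw [h2 u hu, h2' u hu]
      have h6 := hc u hu
      have hy0 : y ≠ 0 := by rintro rfl; simp at h4
      have hy0' : y' ≠ 0 := by rintro rfl; simp at h4'
      rw [map_mul] at h6
      constructor
      · intro e; rw [e] at h6; exact mul_left_cancel₀ hy0 h6
      · intro e; rw [e] at h6; exact mul_right_cancel₀ hy0' h6
    · exact ⟨fun h => absurd (hV h) hu, fun h => absurd (hV' h) hu⟩)
  intro hs
  apply this
  convert hs using 1
  exact Subtype.ext (mul_pow y y' 2)

end Rigid

section PlaceOfGroup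

variable {Ω : Type*} [Field Ω] [CharZero Ω] [Algebra.IsAlgebraic ℚ Ω] [IsAlgClosed Ω]

attribute [local instance] isGalois_rat numberField_of_finiteDimensional

theorem exists_openNormal (x : Ω) : ∃ N : Subgroup (Ω ≃ₐ[ℚ] Ω), N.Normal ∧
    IsOpen (N : Set (Ω ≃ₐ[ℚ] Ω)) ∧ ∀ g ∈ N, g x = x := by
  obtain ⟨N, hN⟩ := ProfiniteGrp.exist_openNormalSubgroup_sub_open_nhds_of_one
    (isOpen_stabilizer x) (one_mem (MulAction.stabilizer (Ω ≃ₐ[ℚ] Ω) x))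
  exact ⟨N.toSubgroup, N.isNormal', N.isOpen', fun g hg => hN hg⟩

theorem relIndex_ne_zero_of_isOpen {G : Type*} [Group G] [TopologicalSpace G]
    [IsTopologicalGroup G] [CompactSpace G]
    {N : Subgroup G} (hN : IsOpen (N : Set G)) (H : Subgroup G) : (H ⊓ N).relIndex H ≠ 0 := by
  rw [Subgroup.inf_relIndex_left]
  have : Finite (G ⧸ N) := Subgroup.quotient_finite_of_isOpen N hN
  have h : N.relIndex ⊤ ≠ 0 := by
    rw [Subgroup.relIndex_top_right]
    exact Subgroup.index_ne_zero_of_finite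
  exact mt (Subgroup.relIndex_eq_zero_of_le_right le_top) h

/-- A place is good for `U` if the one-units fixed by `U` are squares of elements fixed by `U`. -/
def Good (O : ValuationSubring Ω) (U : Subgroup (Ω ≃ₐ[ℚ] Ω)) : Prop :=
  O ≠ ⊤ ∧ ∀ x : Ω, (∀ u ∈ U, u x = x) → O.valuation (x - 1) < 1 →
    ∃ y, (∀ u ∈ U, u y = y) ∧ y ^ 2 = x

theorem fixes_root_near_one {O : ValuationSubring Ω} {l : ℕ} (hl : O.valuation (l : Ω) = 1)
    {x y : Ω} (hy : y ^ l = x) (hy1 : O.valuation (y - 1) < 1) {g : Ω ≃ₐ[ℚ] Ω} (hg : g • O = O)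
    (hgx : g x = x) : g y = y := by
  refine root_near_one_unique (O := O) hl ?_ hy1 ?_
  · rw [← map_one g, ← map_sub, valuation_smul_lt_iff hg]
    exact hy1
  · rw [← map_pow, hy, hgx]

theorem exists_fixed_root {O : ValuationSubring Ω} {U : Subgroup (Ω ≃ₐ[ℚ] Ω)}
    (hU : U ≤ MulAction.stabilizer _ O) {l : ℕ} (hl : O.valuation (l : Ω) = 1)
    {x : Ω} (hx : ∀ u ∈ U, u x = x) (hx1 : O.valuation (x - 1) < 1) :
    ∃ y, (∀ u ∈ U, u y = y) ∧ y ^ l = x ∧ O.valuation (y - 1) < 1 := by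
  have hl0 : l ≠ 0 := by rintro rfl; simp at hl
  obtain ⟨y, hy, hy1⟩ := exists_root_near_one hl0 hx1
  exact ⟨y, fun u hu => fixes_root_near_one hl hy hy1 (hU hu) (hx u hu), hy, hy1⟩

theorem good_of_le {O : ValuationSubring Ω} {U : Subgroup (Ω ≃ₐ[ℚ] Ω)} (hO : O ≠ ⊤)
    (h2 : O.valuation (2 : Ω) = 1) (hU : U ≤ MulAction.stabilizer _ O) : Good O U := by
  refine ⟨hO, fun x hx hx1 => ?_⟩
  obtain ⟨y, h, h', -⟩ := exists_fixed_root hU (l := 2) (by simpa using h2) hx hx1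
  exact ⟨y, h, h'⟩

theorem LocalType.exists_good {H U : Subgroup (Ω ≃ₐ[ℚ] Ω)} (h : LocalType H) {i : Ω}
    (hi : i ^ 2 = -1) (hiH : ∀ g ∈ H, g i = i) (hUH : U ≤ H)
    (hU : IsClosed (U : Set (Ω ≃ₐ[ℚ] Ω))) (hf : U.relIndex H ≠ 0) : ∃ O, Good O U := by
  obtain ⟨a, b, ha, hb, hab⟩ := h.exists_not_isSquare hUH hU hf
  obtain ⟨A, hA, hA2⟩ := (h.isRigid hi hiH hUH hU hf).exists_valuationSubring ha hb hab
  obtain ⟨O, hO⟩ := exists_extension _ A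
  refine ⟨O, ?_, fun x hx hx1 => ?_⟩
  · rintro rfl
    exact hA (eq_top_iff.2 fun x _ => (hO x).1 trivial)
  · let t : IntermediateField.fixedField U := ⟨x - 1, fun u => by
      change u.1 (x - 1) = x - 1
      rw [map_sub, map_one, hx u.1 u.2]⟩
    have hs : IsSquare (1 + t) := by
      by_cases ht : t = 0
      · rw [ht, add_zero]; exact IsSquare.one
      · have ht' : (t : Ω) ≠ 0 := by simpa using ht
        refine hA2 t ((hO t).1 ((O.valuation_le_one_iff _).1 hx1.le)) fun hc => ?_
        have h3 := (hO _).2 hc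
        rw [← O.valuation_le_one_iff] at h3
        exact (valuation_lt_iff_inv O ht').1 hx1 h3
    obtain ⟨y, h1, h2⟩ := isSquare_fixedField.1 hs
    exact ⟨y, h1, by rw [h2]; simp [t]⟩

theorem exists_finiteDimensional_mem {U : Subgroup (Ω ≃ₐ[ℚ] Ω)} (S : Finset Ω)
    (hS : ∀ x ∈ S, ∀ u ∈ U, u x = x) : ∃ E : IntermediateField ℚ Ω, FiniteDimensional ℚ E ∧
      (∀ x ∈ S, x ∈ E) ∧ ∀ x ∈ E, ∀ u ∈ U, u x = x := by
  refine ⟨IntermediateField.adjoin ℚ S, ?_, fun x hx => IntermediateField.subset_adjoin _ _ hx,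
    fun x hx u hu => ?_⟩
  · exact IntermediateField.finiteDimensional_adjoin fun x _ =>
      (Algebra.IsAlgebraic.isAlgebraic x).isIntegral
  · have : IntermediateField.adjoin ℚ S ≤ IntermediateField.fixedField U :=
      IntermediateField.adjoin_le_iff.2 fun x hx u => hS x hx u.1 u.2
    exact this hx ⟨u, hu⟩

theorem Good.valuation_two {O : ValuationSubring Ω} {U : Subgroup (Ω ≃ₐ[ℚ] Ω)} (h : Good O U)
    {a b : IntermediateField.fixedField U} (ha : ¬ IsSquare a) (hb : ¬ IsSquare b)
    (hab : ¬ IsSquare (a * b)) : O.valuation (2 : Ω) = 1 := by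
  classical
  refine le_antisymm ((O.valuation_le_one_iff _).2 (ofNat_mem O 2)) (not_lt.1 fun h2 => ?_)
  obtain ⟨E, hE, hSE, hEU⟩ := exists_finiteDimensional_mem (U := U) {(a : Ω), (b : Ω)} (by
    intro x hx
    simp only [Finset.mem_insert, Finset.mem_singleton] at hx
    rcases hx with rfl | rfl
    exacts [fixedField_fixes a, fixedField_fixes b])
  have haE : (a : Ω) ∈ E := hSE _ (by simp)
  have hbE : (b : Ω) ∈ E := hSE _ (by simp)
  obtain ⟨ζ, hζE, hζ1, hζ⟩ := exists_residue_generator E h.1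
  have hζ0 : ζ ≠ 0 := by rintro rfl; simp at hζ1
  have frob : ∀ t : Ω, O.valuation t = 1 → ∀ n : ℕ, O.valuation (t ^ (2 ^ n) - 1) < 1 →
      O.valuation (t - 1) < 1 := by
    intro t ht n
    induction n with
    | zero => simp
    | succ n ih =>
      intro hn
      apply ih
      set s := t ^ (2 ^ n) with hs
      have hs1 : O.valuation s = 1 := by rw [hs, map_pow, ht, one_pow]
      rw [pow_succ, pow_mul, ← hs] at hn
      by_contra hc
      have hle : O.valuation (s - 1) ≤ 1 := (O.valuation.map_sub _ _).trans (by simp [hs1])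
      have e : O.valuation (s - 1) = 1 := le_antisymm hle (not_lt.1 hc)
      have : O.valuation ((s - 1) ^ 2) < 1 := by
        rw [show (s - 1) ^ 2 = (s ^ 2 - 1) + -(2 * (s - 1)) by ring]
        refine (O.valuation.map_add _ _).trans_lt (max_lt hn ?_)
        rw [Valuation.map_neg, map_mul, e, mul_one]
        exact h2
      rw [map_pow, e, one_pow] at this
      exact lt_irrefl _ this
  obtain ⟨k, hk⟩ := hζ ζ⁻¹ (inv_mem hζE) (by rw [map_inv₀, hζ1, inv_one])
  have hord : O.valuation (ζ ^ (k + 1) - 1) < 1 := by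
    have := near_symm hk
    have h3 : O.valuation ((ζ ^ k - ζ⁻¹) * ζ) < 1 := by rwa [map_mul, hζ1, mul_one]
    rwa [sub_mul, inv_mul_cancel₀ hζ0, ← pow_succ] at h3
  obtain ⟨c, m, hm, hkm⟩ := Nat.exists_eq_two_pow_mul_odd (n := k + 1) (by omega)
  have hζm : O.valuation (ζ ^ m - 1) < 1 := by
    refine frob _ (by rw [map_pow, hζ1, one_pow]) c ?_
    rwa [← pow_mul, mul_comm m, ← hkm]
  obtain ⟨m', rfl⟩ := hm
  have hζsq : O.valuation (ζ ^ (2 * m' + 2) - ζ) < 1 := by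
    have : ζ ^ (2 * m' + 2) - ζ = (ζ ^ (2 * m' + 1) - 1) * ζ := by ring
    rwa [this, map_mul, hζ1, mul_one]
  have unit_sq : ∀ x ∈ E, O.valuation x = 1 → ∃ y, (∀ u ∈ U, u y = y) ∧ y ^ 2 = x := by
    intro x hx hx1
    obtain ⟨n, hn⟩ := hζ x hx hx1
    have h4 : O.valuation (x - (ζ ^ ((m' + 1) * n)) ^ 2) < 1 := by
      refine near_trans hn ?_
      have h5 : ∀ n : ℕ, O.valuation (ζ ^ n - (ζ ^ (2 * m' + 2)) ^ n) < 1 := by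
        intro n
        induction n with
        | zero => simp
        | succ n ih =>
          rw [pow_succ, pow_succ]
          refine near_mul ?_ ?_ ih (near_symm hζsq)
          · rw [map_pow, hζ1, one_pow]
          · rw [map_pow, hζ1, one_pow]
      have h6 := h5 n
      have e6 : (ζ ^ ((m' + 1) * n)) ^ 2 = (ζ ^ (2 * m' + 2)) ^ n := by
        rw [← pow_mul, ← pow_mul]; congr 1; ring
      rwa [e6]
    have hs1 : O.valuation ((ζ ^ ((m' + 1) * n)) ^ 2) = 1 := by simp [hζ1]
    obtain ⟨y, hy, hy2⟩ := h.2 (x / (ζ ^ ((m' + 1) * n)) ^ 2)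
      (hEU _ (E.div_mem hx (pow_mem (pow_mem hζE _) _))) (near_one_div hs1 h4)
    refine ⟨y * ζ ^ ((m' + 1) * n), fun u hu => ?_, ?_⟩
    · rw [map_mul, hy u hu, hEU _ (pow_mem hζE _) u hu]
    · rw [mul_pow, hy2, div_mul_cancel₀]
      exact pow_ne_zero _ (pow_ne_zero _ hζ0)
  obtain ⟨π, hπE, hπ0, -, hπ⟩ := exists_uniformizer E h.1
  have even_sq : ∀ x : IntermediateField.fixedField U, (x : Ω) ∈ E → ∀ n : ℤ,
      O.valuation ((x : Ω) * π ^ n) = 1 → Even n → IsSquare x := by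
    rintro x hx n hn ⟨j, rfl⟩
    obtain ⟨y, hy, hy2⟩ := unit_sq _ (E.mul_mem hx (zpow_mem hπE _)) hn
    refine isSquare_fixedField.2 ⟨y / π ^ j, fun u hu => ?_, ?_⟩
    · rw [map_div₀, hy u hu, hEU _ (zpow_mem hπE _) u hu]
    · have := zpow_ne_zero j hπ0
      rw [div_pow, hy2, div_eq_iff (pow_ne_zero _ this), sq, zpow_add₀ hπ0]
  have hne : ∀ x : IntermediateField.fixedField U, ¬ IsSquare x → (x : Ω) ≠ 0 := by
    intro x hx h0
    apply hx
    rw [show x = 0 from Subtype.ext h0]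
    exact IsSquare.zero
  obtain ⟨n, hn⟩ := hπ a haE (hne a ha)
  obtain ⟨n', hn'⟩ := hπ b hbE (hne b hb)
  have hodd : ¬ Even n := fun he => ha (even_sq a haE n hn he)
  have hodd' : ¬ Even n' := fun he => hb (even_sq b hbE n' hn' he)
  refine hab (even_sq (a * b) (E.mul_mem haE hbE) (n + n') ?_ ?_)
  · rw [zpow_add₀ hπ0, show ((a * b : IntermediateField.fixedField U) : Ω) * (π ^ n * π ^ n') =
      ((a : Ω) * π ^ n) * ((b : Ω) * π ^ n') by
        rw [show ((a * b : IntermediateField.fixedField U) : Ω) = (a : Ω) * b from rfl]; ring,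
      map_mul, hn, hn', one_mul]
  · rw [Int.even_add]; simp [hodd, hodd']

end PlaceOfGroup

section PlaceOfGroup

variable {Ω : Type*} [Field Ω] [CharZero Ω] [Algebra.IsAlgebraic ℚ Ω] [IsAlgClosed Ω]

attribute [local instance] isGalois_rat numberField_of_finiteDimensional

theorem exists_approx_two {O O' : ValuationSubring Ω} (E : IntermediateField ℚ Ω)
    [FiniteDimensional ℚ E] (hO : O ≠ ⊤) (hO' : O' ≠ ⊤) (h : ∃ x ∈ E, ¬ (x ∈ O ↔ x ∈ O'))
    {a : Ω} (ha : a ∈ E) (ha0 : a ≠ 0) : ∃ b ∈ E, ∃ n : ℕ, n ≠ 0 ∧ O.valuation (b - 1) < 1 ∧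
      O'.valuation (b / (a * (n : Ω) ^ 2) - 1) < 1 := by
  obtain ⟨N, hN0, hNa⟩ : ∃ N ≠ (0 : ℤ), IsIntegral ℤ (N • a) :=
    ((IsFractionRing.isAlgebraic_iff ℤ ℚ Ω).2
      (Algebra.IsAlgebraic.isAlgebraic (R := ℚ) a)).exists_integral_multiple
  set n := N.natAbs with hn
  have hn0 : n ≠ 0 := Int.natAbs_ne_zero.2 hN0
  have hn0' : (n : Ω) ≠ 0 := Nat.cast_ne_zero.2 hn0
  set c := a * (n : Ω) ^ 2 with hc
  have hc0 : c ≠ 0 := mul_ne_zero ha0 (pow_ne_zero _ hn0')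
  have hcE : c ∈ E := E.mul_mem ha (pow_mem (natCast_mem E n) _)
  have hci : IsIntegral ℤ c := by
    have e : c = (N : Ω) * (N • a) := by
      have e1 : ((n : Ω)) ^ 2 = (N : Ω) ^ 2 := by
        have : ((n : ℤ)) ^ 2 = N ^ 2 := by rw [hn, Int.natAbs_sq]
        exact_mod_cast congrArg (Int.cast (R := Ω)) this
      rw [hc, e1, zsmul_eq_mul]; ring
    rw [e]
    exact (isIntegral_algebraMap (R := ℤ) (x := N)).mul hNa
  have hv : ∀ A : ValuationSubring Ω, A.valuation c ≤ 1 := fun A =>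
    (A.valuation_le_one_iff _).2 (mem_of_isIntegral A hci)
  obtain ⟨e, he, h1, h2⟩ := exists_approx E hO {O'} (by
    intro A hA
    rw [Finset.mem_singleton] at hA
    subst hA
    exact ⟨hO', h⟩) c⁻¹ (inv_mem hcE)
  have h2' := h2 O' (by simp)
  have hs : ∀ (A : ValuationSubring Ω) (t : Ω), A.valuation (t * c⁻¹) < 1 →
      A.valuation (t * (1 - c) * c⁻¹) < 1 := by
    intro A t ht
    rw [show t * (1 - c) * c⁻¹ = (1 - c) * (t * c⁻¹) by ring, map_mul]
    refine mul_lt_one_of_nonneg_of_lt_one_right ?_ zero_le ht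
    exact (A.valuation.map_sub _ _).trans (by simp [hv A])
  refine ⟨e + (1 - e) * c, E.add_mem he (E.mul_mem (E.sub_mem E.one_mem he) hcE), n, hn0, ?_, ?_⟩
  · have h3 := hs O _ h1
    rw [show e + (1 - e) * c - 1 = ((e - 1) * (1 - c) * c⁻¹) * c by field_simp; ring, map_mul]
    exact mul_lt_one_of_nonneg_of_lt_one_left zero_le h3 (hv O)
  · have h3 := hs O' _ h2'
    rw [← hc, show (e + (1 - e) * c) / c - 1 = e * (1 - c) * c⁻¹ by field_simp; ring]
    exact h3

theorem Good.eq_on {O O' : ValuationSubring Ω} {U : Subgroup (Ω ≃ₐ[ℚ] Ω)} (h : Good O U)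
    (h' : Good O' U) {a : IntermediateField.fixedField U} (ha : ¬ IsSquare a) (x : Ω)
    (hx : ∀ u ∈ U, u x = x) : x ∈ O ↔ x ∈ O' := by
  classical
  by_contra hc
  obtain ⟨E, hE, hSE, hEU⟩ := exists_finiteDimensional_mem (U := U) {(a : Ω), x} (by
    intro x hx
    simp only [Finset.mem_insert, Finset.mem_singleton] at hx
    rcases hx with rfl | rfl
    exacts [fixedField_fixes a, hx])
  have ha0 : (a : Ω) ≠ 0 := by
    intro h0
    apply ha
    rw [show a = 0 from Subtype.ext h0]
    exact IsSquare.zero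
  have haE : (a : Ω) ∈ E := hSE _ (by simp)
  obtain ⟨b, hb, n, hn, h1, h2⟩ := exists_approx_two E h.1 h'.1 ⟨x, hSE _ (by simp), hc⟩ haE ha0
  have hn' : (n : Ω) ≠ 0 := Nat.cast_ne_zero.2 hn
  obtain ⟨y, hy, hyb⟩ := h.2 b (hEU b hb) h1
  obtain ⟨z, hz, hzb⟩ := h'.2 _ (hEU _ (E.div_mem hb (E.mul_mem haE
    (pow_mem (natCast_mem E n) 2)))) h2
  have hb0 : b ≠ 0 := by rintro rfl; simp at h1
  have hz0 : z ≠ 0 := by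
    rintro rfl
    rw [eq_comm, zero_pow two_ne_zero, div_eq_zero_iff] at hzb
    simp [hb0, ha0, hn'] at hzb
  apply ha
  refine isSquare_fixedField.2 ⟨y / (z * n), fun u hu => ?_, ?_⟩
  · rw [map_div₀, map_mul, hy u hu, hz u hu, map_natCast]
  · rw [div_pow, mul_pow, hyb, hzb]
    field_simp

theorem Good.smul {O : ValuationSubring Ω} {U : Subgroup (Ω ≃ₐ[ℚ] Ω)} (h : Good O U)
    {g : Ω ≃ₐ[ℚ] Ω} (hg : ∀ u ∈ U, g⁻¹ * u * g ∈ U) (hg' : ∀ u ∈ U, g * u * g⁻¹ ∈ U) :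
    Good (g • O) U := by
  refine ⟨smul_ne_top h.1 g, fun x hx hx1 => ?_⟩
  have hgi : ∀ x, g (g⁻¹ x) = x := AlgEquiv.apply_symm_apply g
  have hgi' : ∀ x, g⁻¹ (g x) = x := AlgEquiv.symm_apply_apply g
  obtain ⟨y, hy, hyx⟩ := h.2 (g⁻¹ x) (fun u hu => by
      have := congrArg (fun t => g⁻¹ t) (hx _ (hg' u hu))
      rwa [AlgEquiv.mul_apply, AlgEquiv.mul_apply, hgi'] at this) (by
    rw [← valuation_smul_lt (g := g), map_sub, map_one, hgi]; exact hx1)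
  refine ⟨g y, fun u hu => ?_, by rw [← map_pow, hyx, hgi]⟩
  have := congrArg g (hy _ (hg u hu))
  rwa [AlgEquiv.mul_apply, AlgEquiv.mul_apply, hgi] at this

theorem Good.of_normal {O : ValuationSubring Ω} {U U' : Subgroup (Ω ≃ₐ[ℚ] Ω)} (h : Good O U')
    (h2 : O.valuation (2 : Ω) = 1) (hUU' : U' ≤ U) (hn : ∀ u ∈ U, ∀ v ∈ U', u * v * u⁻¹ ∈ U')
    {a : IntermediateField.fixedField U'} (ha : ¬ IsSquare a) : Good O U := by
  refine ⟨h.1, fun x hx hx1 => ?_⟩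
  obtain ⟨y, hy, hy1⟩ := exists_root_near_one (two_ne_zero) hx1
  obtain ⟨y', hy', hyx'⟩ := h.2 x (fun u hu => hx u (hUU' hu)) hx1
  have hyU' : ∀ u ∈ U', u y = y := by
    rcases sq_eq_sq_iff_eq_or_eq_neg.1 (hy.trans hyx'.symm) with e | e
    · rw [e]; exact hy'
    · intro u hu; rw [e, map_neg, hy' u hu]
  refine ⟨y, fun u hu => ?_, hy⟩
  have hg : Good (u⁻¹ • O) U' := h.smul (fun v hv => by simpa using hn u hu v hv)
    (fun v hv => by simpa using hn u⁻¹ (inv_mem hu) v hv)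
  have hagree := hg.eq_on h ha (y - 1)⁻¹ (fun v hv => by
    rw [map_inv₀, map_sub, map_one, hyU' v hv])
  have h3 := (valuation_lt_of_le_iff hagree).2 hy1
  rw [← valuation_smul_lt (g := u), smul_inv_smul, map_sub, map_one] at h3
  refine root_near_one_unique (O := O) (l := 2) (by simpa using h2) h3 hy1 ?_
  rw [← map_pow, hy, hx u hu]

theorem LocalType.exists_place {H : Subgroup (Ω ≃ₐ[ℚ] Ω)} (h : LocalType H) {i : Ω}
    (hi : i ^ 2 = -1) (hiH : ∀ g ∈ H, g i = i) (hH : IsClosed (H : Set (Ω ≃ₐ[ℚ] Ω))) :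
    ∃ O : ValuationSubring Ω, O ≠ ⊤ ∧ O.valuation (2 : Ω) = 1 ∧ H ≤ MulAction.stabilizer _ O := by
  let 𝒩 := {N : Subgroup (Ω ≃ₐ[ℚ] Ω) // N.Normal ∧ IsOpen (N : Set (Ω ≃ₐ[ℚ] Ω))}
  have hcl : ∀ N : 𝒩, IsClosed ((H ⊓ N.1 : Subgroup _) : Set (Ω ≃ₐ[ℚ] Ω)) := fun N =>
    hH.inter (Subgroup.isClosed_of_isOpen _ N.2.2)
  have hfi : ∀ N : 𝒩, (H ⊓ N.1).relIndex H ≠ 0 := fun N => relIndex_ne_zero_of_isOpen N.2.2 H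
  have hgood := fun N : 𝒩 => h.exists_good hi hiH inf_le_left (hcl N) (hfi N)
  choose o ho using hgood
  have hsq := fun N : 𝒩 => h.exists_not_isSquare inf_le_left (hcl N) (hfi N)
  choose a b ha hb hab using hsq
  have ho2 : ∀ N, (o N).valuation (2 : Ω) = 1 := fun N => (ho N).valuation_two (ha N) (hb N) (hab N)
  have hmono : ∀ N N' : 𝒩, N'.1 ≤ N.1 → ∀ x, (∀ g ∈ H ⊓ N.1, g x = x) → (x ∈ o N ↔ x ∈ o N') := by
    intro N N' hle x hx
    refine (ho N).eq_on ((ho N').of_normal (ho2 N') (inf_le_inf_left _ hle) ?_ (ha N')) (ha N) x hx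
    intro u hu v hv
    exact ⟨H.mul_mem (H.mul_mem hu.1 hv.1) (H.inv_mem hu.1), N'.2.1.conj_mem v hv.2 u⟩
  let inf𝒩 : 𝒩 → 𝒩 → 𝒩 := fun N N' => ⟨N.1 ⊓ N'.1,
    ⟨fun n hn g => ⟨N.2.1.conj_mem n hn.1 g, N'.2.1.conj_mem n hn.2 g⟩⟩, N.2.2.inter N'.2.2⟩
  have hind : ∀ N N' : 𝒩, ∀ x, (∀ g ∈ H ⊓ N.1, g x = x) → (∀ g ∈ H ⊓ N'.1, g x = x) →
      (x ∈ o N ↔ x ∈ o N') := by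
    intro N N' x hx hx'
    rw [hmono N (inf𝒩 N N') inf_le_left x hx, hmono N' (inf𝒩 N N') inf_le_right x hx']
  have hex : ∀ x : Ω, ∃ N : 𝒩, ∀ g ∈ H ⊓ N.1, g x = x := by
    intro x
    obtain ⟨N, h1, h2, h3⟩ := exists_openNormal x
    exact ⟨⟨N, h1, h2⟩, fun g hg => h3 g hg.2⟩
  choose n hn using hex
  have hdef : ∀ N : 𝒩, ∀ x, (∀ g ∈ H ⊓ N.1, g x = x) → (x ∈ o (n x) ↔ x ∈ o N) :=
    fun N x hx => hind _ _ x (hn x) hx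
  have hpair : ∀ x y : Ω, ∃ N : 𝒩, (∀ g ∈ H ⊓ N.1, g x = x) ∧ (∀ g ∈ H ⊓ N.1, g y = y) :=
    fun x y => ⟨inf𝒩 (n x) (n y), fun g hg => hn x g ⟨hg.1, hg.2.1⟩,
      fun g hg => hn y g ⟨hg.1, hg.2.2⟩⟩
  let O : ValuationSubring Ω :=
    { carrier := {x | x ∈ o (n x)}
      mul_mem' := by
        intro x y hx hy
        obtain ⟨N, h1, h2⟩ := hpair x y
        exact (hdef N _ fun g hg => by rw [map_mul, h1 g hg, h2 g hg]).2
          (mul_mem ((hdef N x h1).1 hx) ((hdef N y h2).1 hy))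
      one_mem' := (show (1 : Ω) ∈ o (n 1) from one_mem _)
      add_mem' := by
        intro x y hx hy
        obtain ⟨N, h1, h2⟩ := hpair x y
        exact (hdef N _ fun g hg => by rw [map_add, h1 g hg, h2 g hg]).2
          (add_mem ((hdef N x h1).1 hx) ((hdef N y h2).1 hy))
      zero_mem' := (show (0 : Ω) ∈ o (n 0) from zero_mem _)
      neg_mem' := by
        intro x hx
        exact (hdef (n x) _ fun g hg => by rw [map_neg, hn x g hg]).2 (neg_mem hx)
      mem_or_inv_mem' := by
        intro x
        refine ((o (n x)).mem_or_inv_mem x).imp id fun h => ?_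
        exact (hdef (n x) _ fun g hg => by rw [map_inv₀, hn x g hg]).2 h }
  have hO : ∀ N : 𝒩, ∀ x, (∀ g ∈ H ⊓ N.1, g x = x) → (x ∈ O ↔ x ∈ o N) := hdef
  have hinv : ∀ g ∈ H, ∀ x, x ∈ O → g x ∈ O := by
    intro g hg x hx
    have hgi' : ∀ x, g⁻¹ (g x) = x := AlgEquiv.symm_apply_apply g
    have hgi : ∀ x, g (g⁻¹ x) = x := AlgEquiv.apply_symm_apply g
    have hc1 : ∀ u ∈ H ⊓ (n x).1, g⁻¹ * u * g ∈ H ⊓ (n x).1 := fun u hu =>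
      ⟨H.mul_mem (H.mul_mem (H.inv_mem hg) hu.1) hg, by simpa using (n x).2.1.conj_mem u hu.2 g⁻¹⟩
    have hfix : ∀ u ∈ H ⊓ (n x).1, u (g x) = g x := by
      intro u hu
      have := congrArg g (hn x _ (hc1 u hu))
      rwa [AlgEquiv.mul_apply, AlgEquiv.mul_apply, hgi] at this
    rw [hO (n x) _ hfix]
    have hgg : Good (g • o (n x)) (H ⊓ (n x).1) := (ho (n x)).smul hc1
      (fun u hu => ⟨H.mul_mem (H.mul_mem hg hu.1) (H.inv_mem hg), (n x).2.1.conj_mem u hu.2 g⟩)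
    rw [(ho (n x)).eq_on hgg (ha (n x)) _ hfix]
    exact ValuationSubring.smul_mem_pointwise_smul_iff.2 hx
  refine ⟨O, ?_, ?_, ?_⟩
  · intro hT
    let T : 𝒩 := ⟨⊤, inferInstance, isOpen_univ⟩
    refine restrictPlace_ne_top (ho T).1 (IntermediateField.fixedField H) (eq_top_iff.2 fun x _ => ?_)
    rw [mem_restrictPlace, ← hO T x fun g hg => x.2 ⟨g, hg.1⟩, hT]
    trivial
  · have h0 : (2 : Ω) ≠ 0 := two_ne_zero
    rw [valuation_eq_one_iff_inv]
    refine ⟨h0, (O.valuation_le_one_iff _).2 (ofNat_mem O 2), (O.valuation_le_one_iff _).2 ?_⟩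
    have h3 := ((valuation_eq_one_iff_inv (o (n (2 : Ω)⁻¹))).1 (ho2 _)).2.2
    rw [ValuationSubring.valuation_le_one_iff] at h3
    exact h3
  · intro g hg
    rw [MulAction.mem_stabilizer_iff]
    ext x
    rw [ValuationSubring.mem_pointwise_smul_iff_inv_smul_mem]
    constructor
    · intro h
      have := hinv g hg _ h
      rwa [show g (g⁻¹ • x) = x from AlgEquiv.apply_symm_apply g x] at this
    · exact hinv g⁻¹ (inv_mem hg) x

theorem LocalType.place_unique {H : Subgroup (Ω ≃ₐ[ℚ] Ω)} (h : LocalType H)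
    (hH : IsClosed (H : Set (Ω ≃ₐ[ℚ] Ω))) {O O' : ValuationSubring Ω} (hO : O ≠ ⊤) (hO' : O' ≠ ⊤)
    (h2 : O.valuation (2 : Ω) = 1) (h2' : O'.valuation (2 : Ω) = 1)
    (hHO : H ≤ MulAction.stabilizer _ O) (hHO' : H ≤ MulAction.stabilizer _ O') : O = O' := by
  ext x
  obtain ⟨N, -, hN, hNx⟩ := exists_openNormal x
  obtain ⟨a, -, ha, -⟩ := h.exists_not_isSquare (U := H ⊓ N) inf_le_left
    (hH.inter (Subgroup.isClosed_of_isOpen _ hN)) (relIndex_ne_zero_of_isOpen hN H)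
  exact (good_of_le hO h2 (inf_le_left.trans hHO)).eq_on
    (good_of_le hO' h2' (inf_le_left.trans hHO')) ha x fun g hg => hNx g hg.2

end PlaceOfGroup

section Converse

variable {Ω : Type*} [Field Ω] [CharZero Ω] [Algebra.IsAlgebraic ℚ Ω] [IsAlgClosed Ω]

attribute [local instance] isGalois_rat numberField_of_finiteDimensional

theorem exists_openNormal_le {s : Set (Ω ≃ₐ[ℚ] Ω)} (hs : IsOpen s) (h1 : 1 ∈ s) :
    ∃ N : Subgroup (Ω ≃ₐ[ℚ] Ω), N.Normal ∧ IsOpen (N : Set (Ω ≃ₐ[ℚ] Ω)) ∧ (N : Set _) ⊆ s := by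
  obtain ⟨N, hN⟩ := ProfiniteGrp.exist_openNormalSubgroup_sub_open_nhds_of_one hs h1
  exact ⟨N.toSubgroup, N.isNormal', N.isOpen', hN⟩

theorem exists_openNormal_inf_le {Z U : Subgroup (Ω ≃ₐ[ℚ] Ω)}
    (hU : IsClosed (U : Set (Ω ≃ₐ[ℚ] Ω))) (hi : U.relIndex Z ≠ 0) :
    ∃ N : Subgroup (Ω ≃ₐ[ℚ] Ω), N.Normal ∧ IsOpen (N : Set (Ω ≃ₐ[ℚ] Ω)) ∧ Z ⊓ N ≤ U := by
  have : (U.subgroupOf Z).FiniteIndex := ⟨hi⟩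
  have hop : IsOpen (U.subgroupOf Z : Set Z) := Subgroup.isOpen_of_isClosed_of_finiteIndex _
    (hU.preimage continuous_subtype_val)
  obtain ⟨s, hs, hsU⟩ := isOpen_induced_iff.1 hop
  obtain ⟨N, h1, h2, h3⟩ := exists_openNormal_le hs (by
    have : (1 : Z) ∈ Subtype.val ⁻¹' s := by rw [hsU]; exact one_mem _
    exact this)
  refine ⟨N, h1, h2, fun g hg => ?_⟩
  have : (⟨g, hg.1⟩ : Z) ∈ Subtype.val ⁻¹' s := h3 hg.2
  rw [hsU] at this
  exact this

theorem fixingSubgroup_fixedField_of_isClosed {U : Subgroup (Ω ≃ₐ[ℚ] Ω)}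
    (hU : IsClosed (U : Set (Ω ≃ₐ[ℚ] Ω))) : (IntermediateField.fixedField U).fixingSubgroup = U :=
  InfiniteGalois.fixingSubgroup_fixedField (k := ℚ) (K := Ω) ⟨U, hU⟩

theorem finiteDimensional_fixedField {U : Subgroup (Ω ≃ₐ[ℚ] Ω)}
    (hU : IsOpen (U : Set (Ω ≃ₐ[ℚ] Ω))) :
    FiniteDimensional ℚ (IntermediateField.fixedField U) := by
  rw [← InfiniteGalois.isOpen_iff_finite]
  change IsOpen ((IntermediateField.fixedField U).fixingSubgroup : Set (Ω ≃ₐ[ℚ] Ω))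
  rwa [fixingSubgroup_fixedField_of_isClosed (Subgroup.isClosed_of_isOpen _ hU)]

theorem exists_field_of_relIndex {Z U : Subgroup (Ω ≃ₐ[ℚ] Ω)}
    (hU : IsClosed (U : Set (Ω ≃ₐ[ℚ] Ω))) (hi : U.relIndex Z ≠ 0) (hUZ : U ≤ Z) :
    ∃ E : IntermediateField ℚ Ω, FiniteDimensional ℚ E ∧ (∀ x ∈ E, ∀ u ∈ U, u x = x) ∧
      ∀ g ∈ E.fixingSubgroup, g ∈ Z → g ∈ U := by
  obtain ⟨N, hN, hNo, hNU⟩ := exists_openNormal_inf_le hU hi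
  have hop : IsOpen ((U ⊔ N : Subgroup (Ω ≃ₐ[ℚ] Ω)) : Set (Ω ≃ₐ[ℚ] Ω)) :=
    Subgroup.isOpen_mono le_sup_right hNo
  refine ⟨IntermediateField.fixedField (U ⊔ N), finiteDimensional_fixedField hop,
    fun x hx u hu => hx ⟨u, Subgroup.mem_sup_left hu⟩, fun g hg hgZ => ?_⟩
  rw [fixingSubgroup_fixedField_of_isClosed (Subgroup.isClosed_of_isOpen _ hop)] at hg
  obtain ⟨u, hu, n, hn, rfl⟩ := Subgroup.mem_sup_of_normal_right.1 hg
  refine mul_mem hu (hNU ⟨?_, hn⟩)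
  have := mul_mem (inv_mem (hUZ hu)) hgZ
  rwa [inv_mul_cancel_left] at this

theorem exists_near_of_fixed {O : ValuationSubring Ω} (hO : O ≠ ⊤) {U : Subgroup (Ω ≃ₐ[ℚ] Ω)}
    {E : IntermediateField ℚ Ω} [FiniteDimensional ℚ E]
    (hE : ∀ g ∈ E.fixingSubgroup, g ∈ MulAction.stabilizer _ O → g ∈ U) {y : Ω}
    (hy : ∀ u ∈ U, u y = y) : ∃ f ∈ E, O.valuation (y - f) < 1 := by
  obtain ⟨f, hf, h⟩ := exists_near E hO (c := 1) E.one_mem (y := y) fun g hg hgO =>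
    hy g (hE g hg hgO)
  exact ⟨f, hf, by simpa using h⟩

/-- A uniformiser `π` and a generator `ζ` of the multiplicative group of the residue field, for the
field fixed by `U` equipped with the restriction of `O`. -/
structure IsLocalParameters (O : ValuationSubring Ω) (U : Subgroup (Ω ≃ₐ[ℚ] Ω)) (π ζ : Ω) :
    Prop where
  fixes_left : ∀ u ∈ U, u π = π
  fixes_right : ∀ u ∈ U, u ζ = ζ
  ne_zero : π ≠ 0
  valuation_lt : O.valuation π < 1
  valuation_eq : O.valuation ζ = 1
  exists_zpow : ∀ x, (∀ u ∈ U, u x = x) → x ≠ 0 → ∃ n : ℤ, O.valuation (x * π ^ n) = 1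
  exists_near : ∀ x, (∀ u ∈ U, u x = x) → O.valuation x = 1 →
    ∃ k : ℕ, O.valuation (x - ζ ^ k) < 1

/-- The elements fixed by a closed subgroup of finite index in a decomposition group have a
uniformiser and a generator of the multiplicative group of the residue field. -/
theorem exists_local_parameters {O : ValuationSubring Ω} (hO : O ≠ ⊤)
    {U : Subgroup (Ω ≃ₐ[ℚ] Ω)} (hU : IsClosed (U : Set (Ω ≃ₐ[ℚ] Ω)))
    (hUO : U ≤ MulAction.stabilizer _ O) (hi : U.relIndex (MulAction.stabilizer _ O) ≠ 0) :
    ∃ π ζ : Ω, IsLocalParameters O U π ζ := by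
  obtain ⟨E, hEf, hEU, hE⟩ := exists_field_of_relIndex hU hi hUO
  obtain ⟨π, hπE, hπ0, hπ, hπv⟩ := exists_uniformizer E hO
  obtain ⟨ζ, hζE, hζ, hζv⟩ := exists_residue_generator E hO
  refine ⟨π, ζ, hEU π hπE, hEU ζ hζE, hπ0, hπ, hζ, fun x hx hx0 => ?_, fun x hx hx1 => ?_⟩
  · have key : ∀ x, (∀ u ∈ U, u x = x) → 1 ≤ O.valuation x →
        ∃ n : ℤ, O.valuation (x * π ^ n) = 1 := by
      intro x hx hx1
      obtain ⟨f, hf, h⟩ := exists_near_of_fixed hO hE hx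
      have hfx : O.valuation f = O.valuation x := by
        have := Valuation.map_add_eq_of_lt_right O.valuation (x := f - x) (y := x)
          ((near_symm h).trans_le hx1)
        rwa [sub_add_cancel] at this
      have hf0 : f ≠ 0 := by
        rintro rfl
        rw [map_zero] at hfx
        rw [← hfx] at hx1
        exact absurd hx1 (by simp)
      obtain ⟨n, hn⟩ := hπv f hf hf0
      exact ⟨n, by rw [map_mul, ← hfx, ← map_mul, hn]⟩
    rcases le_total 1 (O.valuation x) with h | h
    · exact key x hx h
    · obtain ⟨n, hn⟩ := key x⁻¹ (fun u hu => by rw [map_inv₀, hx u hu]) (by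
        rw [map_inv₀]
        exact (one_le_inv₀ (zero_lt_iff.2 ((Valuation.ne_zero_iff _).2 hx0))).2 h)
      refine ⟨-n, ?_⟩
      rw [zpow_neg, ← inv_inv (x * _), mul_inv, inv_inv, map_inv₀, hn, inv_one]
  · obtain ⟨f, hf, h⟩ := exists_near_of_fixed hO hE hx
    obtain ⟨k, hk⟩ := hζv f hf (valuation_eq_one_of_near hx1 (near_symm h))
    exact ⟨k, near_trans h hk⟩

end Converse

section Converse

variable {Ω : Type*} [Field Ω] [CharZero Ω] [Algebra.IsAlgebraic ℚ Ω] [IsAlgClosed Ω]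

attribute [local instance] isGalois_rat numberField_of_finiteDimensional

namespace IsLocalParameters

variable {O : ValuationSubring Ω} {U : Subgroup (Ω ≃ₐ[ℚ] Ω)} {π ζ : Ω}

theorem valuation_zpow_eq_one (h : IsLocalParameters O U π ζ) {n : ℤ}
    (hn : O.valuation (π ^ n) = 1) : n = 0 := by
  have h0 : O.valuation π ≠ 0 := (Valuation.ne_zero_iff _).2 h.ne_zero
  have h1 := h.valuation_lt
  rw [map_zpow₀] at hn
  rcases n with n | n
  · rcases n with - | n
    · rfl
    · rw [Int.ofNat_eq_natCast, zpow_natCast] at hn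
      exact absurd hn (pow_lt_one₀ zero_le h1 (by simp)).ne
  · rw [zpow_negSucc, inv_eq_one] at hn
    exact absurd hn (pow_lt_one₀ zero_le h1 (by simp)).ne

/-- Every element is a product of powers of the local parameters and an `l`-th power, when `l` is
invertible in the residue field. -/
theorem exists_eq_pow (h : IsLocalParameters O U π ζ) (hU : U ≤ MulAction.stabilizer _ O) {x : Ω}
    (hx : ∀ u ∈ U, u x = x) (hx0 : x ≠ 0) : ∃ n : ℤ, ∃ k : ℕ, ∀ l : ℕ, O.valuation (l : Ω) = 1 →
      ∃ w : Ω, w ≠ 0 ∧ (∀ u ∈ U, u w = w) ∧ O.valuation (w - 1) < 1 ∧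
        x = π ^ n * ζ ^ k * w ^ l := by
  obtain ⟨n, hn⟩ := h.exists_zpow x hx hx0
  have hf : ∀ u ∈ U, u (x * π ^ n) = x * π ^ n := fun u hu => by
    rw [map_mul, map_zpow₀, hx u hu, h.fixes_left u hu]
  obtain ⟨k, hk⟩ := h.exists_near _ hf hn
  refine ⟨-n, k, fun l hl => ?_⟩
  have hζ0 : ζ ≠ 0 := by
    have := h.valuation_eq
    rintro rfl
    simp at this
  obtain ⟨w, hw, hwl, hw1⟩ := exists_fixed_root hU hl (x := x * π ^ n / ζ ^ k) (fun u hu => by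
    rw [map_div₀, hf u hu, map_pow, h.fixes_right u hu])
    (near_one_div (by rw [map_pow, h.valuation_eq, one_pow]) hk)
  refine ⟨w, ?_, hw, hw1, ?_⟩
  · rintro rfl
    simp at hw1
  · rw [hwl]
    have := zpow_ne_zero n h.ne_zero
    field_simp
    rw [← zpow_add₀ h.ne_zero]
    simp

theorem near_pow (h : IsLocalParameters O U π ζ) {x : Ω} {k : ℕ}
    (hk : O.valuation (x - ζ ^ k) < 1) (n : ℕ) : O.valuation (x ^ n - ζ ^ (k * n)) < 1 := by
  have hz : ∀ m : ℕ, O.valuation (ζ ^ m) = 1 := fun m => by rw [map_pow, h.valuation_eq, one_pow]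
  have hx : O.valuation x = 1 := valuation_eq_one_of_near (hz k) hk
  induction n with
  | zero => simp
  | succ n ih =>
    rw [pow_succ, mul_add, mul_one, pow_add]
    exact near_mul (by rw [map_pow, hx, one_pow]) (hz _).le ih hk

theorem odd_order (h : IsLocalParameters O U π ζ) (h2 : O.valuation (2 : Ω) = 1) {r : ℕ}
    (hr : O.valuation (ζ ^ r - 1) < 1) : ¬ Odd r := by
  intro ho
  obtain ⟨m, hm⟩ := h.exists_near (-1) (fun u _ => by simp) (by simp)
  have h1 := h.near_pow hm r
  rw [ho.neg_one_pow, mul_comm, pow_mul] at h1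
  have h3 := near_trans h1 (near_one_pow hr m)
  rw [show (-1 - 1 : Ω) = -2 by norm_num, Valuation.map_neg, h2] at h3
  exact lt_irrefl _ h3

theorem not_isSquare_right (h : IsLocalParameters O U π ζ) (h2 : O.valuation (2 : Ω) = 1) {y : Ω}
    (hy : ∀ u ∈ U, u y = y) : y ^ 2 ≠ ζ := by
  intro he
  have hy1 : O.valuation y = 1 := by
    have := h.valuation_eq
    rw [← he, map_pow] at this
    exact (pow_eq_one_iff_of_nonneg zero_le two_ne_zero).1 this
  obtain ⟨k, hk⟩ := h.exists_near y hy hy1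
  have h1 := h.near_pow hk 2
  rw [he] at h1
  rcases Nat.eq_zero_or_pos k with rfl | hk0
  · rw [zero_mul, pow_zero] at h1
    exact h.odd_order h2 (r := 1) (by simpa using h1) odd_one
  · refine h.odd_order h2 (r := k * 2 - 1) ?_ ⟨k - 1, by omega⟩
    have h3 := near_one_div h.valuation_eq (near_symm h1)
    rwa [show ζ ^ (k * 2) / ζ = ζ ^ (k * 2 - 1) by
      rw [div_eq_iff (by rintro rfl; simpa using h.valuation_eq), ← pow_succ]
      congr 1; omega] at h3

theorem not_isSquare_left (h : IsLocalParameters O U π ζ) {y : Ω} (b : ℕ)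
    (hy : ∀ u ∈ U, u y = y) : y ^ 2 ≠ π * ζ ^ b := by
  intro he
  have hζ0 : ζ ≠ 0 := by
    have := h.valuation_eq
    rintro rfl
    simp at this
  have hy0 : y ≠ 0 := by
    rintro rfl
    rw [eq_comm] at he
    simp [h.ne_zero, hζ0] at he
  obtain ⟨n, hn⟩ := h.exists_zpow y hy hy0
  have h1 : O.valuation ((y * π ^ n) ^ 2) = 1 := by rw [map_pow, hn, one_pow]
  have e : (y * π ^ n) ^ 2 = π ^ (2 * n + 1) * ζ ^ b := by
    rw [mul_pow, he, zpow_add₀ h.ne_zero, zpow_mul', zpow_one]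
    norm_cast
    ring
  rw [e, map_mul, map_pow, h.valuation_eq, one_pow, mul_one] at h1
  have := h.valuation_zpow_eq_one h1
  omega

theorem rigid (h : IsLocalParameters O U π ζ) (hU : U ≤ MulAction.stabilizer _ O)
    (h2 : O.valuation (2 : Ω) = 1) {i : Ω} (hi : i ^ 2 = -1) (hiU : ∀ u ∈ U, u i = i) {t : Ω}
    (ht : ∀ u ∈ U, u t = t) (hts : ¬ ∃ y, (∀ u ∈ U, u y = y) ∧ y ^ 2 = t) :
    ∃ y, (∀ u ∈ U, u y = y) ∧ (y ^ 2 = 1 - t ∨ y ^ 2 = t * (1 - t)) := by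
  have h2' : O.valuation ((2 : ℕ) : Ω) = 1 := by simpa using h2
  have ht0 : t ≠ 0 := by
    rintro rfl
    exact hts ⟨0, by simp, by simp⟩
  have hfix : ∀ u ∈ U, u (1 - t) = 1 - t := fun u hu => by rw [map_sub, map_one, ht u hu]
  rcases lt_trichotomy (O.valuation t) 1 with hlt | heq | hgt
  · obtain ⟨y, hy, hy2, -⟩ := exists_fixed_root hU h2' hfix (by
      rwa [show 1 - t - 1 = -t by ring, Valuation.map_neg])
    exact ⟨y, hy, Or.inl hy2⟩
  · obtain ⟨k, hk⟩ := h.exists_near t ht heq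
    have sq : ∀ (x : Ω) (m : ℕ), (∀ u ∈ U, u x = x) → O.valuation (x - ζ ^ m) < 1 → Even m →
        ∃ y, (∀ u ∈ U, u y = y) ∧ y ^ 2 = x := by
      rintro x m hx hm ⟨j, rfl⟩
      have hz : O.valuation (ζ ^ (j + j)) = 1 := by rw [map_pow, h.valuation_eq, one_pow]
      have hz0 : ζ ^ (j + j) ≠ 0 := fun h0 => by simp [h0] at hz
      obtain ⟨y, hy, hy2, -⟩ := exists_fixed_root hU h2' (x := x / ζ ^ (j + j)) (fun u hu => by
        rw [map_div₀, hx u hu, map_pow, h.fixes_right u hu]) (near_one_div hz hm)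
      refine ⟨y * ζ ^ j, fun u hu => by rw [map_mul, map_pow, hy u hu, h.fixes_right u hu], ?_⟩
      rw [mul_pow, hy2, ← pow_mul, mul_two, div_mul_cancel₀ _ hz0]
    have hko : ¬ Even k := fun he => hts (sq t k ht hk he)
    have hle : O.valuation (1 - t) ≤ 1 := (O.valuation.map_sub _ _).trans (by simp [heq])
    rcases hle.lt_or_eq with hl | he
    · obtain ⟨y, hy, hy2, -⟩ := exists_fixed_root hU h2' ht (near_symm hl)
      exact absurd ⟨y, hy, hy2⟩ hts
    · obtain ⟨m, hm⟩ := h.exists_near _ hfix he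
      by_cases hme : Even m
      · obtain ⟨y, hy, hy2⟩ := sq _ m hfix hm hme
        exact ⟨y, hy, Or.inl hy2⟩
      · obtain ⟨y, hy, hy2⟩ := sq (t * (1 - t)) (k + m) (fun u hu => by
          rw [map_mul, ht u hu, hfix u hu]) (by
          rw [pow_add]
          exact near_mul heq.le (by rw [map_pow, h.valuation_eq, one_pow]) hk hm) (by
          rw [Nat.even_add]; tauto)
        exact ⟨y, hy, Or.inr hy2⟩
  · obtain ⟨y, hy, hy2, -⟩ := exists_fixed_root hU h2' (x := 1 - t⁻¹) (fun u hu => by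
      rw [map_sub, map_one, map_inv₀, ht u hu]) (by
      rw [show 1 - t⁻¹ - 1 = -t⁻¹ by ring, Valuation.map_neg, map_inv₀]
      exact inv_lt_one_of_one_lt₀ hgt)
    refine ⟨i * y * t, fun u hu => by rw [map_mul, map_mul, hiU u hu, hy u hu, ht u hu], Or.inr ?_⟩
    rw [mul_pow, mul_pow, hi, hy2]
    field_simp
    ring

end IsLocalParameters

theorem localType_of_le_stabilizer {O : ValuationSubring Ω} (hO : O ≠ ⊤)
    (h2 : O.valuation (2 : Ω) = 1) {H : Subgroup (Ω ≃ₐ[ℚ] Ω)}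
    (hHO : H ≤ MulAction.stabilizer _ O) (hH : H.relIndex (MulAction.stabilizer _ O) ≠ 0)
    {i : Ω} (hi : i ^ 2 = -1) (hiH : ∀ g ∈ H, g i = i) : LocalType H := by
  intro U hUH hU hUi
  have hUO := hUH.trans hHO
  have hiU : ∀ u ∈ U, u i = i := fun u hu => hiH u (hUH hu)
  obtain ⟨π, ζ, h⟩ := exists_local_parameters hO hU hUO (Subgroup.relIndex_ne_zero_trans hUi hH)
  have hζ0 : ζ ≠ 0 := by
    have := h.valuation_eq
    rintro rfl
    simp at this
  refine ⟨?_, ?_⟩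
  · obtain ⟨a, ha⟩ := IsAlgClosed.exists_pow_nat_eq π (n := 2) (by norm_num)
    obtain ⟨b, hb⟩ := IsAlgClosed.exists_pow_nat_eq ζ (n := 2) (by norm_num)
    have ha0 : a ≠ 0 := by rintro rfl; exact h.ne_zero (by rw [← ha]; simp)
    have hb0 : b ≠ 0 := by rintro rfl; exact hζ0 (by rw [← hb]; simp)
    have hau := sq_fixed (U := U) (y := a) (by rw [ha]; exact h.fixes_left)
    have hbu := sq_fixed (U := U) (y := b) (by rw [hb]; exact h.fixes_right)
    have hane : ∃ u ∈ U, u a ≠ a := by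
      by_contra! hc
      exact h.not_isSquare_left 0 hc (by rw [ha, pow_zero, mul_one])
    have hbne : ∃ u ∈ U, u b ≠ b := by
      by_contra! hc
      exact h.not_isSquare_right h2 hc hb
    refine ⟨U ⊓ MulAction.stabilizer _ a, inf_le_left, U ⊓ MulAction.stabilizer _ b, inf_le_left,
      hU.inter (isClosed_stabilizer a), hU.inter (isClosed_stabilizer b),
      index_two_of_sqrt ha0 hau hane, index_two_of_sqrt hb0 hbu hbne, fun he => ?_⟩
    have hiff : ∀ u ∈ U, u a = a ↔ u b = b := fun u hu => by
      have : u ∈ U ⊓ MulAction.stabilizer _ a ↔ u ∈ U ⊓ MulAction.stabilizer _ b := by rw [he]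
      simpa [Subgroup.mem_inf, hu, mem_stabilizer] using this
    refine h.not_isSquare_left (y := a * b) 1 (fun u hu => ?_) (by rw [mul_pow, ha, hb, pow_one])
    rw [map_mul]
    by_cases hua : u a = a
    · rw [hua, (hiff u hu).1 hua]
    · rw [(hau u hu).resolve_left hua, (hbu u hu).resolve_left (mt (hiff u hu).2 hua), neg_mul_neg]
  · intro V hVU hV hVi W hWV hW hWi
    obtain ⟨y, hy0, hyV, hyU⟩ := exists_sqrt_of_index_two hV hVU hVi
    obtain ⟨z, hz0, hzW, hzV⟩ := exists_sqrt_of_index_two hW hWV hWi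
    have hny : -y ≠ y := by
      intro h
      rw [neg_eq_iff_add_eq_zero, ← two_mul] at h
      simp [hy0] at h
    have hnz : -z ≠ z := by
      intro h
      rw [neg_eq_iff_add_eq_zero, ← two_mul] at h
      simp [hz0] at h
    have hVn : ∀ u ∈ U, ∀ v ∈ V, u⁻¹ * v * u ∈ V := by
      intro u hu v hv
      have hm : ∀ a ∈ U, ∀ b ∈ U, a * b ∈ V ↔ (a ∈ V ↔ b ∈ V) := fun a ha b hb =>
        Subgroup.mul_mem_iff_of_index_two (a := (⟨a, ha⟩ : U)) (b := ⟨b, hb⟩) hVi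
      rw [hm _ (U.mul_mem (inv_mem hu) (hVU hv)) _ hu, hm _ (inv_mem hu) _ (hVU hv), inv_mem_iff]
      tauto
    have hxV : ∀ v ∈ V, v (z ^ 2) = z ^ 2 := by
      intro v hv
      by_cases hvW : v ∈ W
      · rw [map_pow, hzW v hvW]
      · rw [map_pow, hzV v hv hvW, neg_sq]
    have hyy : ∀ u ∈ U, u (y ^ 2) = y ^ 2 := by
      intro u hu
      by_cases huV : u ∈ V
      · rw [map_pow, hyV u huV]
      · rw [map_pow, hyU u hu huV, neg_sq]
    have key : ∀ u ∈ U, ∃ s, (∀ v ∈ V, v s = s) ∧ s ^ 2 = u (z ^ 2) * z ^ 2 := by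
      intro u hu
      by_cases huV : u ∈ V
      · exact ⟨z ^ 2, hxV, by rw [hxV u huV, sq]⟩
      have huy := hyU u hu huV
      set x := z ^ 2 with hx
      have hm : ∀ a ∈ U, ∀ b ∈ U, a * b ∈ V ↔ (a ∈ V ↔ b ∈ V) := fun a ha b hb =>
        Subgroup.mul_mem_iff_of_index_two (a := (⟨a, ha⟩ : U)) (b := ⟨b, hb⟩) hVi
      have hux : ∀ v ∈ V, v (u x) = u x := by
        intro v hv
        have e := hxV _ (hVn u hu v hv)
        have := congrArg (fun t => u t) e
        simpa [AlgEquiv.mul_apply, AlgEquiv.apply_symm_apply] using this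
      have huux : u (u x) = x := hxV (u * u) ((hm u hu u hu).2 Iff.rfl)
      have hg : ∀ g ∈ U, g ∉ V → g x = u x ∧ g (u x) = x := by
        intro g hg hgV
        have h1 : u⁻¹ * g ∈ V := (hm _ (inv_mem hu) _ hg).2 (by rw [inv_mem_iff]; tauto)
        have h2 : g * u ∈ V := (hm _ hg _ hu).2 (by tauto)
        refine ⟨?_, hxV _ h2⟩
        have := congrArg (fun t => u t) (hxV _ h1)
        simpa [AlgEquiv.mul_apply, AlgEquiv.apply_symm_apply] using this
      set a := (x + u x) / 2 with ha
      set b := (x - u x) / (2 * y) with hb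
      have haU : ∀ g ∈ U, g a = a := by
        intro g hgU
        by_cases hgV : g ∈ V
        · rw [ha, map_div₀, map_add, hxV g hgV, hux g hgV, map_ofNat]
        · rw [ha, map_div₀, map_add, (hg g hgU hgV).1, (hg g hgU hgV).2, map_ofNat, add_comm]
      have hbU : ∀ g ∈ U, g b = b := by
        intro g hgU
        by_cases hgV : g ∈ V
        · rw [hb, map_div₀, map_sub, map_mul, hxV g hgV, hux g hgV, hyV g hgV, map_ofNat]
        · rw [hb, map_div₀, map_sub, map_mul, (hg g hgU hgV).1, (hg g hgU hgV).2,
            hyU g hgU hgV, map_ofNat, mul_neg, div_neg, ← neg_div, neg_sub]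
      have hn : u x * x = a ^ 2 - b ^ 2 * y ^ 2 := by
        rw [ha, hb]
        field_simp
        ring
      rw [hn]
      rcases eq_or_ne a 0 with ha0 | ha0
      · refine ⟨i * b * y, fun v hv => ?_, by rw [mul_pow, mul_pow, hi, ha0]; ring⟩
        rw [map_mul, map_mul, hiU v (hVU hv), hbU v (hVU hv), hyV v hv]
      rcases eq_or_ne b 0 with hb0 | hb0
      · exact ⟨a, fun v hv => haU v (hVU hv), by rw [hb0]; ring⟩
      obtain ⟨w, hw, hw2⟩ := h.rigid hUO h2 hi hiU (t := b ^ 2 * y ^ 2 / a ^ 2) (fun g hgU => by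
        rw [map_div₀, map_mul, map_pow g b, map_pow g a, hbU g hgU, haU g hgU, hyy g hgU]) (by
        rintro ⟨w, hw, hw2⟩
        have hwy : w ^ 2 = (b * y / a) ^ 2 := by
          rw [hw2, div_pow (b * y) a, mul_pow b y]
        have hby : b * y / a ≠ 0 := div_ne_zero (mul_ne_zero hb0 hy0) ha0
        have hf : u (b * y / a) = b * y / a := by
          rcases sq_eq_sq_iff_eq_or_eq_neg.1 hwy with e | e
          · rw [← e]; exact hw u hu
          · rw [eq_neg_iff_add_eq_zero, add_comm, ← eq_neg_iff_add_eq_zero] at e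
            rw [e, map_neg, hw u hu]
        rw [map_div₀, map_mul, hbU u hu, haU u hu, huy] at hf
        apply hny
        have hne : b / a ≠ 0 := div_ne_zero hb0 ha0
        refine mul_left_cancel₀ hne ?_
        calc b / a * -y = b * -y / a := (mul_div_right_comm _ _ _).symm
          _ = b * y / a := hf
          _ = b / a * y := mul_div_right_comm _ _ _)
      rcases hw2 with hw2 | hw2
      · refine ⟨a * w, fun v hv => by rw [map_mul, haU v (hVU hv), hw v (hVU hv)], ?_⟩
        rw [mul_pow, hw2]
        field_simp
      · refine ⟨a ^ 2 * w / (b * y), fun v hv => by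
          rw [map_div₀, map_mul, map_mul, map_pow, haU v (hVU hv), hw v (hVU hv), hbU v (hVU hv),
            hyV v hv], ?_⟩
        rw [div_pow, mul_pow, hw2]
        field_simp
    intro u hu w hw
    have hwV : u * w * u⁻¹ ∈ V := by
      simpa using hVn u⁻¹ (inv_mem hu) w (hWV hw)
    by_contra hc
    have h1 := hzV _ hwV hc
    obtain ⟨s, hs, hs2⟩ := key u⁻¹ (inv_mem hu)
    have hsW := hs w (hWV hw)
    have hw1 : w (u⁻¹ z) = u⁻¹ z := by
      have : (u⁻¹ z * z) ^ 2 = s ^ 2 := by rw [hs2, mul_pow, map_pow]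
      have e : u⁻¹ z * z = s ∨ u⁻¹ z * z = -s := sq_eq_sq_iff_eq_or_eq_neg.1 this
      have e2 : u⁻¹ z = s / z ∨ u⁻¹ z = -s / z := by
        rwa [eq_div_iff hz0, eq_div_iff hz0]
      rcases e2 with e | e
      · rw [e, map_div₀, hsW, hzW w hw]
      · rw [e, map_div₀, map_neg, hsW, hzW w hw]
    rw [AlgEquiv.mul_apply, AlgEquiv.mul_apply, hw1] at h1
    exact hnz (h1.symm.trans (AlgEquiv.apply_symm_apply u z))

end Converse

section Transport

variable {G : Type*} [Group G] [TopologicalSpace G] {U U' : Subgroup G}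

/-- The image of a subgroup of `G` under an isomorphism between two subgroups of `G`. -/
def transport (α : U ≃ₜ* U') (V : Subgroup G) : Subgroup G :=
  ((V.subgroupOf U).map (α : U →* U')).map U'.subtype

theorem mem_transport {α : U ≃ₜ* U'} {V : Subgroup G} {g : G} :
    g ∈ transport α V ↔ ∃ h : g ∈ U', (α.symm ⟨g, h⟩ : G) ∈ V := by
  simp only [transport, Subgroup.mem_map, Subgroup.mem_subgroupOf]
  constructor
  · rintro ⟨-, ⟨u, hu, rfl⟩, rfl⟩
    refine ⟨(α u).2, ?_⟩
    change ((α.symm (α u) : U) : G) ∈ V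
    rwa [ContinuousMulEquiv.symm_apply_apply]
  · rintro ⟨h, hg⟩
    exact ⟨⟨g, h⟩, ⟨α.symm ⟨g, h⟩, hg, ContinuousMulEquiv.apply_symm_apply _ _⟩, rfl⟩

theorem apply_mem_transport {α : U ≃ₜ* U'} {V : Subgroup G} {u : U} :
    (α u : G) ∈ transport α V ↔ (u : G) ∈ V := by
  rw [mem_transport]
  constructor
  · rintro ⟨h, hu⟩
    change ((α.symm (α u) : U) : G) ∈ V at hu
    rwa [ContinuousMulEquiv.symm_apply_apply] at hu
  · intro hu
    refine ⟨(α u).2, ?_⟩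
    change ((α.symm (α u) : U) : G) ∈ V
    rwa [ContinuousMulEquiv.symm_apply_apply]

theorem transport_le (α : U ≃ₜ* U') (V : Subgroup G) : transport α V ≤ U' := fun _ hg =>
  (mem_transport.1 hg).1

theorem transport_mono (α : U ≃ₜ* U') {V W : Subgroup G} (h : V ≤ W) :
    transport α V ≤ transport α W := fun _ hg =>
  let ⟨h1, h2⟩ := mem_transport.1 hg
  mem_transport.2 ⟨h1, h h2⟩

theorem transport_symm_transport (α : U ≃ₜ* U') {V : Subgroup G} (hV : V ≤ U) :
    transport α.symm (transport α V) = V := by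
  ext g
  rw [mem_transport]
  constructor
  · rintro ⟨h, hg⟩
    exact apply_mem_transport (u := ⟨g, h⟩).1 hg
  · intro hg
    exact ⟨hV hg, apply_mem_transport (u := ⟨g, hV hg⟩).2 hg⟩

theorem transport_transport_symm (α : U ≃ₜ* U') {V : Subgroup G} (hV : V ≤ U') :
    transport α (transport α.symm V) = V :=
  transport_symm_transport α.symm hV

theorem transport_self (α : U ≃ₜ* U') : transport α U = U' := by
  ext g
  rw [mem_transport]
  exact ⟨fun h => h.1, fun h => ⟨h, (α.symm _).2⟩⟩

theorem transport_inf (α : U ≃ₜ* U') (V W : Subgroup G) :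
    transport α (V ⊓ W) = transport α V ⊓ transport α W := by
  ext g
  simp only [mem_transport, Subgroup.mem_inf]
  constructor
  · rintro ⟨h, h1, h2⟩
    exact ⟨⟨h, h1⟩, ⟨h, h2⟩⟩
  · rintro ⟨⟨h, h1⟩, ⟨_, h2⟩⟩
    exact ⟨h, h1, h2⟩

theorem coe_transport (α : U ≃ₜ* U') (V : Subgroup G) :
    (transport α V : Set G) = Subtype.val '' (α.symm ⁻¹' (Subtype.val ⁻¹' (V : Set G))) := by
  ext g
  simp only [SetLike.mem_coe, mem_transport, Set.mem_image, Set.mem_preimage, Subtype.exists,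
    exists_and_right, exists_eq_right]

theorem isClosed_transport (α : U ≃ₜ* U') (hU' : IsClosed (U' : Set G)) {V : Subgroup G}
    (hV : IsClosed (V : Set G)) : IsClosed (transport α V : Set G) := by
  rw [coe_transport]
  exact hU'.isClosedEmbedding_subtypeVal.isClosedMap _
    ((hV.preimage continuous_subtype_val).preimage α.symm.continuous)

theorem isOpen_transport (α : U ≃ₜ* U') (hU' : IsOpen (U' : Set G)) {V : Subgroup G}
    (hV : IsOpen (V : Set G)) : IsOpen (transport α V : Set G) := by
  rw [coe_transport]
  exact hU'.isOpenEmbedding_subtypeVal.isOpenMap _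
    ((hV.preimage continuous_subtype_val).preimage α.symm.continuous)

theorem relIndex_transport (α : U ≃ₜ* U') {V W : Subgroup G} (hW : W ≤ U) :
    (transport α V).relIndex (transport α W) = V.relIndex W := by
  unfold transport
  rw [Subgroup.relIndex_map_map_of_injective _ _ U'.subtype_injective,
    Subgroup.relIndex_map_map_of_injective _ _ α.injective, Subgroup.relIndex_subgroupOf hW]

theorem conj_mem_transport (α : U ≃ₜ* U') {V W : Subgroup G}
    (h : ∀ w ∈ W, ∀ v ∈ V, w * v * w⁻¹ ∈ V) :
    ∀ w ∈ transport α W, ∀ v ∈ transport α V, w * v * w⁻¹ ∈ transport α V := by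
  intro w hw v hv
  obtain ⟨hwU, hw⟩ := mem_transport.1 hw
  obtain ⟨hvU, hv⟩ := mem_transport.1 hv
  refine mem_transport.2 ⟨mul_mem (mul_mem hwU hvU) (inv_mem hwU), ?_⟩
  have := h _ hw _ hv
  have e : (⟨w * v * w⁻¹, mul_mem (mul_mem hwU hvU) (inv_mem hwU)⟩ : U') =
    ⟨w, hwU⟩ * ⟨v, hvU⟩ * (⟨w, hwU⟩ : U')⁻¹ := rfl
  rw [e, map_mul, map_mul, map_inv]
  exact this

theorem LocalType.transport (α : U ≃ₜ* U') (hU : IsClosed (U : Set G)) (hU' : IsClosed (U' : Set G))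
    {H : Subgroup G} (hH : H ≤ U) (h : LocalType H) : LocalType (transport α H) := by
  intro A hA hAc hAi
  have hAU : A ≤ U' := hA.trans (transport_le α H)
  have back : ∀ B ≤ U', ∃ C ≤ U, NU.transport α C = B ∧ (IsClosed (B : Set G) → IsClosed (C : Set G)) :=
    fun B hB => ⟨NU.transport α.symm B, transport_le _ _, transport_transport_symm α hB,
      fun hc => isClosed_transport _ hU hc⟩
  have le : ∀ {B C : Subgroup G}, B ≤ U → C ≤ U → NU.transport α B ≤ NU.transport α C → B ≤ C := by
    intro B C hB hC h
    rw [← transport_symm_transport α hB, ← transport_symm_transport α hC]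
    exact transport_mono _ h
  obtain ⟨B, hB, rfl, hBc⟩ := back A hAU
  rw [relIndex_transport α hH] at hAi
  obtain ⟨⟨V₁, h1, V₂, h2, h1c, h2c, h1i, h2i, hne⟩, h3⟩ := h B (le hB hH hA) (hBc hAc) hAi
  refine ⟨⟨_, transport_mono α h1, _, transport_mono α h2, isClosed_transport α hU' h1c,
    isClosed_transport α hU' h2c, ?_, ?_, fun he => hne ?_⟩, ?_⟩
  · rw [relIndex_transport α hB, h1i]
  · rw [relIndex_transport α hB, h2i]
  · rw [← transport_symm_transport α (h1.trans hB), he, transport_symm_transport α (h2.trans hB)]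
  · intro V hV hVc hVi W hW hWc hWi
    obtain ⟨V, hVU, rfl, hVc'⟩ := back V (hV.trans (transport_le α B))
    obtain ⟨W, hWU, rfl, hWc'⟩ := back W (hW.trans (transport_le α V))
    rw [relIndex_transport α hB] at hVi
    rw [relIndex_transport α hVU] at hWi
    exact conj_mem_transport α (h3 V (le hVU hB hV) (hVc' hVc) hVi W (le hWU hVU hW)
      (hWc' hWc) hWi)

end Transport

section Correspondence

variable {Ω : Type*} [Field Ω] [CharZero Ω] [Algebra.IsAlgebraic ℚ Ω] [IsAlgClosed Ω]

attribute [local instance] isGalois_rat numberField_of_finiteDimensional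

/-- A nontrivial valuation ring of odd residue characteristic. -/
def IsOdd (O : ValuationSubring Ω) : Prop := O ≠ ⊤ ∧ O.valuation (2 : Ω) = 1

theorem valuation_smul_eq_one {O : ValuationSubring Ω} {g : Ω ≃ₐ[ℚ] Ω} (x : Ω) :
    (g • O).valuation (g x) = 1 ↔ O.valuation x = 1 := by
  rw [le_antisymm_iff, le_antisymm_iff]
  exact and_congr (valuation_smul x)
    (not_lt.symm.trans ((not_congr (valuation_smul_lt x)).trans not_lt))

theorem IsOdd.smul {O : ValuationSubring Ω} (h : IsOdd O) (g : Ω ≃ₐ[ℚ] Ω) : IsOdd (g • O) := by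
  refine ⟨smul_ne_top h.1 g, ?_⟩
  have := (valuation_smul_eq_one (O := O) (g := g) 2).2 h.2
  rwa [map_ofNat] at this

theorem IsOdd.eq_of_le {O O' : ValuationSubring Ω} (h : IsOdd O) (h' : IsOdd O')
    {U : Subgroup (Ω ≃ₐ[ℚ] Ω)} (hU : IsOpen (U : Set (Ω ≃ₐ[ℚ] Ω)))
    (hle : MulAction.stabilizer _ O ⊓ U ≤ MulAction.stabilizer _ O') : O = O' := by
  obtain ⟨i, hi⟩ := IsAlgClosed.exists_pow_nat_eq (-1 : Ω) (n := 2) (by norm_num)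
  have ho : IsOpen ((U ⊓ MulAction.stabilizer _ i : Subgroup (Ω ≃ₐ[ℚ] Ω)) : Set (Ω ≃ₐ[ℚ] Ω)) :=
    hU.inter (isOpen_stabilizer i)
  have hl := localType_of_le_stabilizer h.1 h.2 (H := MulAction.stabilizer _ O ⊓
    (U ⊓ MulAction.stabilizer _ i)) inf_le_left (relIndex_ne_zero_of_isOpen ho _) hi
    (fun g hg => hg.2.2)
  exact hl.place_unique ((isClosed_decomposition O).inter (Subgroup.isClosed_of_isOpen _ ho))
    h.1 h'.1 h.2 h'.2 inf_le_left (le_trans (le_inf inf_le_left (inf_le_right.trans inf_le_left)) hle)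

theorem exists_le_of_continuousMulEquiv {U U' : Subgroup (Ω ≃ₐ[ℚ] Ω)}
    (hU : IsOpen (U : Set (Ω ≃ₐ[ℚ] Ω))) (hU' : IsOpen (U' : Set (Ω ≃ₐ[ℚ] Ω))) (α : U ≃ₜ* U')
    {O : ValuationSubring Ω} (h : IsOdd O) : ∃ O' : ValuationSubring Ω, IsOdd O' ∧
      transport α (MulAction.stabilizer _ O ⊓ U) ≤ MulAction.stabilizer _ O' ⊓ U' := by
  obtain ⟨i, hi⟩ := IsAlgClosed.exists_pow_nat_eq (-1 : Ω) (n := 2) (by norm_num)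
  obtain ⟨N, hN, hNo, hNi⟩ := exists_openNormal i
  have hNc := Subgroup.isClosed_of_isOpen _ hNo
  have hUc := Subgroup.isClosed_of_isOpen _ hU
  have hU'c := Subgroup.isClosed_of_isOpen _ hU'
  set M := U ⊓ (N ⊓ transport α.symm N) with hM
  have hMo : IsOpen (M : Set (Ω ≃ₐ[ℚ] Ω)) := hU.inter (hNo.inter (isOpen_transport _ hU hNo))
  set H := MulAction.stabilizer (Ω ≃ₐ[ℚ] Ω) O ⊓ M with hH
  have hHU : H ≤ U := inf_le_right.trans inf_le_left
  have hHc : IsClosed (H : Set (Ω ≃ₐ[ℚ] Ω)) :=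
    (isClosed_decomposition O).inter (Subgroup.isClosed_of_isOpen _ hMo)
  have hl : LocalType H := localType_of_le_stabilizer h.1 h.2 inf_le_left
    (relIndex_ne_zero_of_isOpen hMo _) hi (fun g hg => hNi g hg.2.2.1)
  have hl' := hl.transport α hUc hU'c hHU
  have hHc' := isClosed_transport α hU'c hHc
  obtain ⟨O', h1, h2, h3⟩ := hl'.exists_place hi (fun g hg => hNi g (by
    obtain ⟨h4, h5⟩ := mem_transport.1 hg
    exact (apply_mem_transport (α := α.symm) (u := ⟨g, h4⟩)).1 h5.2.2.2)) hHc'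
  refine ⟨O', ⟨h1, h2⟩, le_inf (fun g hg => ?_) (transport_le _ _)⟩
  have hnorm : ∀ w ∈ MulAction.stabilizer (Ω ≃ₐ[ℚ] Ω) O ⊓ U, ∀ v ∈ H, w * v * w⁻¹ ∈ H := by
    intro w hw v hv
    refine ⟨(MulAction.stabilizer _ O).mul_mem ((MulAction.stabilizer _ O).mul_mem hw.1 hv.1)
      ((MulAction.stabilizer _ O).inv_mem hw.1), U.mul_mem (U.mul_mem hw.2 hv.2.1)
      (U.inv_mem hw.2), hN.conj_mem v hv.2.2.1 w, ?_⟩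
    refine conj_mem_transport α.symm (V := N ⊓ U') (W := U') ?_ w ?_ v ?_ |> fun h =>
      transport_mono _ inf_le_left h
    · exact fun w hw v hv => ⟨hN.conj_mem v hv.1 w, U'.mul_mem (U'.mul_mem hw hv.2) (U'.inv_mem hw)⟩
    · rw [transport_self]; exact hw.2
    · rw [transport_inf, transport_self]
      exact ⟨hv.2.2.2, hv.2.1⟩
  have hconj := conj_mem_transport α hnorm
  have hg' : IsOdd (g • O') := IsOdd.smul ⟨h1, h2⟩ g
  refine MulAction.mem_stabilizer_iff.2 (hl'.place_unique hHc' hg'.1 h1 hg'.2 h2 ?_ h3)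
  · intro v hv
    have := h3 (hconj g⁻¹ (inv_mem hg) v hv)
    rw [MulAction.mem_stabilizer_iff] at this ⊢
    rw [inv_inv, mul_smul, mul_smul, inv_smul_eq_iff] at this
    exact this

theorem exists_eq_of_continuousMulEquiv {U U' : Subgroup (Ω ≃ₐ[ℚ] Ω)}
    (hU : IsOpen (U : Set (Ω ≃ₐ[ℚ] Ω))) (hU' : IsOpen (U' : Set (Ω ≃ₐ[ℚ] Ω))) (α : U ≃ₜ* U')
    {O : ValuationSubring Ω} (h : IsOdd O) : ∃ O' : ValuationSubring Ω, IsOdd O' ∧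
      transport α (MulAction.stabilizer _ O ⊓ U) = MulAction.stabilizer _ O' ⊓ U' := by
  obtain ⟨O', h', hle⟩ := exists_le_of_continuousMulEquiv hU hU' α h
  obtain ⟨O'', h'', hle'⟩ := exists_le_of_continuousMulEquiv hU' hU α.symm h'
  have e := (transport_mono α.symm hle).trans hle'
  rw [transport_symm_transport α inf_le_right] at e
  have := h.eq_of_le h'' hU (e.trans inf_le_left)
  subst this
  refine ⟨O', h', hle.antisymm ?_⟩
  have := transport_mono α hle'
  rwa [transport_transport_symm α inf_le_right] at this

end Correspondence

/-- `V` is a closed normal subgroup of `U` of index `l`. -/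
def IsNormalIndex {G : Type*} [Group G] [TopologicalSpace G] (l : ℕ) (V U : Subgroup G) : Prop :=
  V ≤ U ∧ IsClosed (V : Set G) ∧ (∀ u ∈ U, ∀ v ∈ V, u * v * u⁻¹ ∈ V) ∧ V.relIndex U = l

/-- Any two distinct closed normal subgroups of index `l` have their intersection contained in all
the others. -/
def RankLETwo {G : Type*} [Group G] [TopologicalSpace G] (l : ℕ) (U : Subgroup G) : Prop :=
  ∀ V₁ V₂ V₃, IsNormalIndex l V₁ U → IsNormalIndex l V₂ U → IsNormalIndex l V₃ U → V₁ ≠ V₂ →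
    V₁ ⊓ V₂ ≤ V₃

/-- Sufficiently small closed subgroups of finite index have `l`-rank at most two. -/
def SmallRank {G : Type*} [Group G] [TopologicalSpace G] (l : ℕ) (H : Subgroup G) : Prop :=
  ∃ U₀ ≤ H, IsClosed (U₀ : Set G) ∧ U₀.relIndex H ≠ 0 ∧
    ∀ U ≤ U₀, IsClosed (U : Set G) → U.relIndex H ≠ 0 → RankLETwo l U

section RankTransport

variable {G : Type*} [Group G] [TopologicalSpace G] {U U' : Subgroup G}

theorem IsNormalIndex.transport {l : ℕ} (α : U ≃ₜ* U') (hU' : IsClosed (U' : Set G))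
    {V W : Subgroup G} (hW : W ≤ U) (h : IsNormalIndex l V W) :
    IsNormalIndex l (transport α V) (transport α W) :=
  ⟨transport_mono α h.1, isClosed_transport α hU' h.2.1, conj_mem_transport α h.2.2.1, by
    rw [relIndex_transport α hW, h.2.2.2]⟩

theorem RankLETwo.transport {l : ℕ} (α : U ≃ₜ* U') (hU : IsClosed (U : Set G)) {W : Subgroup G}
    (hW : W ≤ U) (h : RankLETwo l W) : RankLETwo l (transport α W) := by
  intro V₁ V₂ V₃ h₁ h₂ h₃ hne
  have hle := transport_le α W
  have key : ∀ V, IsNormalIndex l V (NU.transport α W) →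
      IsNormalIndex l (NU.transport α.symm V) W := fun V hV => by
    have := hV.transport α.symm hU hle
    rwa [transport_symm_transport α hW] at this
  have hb : ∀ V, IsNormalIndex l V (NU.transport α W) →
      NU.transport α (NU.transport α.symm V) = V := fun V hV =>
    transport_transport_symm α (hV.1.trans hle)
  have := h _ _ _ (key V₁ h₁) (key V₂ h₂) (key V₃ h₃) fun he => hne (by
    rw [← hb V₁ h₁, he, hb V₂ h₂])
  rw [← hb V₁ h₁, ← hb V₂ h₂, ← hb V₃ h₃, ← transport_inf]
  exact transport_mono α this

theorem SmallRank.transport {l : ℕ} (α : U ≃ₜ* U') (hU : IsClosed (U : Set G))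
    (hU' : IsClosed (U' : Set G)) {H : Subgroup G}
    (hH : H ≤ U) (h : SmallRank l H) : SmallRank l (transport α H) := by
  obtain ⟨U₀, h₀, hc, hi, h⟩ := h
  refine ⟨NU.transport α U₀, transport_mono α h₀, isClosed_transport α hU' hc, by
    rwa [relIndex_transport α hH], fun W hW hWc hWi => ?_⟩
  have hWU := hW.trans (transport_le α _)
  have e := transport_transport_symm α hWU
  have hle : NU.transport α.symm W ≤ U₀ := by
    have := transport_mono α.symm hW
    rwa [transport_symm_transport α (h₀.trans hH)] at this
  have := h _ hle (isClosed_transport α.symm hU hWc) (by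
    rwa [← e, relIndex_transport α hH] at hWi)
  have := this.transport α hU ((hle.trans h₀).trans hH)
  rwa [e] at this

end RankTransport

section Kummer

variable {Ω : Type*} [Field Ω] [CharZero Ω] [Algebra.IsAlgebraic ℚ Ω] [IsAlgClosed Ω]

attribute [local instance] isGalois_rat numberField_of_finiteDimensional

variable {U V : Subgroup (Ω ≃ₐ[ℚ] Ω)} {l : ℕ} {ω : Ω}

/-- The Kummer character attached to an `l`-th root. -/
theorem exists_kummer_hom (hl : l.Prime) {y : Ω} (hy0 : y ≠ 0) (hω : IsPrimitiveRoot ω l)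
    (hωU : ∀ u ∈ U, u ω = ω) (hy : ∀ u ∈ U, u (y ^ l) = y ^ l) :
    ∃ χ : U →* Ωˣ, (∀ u : U, (u : Ω ≃ₐ[ℚ] Ω) y = χ u * y) ∧ (∀ u, χ u ^ l = 1) ∧
      ∀ u, ∀ v ∈ U, v (χ u : Ω) = χ u := by
  have : NeZero l := ⟨hl.ne_zero⟩
  have h1 : ∀ u ∈ U, (u y / y) ^ l = 1 := fun u hu => by
    rw [div_pow, ← map_pow, hy u hu, div_self (pow_ne_zero _ hy0)]
  have h2 : ∀ u ∈ U, ∀ v ∈ U, v (u y / y) = u y / y := fun u hu v hv => by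
    obtain ⟨i, -, hi⟩ := hω.eq_pow_of_pow_eq_one (h1 u hu)
    rw [← hi, map_pow, hωU v hv]
  have h0 : ∀ u : Ω ≃ₐ[ℚ] Ω, u y / y ≠ 0 := fun u => div_ne_zero (by simpa using hy0) hy0
  refine ⟨{ toFun := fun u => Units.mk0 _ (h0 u), map_one' := ?_, map_mul' := fun u v => ?_ },
    fun u => ?_, fun u => ?_, fun u v hv => ?_⟩
  · ext
    simp [hy0]
  · ext
    have := h2 v v.2 u u.2
    rw [map_div₀] at this
    change u.1 (v.1 y) / y = u.1 y / y * (v.1 y / y)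
    rw [← this]
    have := (AlgEquiv.injective u.1).ne hy0
    rw [map_zero] at this
    field_simp
  · change u.1 y = u.1 y / y * y
    field_simp
  · ext
    exact h1 u u.2
  · exact h2 u u.2 v hv

theorem kummer_relIndex_dvd (hl : l.Prime) {y : Ω} (hy0 : y ≠ 0) (hω : IsPrimitiveRoot ω l)
    (hωU : ∀ u ∈ U, u ω = ω) (hy : ∀ u ∈ U, u (y ^ l) = y ^ l) :
    (MulAction.stabilizer _ y).relIndex U ∣ l := by
  have : NeZero l := ⟨hl.ne_zero⟩
  obtain ⟨χ, hχ, hχl, -⟩ := exists_kummer_hom hl hy0 hω hωU hy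
  have hk : (MulAction.stabilizer (Ω ≃ₐ[ℚ] Ω) y).subgroupOf U = χ.ker := by
    ext u
    rw [Subgroup.mem_subgroupOf, mem_stabilizer, hχ, MonoidHom.mem_ker, ← Units.val_eq_one,
      mul_eq_right₀ hy0]
  rw [Subgroup.relIndex, hk, Subgroup.index_ker]
  have hle : χ.range ≤ rootsOfUnity l Ω := by
    rintro _ ⟨u, rfl⟩
    exact hχl u
  have := Subgroup.card_dvd_of_le hle
  rwa [hω.card_rootsOfUnity] at this

theorem kummer_isNormalIndex (hU : IsClosed (U : Set (Ω ≃ₐ[ℚ] Ω))) (hl : l.Prime) {y : Ω}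
    (hy0 : y ≠ 0) (hω : IsPrimitiveRoot ω l) (hωU : ∀ u ∈ U, u ω = ω)
    (hy : ∀ u ∈ U, u (y ^ l) = y ^ l) (hne : ¬ ∀ u ∈ U, u y = y) :
    IsNormalIndex l (U ⊓ MulAction.stabilizer _ y) U := by
  refine ⟨inf_le_left, hU.inter (isClosed_stabilizer y), ?_, ?_⟩
  · obtain ⟨χ, hχ, hχl, hχU⟩ := exists_kummer_hom hl hy0 hω hωU hy
    rintro u hu v ⟨hv, hvy⟩
    refine ⟨U.mul_mem (U.mul_mem hu hv) (U.inv_mem hu), ?_⟩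
    change u (v (u⁻¹ y)) = y
    rw [hχ ⟨u⁻¹, U.inv_mem hu⟩, map_mul, hχU _ v hv, (show v y = y from hvy),
      ← hχ ⟨u⁻¹, U.inv_mem hu⟩]
    exact AlgEquiv.apply_symm_apply u y
  · rw [Subgroup.inf_relIndex_left]
    refine ((Nat.dvd_prime hl).1 (kummer_relIndex_dvd hl hy0 hω hωU hy)).resolve_left ?_
    rw [Subgroup.relIndex_eq_one]
    exact fun h => hne fun u hu => h hu

theorem eq_of_le_of_relIndex_prime {G : Type*} [Group G] {U V W : Subgroup G} (hl : l.Prime)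
    (hVW : V ≤ W) (hWU : W ≤ U) (h : V.relIndex U = l) (hne : ¬ U ≤ W) : V = W := by
  have := Subgroup.relIndex_mul_relIndex V W U hVW hWU
  rw [h] at this
  have hW := ((Nat.dvd_prime hl).1 (Dvd.intro_left _ this)).resolve_left
    (fun h => hne (Subgroup.relIndex_eq_one.1 h))
  rw [hW, Nat.mul_eq_right hl.ne_zero] at this
  exact hVW.antisymm (Subgroup.relIndex_eq_one.1 this)

/-- Two Kummer generators, one of which generates a field containing the other. -/
theorem kummer_mul_pow (hl : l.Prime) {y z : Ω} (hy0 : y ≠ 0) (hz0 : z ≠ 0)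
    (hω : IsPrimitiveRoot ω l) (hωU : ∀ u ∈ U, u ω = ω)
    (hy : ∀ u ∈ U, u (y ^ l) = y ^ l) (hz : ∀ u ∈ U, u (z ^ l) = z ^ l)
    (hne : ¬ ∀ u ∈ U, u y = y) (h : ∀ u ∈ U, u y = y → u z = z) :
    ∃ k : ℕ, ∀ u ∈ U, u (z * y ^ k) = z * y ^ k := by
  have : NeZero l := ⟨hl.ne_zero⟩
  obtain ⟨χ, hχ, hχl, hχU⟩ := exists_kummer_hom hl hy0 hω hωU hy
  obtain ⟨ψ, hψ, hψl, hψU⟩ := exists_kummer_hom hl hz0 hω hωU hz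
  push Not at hne
  obtain ⟨g, hg, hgy⟩ := hne
  set g' : U := ⟨g, hg⟩
  have hg1 : χ g' ≠ 1 := fun hc => hgy (by
    have := hχ g'
    rwa [hc, Units.val_one, one_mul] at this)
  have hprim : IsPrimitiveRoot (χ g') l := by
    rw [← orderOf_eq_prime (p := l) (hp := ⟨hl⟩) (hχl g') hg1]
    exact IsPrimitiveRoot.orderOf _
  have hkey : ∀ u : U, χ u = 1 → ψ u = 1 := fun u hu => by
    have h1 := h u u.2 (by rw [hχ, hu, Units.val_one, one_mul])
    rw [hψ, mul_eq_right₀ hz0] at h1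
    exact Units.ext h1
  have hp' : ∀ ξ : Ωˣ, ξ ^ l = 1 → ∃ i : ℕ, χ g' ^ i = ξ := fun ξ hξ => by
    obtain ⟨i, -, hi⟩ := (IsPrimitiveRoot.coe_units_iff.2 hprim).eq_pow_of_pow_eq_one
      (ξ := (ξ : Ω)) (by rw [← Units.val_pow_eq_pow_val, hξ, Units.val_one])
    exact ⟨i, Units.ext (by push_cast; exact hi)⟩
  obtain ⟨k, hk⟩ := hp' (ψ g')⁻¹ (by rw [inv_pow, hψl, inv_one])
  refine ⟨k, fun u hu => ?_⟩
  obtain ⟨i, hi⟩ := hp' (χ ⟨u, hu⟩) (hχl _)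
  have h1 : ψ (⟨u, hu⟩ * (g' ^ i)⁻¹) = 1 := hkey _ (by rw [map_mul, map_inv, map_pow, hi,
    mul_inv_cancel])
  rw [map_mul, map_inv, map_pow, mul_inv_eq_one] at h1
  have h2 : ψ ⟨u, hu⟩ * χ ⟨u, hu⟩ ^ k = 1 := by
    rw [h1, ← hi, ← pow_mul, mul_comm i k, pow_mul, hk, inv_pow, mul_inv_cancel]
  have h3 : ((ψ ⟨u, hu⟩ : Ω)) * (χ ⟨u, hu⟩ : Ω) ^ k = 1 := by
    rw [← Units.val_pow_eq_pow_val, ← Units.val_mul, h2, Units.val_one]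
  rw [map_mul, map_pow, hψ ⟨u, hu⟩, hχ ⟨u, hu⟩]
  calc _ = ((ψ ⟨u, hu⟩ : Ω)) * (χ ⟨u, hu⟩ : Ω) ^ k * (z * y ^ k) := by ring
    _ = _ := by rw [h3, one_mul]

/-- Cyclic extensions of prime degree are generated by a root. -/
theorem IsNormalIndex.exists_kummer (h : IsNormalIndex l V U) (hl : l.Prime)
    (hω : IsPrimitiveRoot ω l) (hωU : ∀ u ∈ U, u ω = ω) :
    ∃ y : Ω, y ≠ 0 ∧ (∀ u ∈ U, u (y ^ l) = y ^ l) ∧ V = U ⊓ MulAction.stabilizer _ y := by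
  obtain ⟨hVU, hV, hn, hi⟩ := h
  obtain ⟨g, hg, hgV⟩ : ∃ g ∈ U, g ∉ V := by
    by_contra! hc
    exact hl.ne_one (hi ▸ Subgroup.relIndex_eq_one.2 hc)
  obtain ⟨t, ht, hgt⟩ : ∃ t : Ω, (∀ v ∈ V, v t = t) ∧ g t ≠ t := by
    by_contra! hc
    exact hgV (mem_of_fixes hV hc)
  have hω0 : ω ≠ 0 := hω.ne_zero hl.ne_zero
  have hgl : g ^ l ∈ V := by
    have : (V.subgroupOf U).Normal := ⟨fun v hv u => hn u u.2 v hv⟩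
    have := Subgroup.pow_index_mem (H := V.subgroupOf U) ⟨g, hg⟩
    rw [show (V.subgroupOf U).index = l from hi] at this
    exact this
  have hVg : ∀ (j : ℕ), ∀ v ∈ V, v ((g ^ j) t) = (g ^ j) t := fun j v hv => by
    have hm : (g ^ j)⁻¹ * v * g ^ j ∈ V := by
      simpa using hn (g ^ j)⁻¹ (U.inv_mem (U.pow_mem hg j)) v hv
    have := ht _ hm
    have h2 : (g ^ j) (((g ^ j)⁻¹ * v * g ^ j) t) = (g ^ j) t := congrArg _ this
    rw [← AlgEquiv.mul_apply] at h2
    rw [← AlgEquiv.mul_apply]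
    convert h2 using 2
    group
  set r : ℕ → Ω := fun m => ∑ j ∈ Finset.range l, (ω⁻¹ ^ m) ^ j * (g ^ j) t with hr
  have hrV : ∀ m, ∀ v ∈ V, v (r m) = r m := fun m v hv => by
    simp only [hr, map_sum, map_mul, map_pow, map_inv₀, hωU v (hVU hv)]
    exact Finset.sum_congr rfl fun j _ => by rw [hVg j v hv]
  have hrg : ∀ m, g (r m) = ω ^ m * r m := fun m => by
    have h1 : g (r m) = ω ^ m * ∑ j ∈ Finset.range l, (ω⁻¹ ^ m) ^ (j + 1) * (g ^ (j + 1)) t := by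
      simp only [hr, map_sum, map_mul, map_pow, map_inv₀, hωU g hg, Finset.mul_sum]
      refine Finset.sum_congr rfl fun j _ => ?_
      have h2 : ω ^ m * ω⁻¹ ^ m = 1 := by
        rw [inv_pow, mul_inv_cancel₀ (pow_ne_zero _ hω0)]
      rw [pow_succ' g, AlgEquiv.mul_apply, pow_succ]
      linear_combination (-(ω⁻¹ ^ m) ^ j * g ((g ^ j) t)) * h2
    rw [h1]
    congr 1
    have h2 := Finset.sum_range_succ' (fun j => (ω⁻¹ ^ m) ^ j * (g ^ j) t) l
    rw [Finset.sum_range_succ] at h2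
    have h3 : (ω⁻¹ ^ m) ^ l * (g ^ l) t = (ω⁻¹ ^ m) ^ 0 * (g ^ 0) t := by
      rw [ht _ hgl, ← pow_mul, mul_comm m, pow_mul, inv_pow, hω.pow_eq_one]
      simp
    rw [h3] at h2
    exact (add_right_cancel h2).symm
  obtain ⟨m, hm, hm0⟩ : ∃ m, ω ^ m ≠ 1 ∧ r m ≠ 0 := by
    by_contra! hc
    have hs : ∑ m ∈ Finset.range l, r m = l * t := by
      simp only [hr]
      rw [Finset.sum_comm, Finset.sum_eq_single_of_mem 0 (Finset.mem_range.2 hl.pos)]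
      · simp
      · intro j hj hj0
        rw [← Finset.sum_mul]
        have hζ : ω⁻¹ ^ j ≠ 1 := by
          rw [inv_pow, Ne, inv_eq_one]
          exact fun hc => hj0 (Nat.eq_zero_of_dvd_of_lt (hω.dvd_of_pow_eq_one j hc)
            (Finset.mem_range.1 hj))
        have h0 : ∑ m ∈ Finset.range l, (ω⁻¹ ^ m) ^ j = 0 := by
          simp_rw [← pow_mul, mul_comm _ j, pow_mul]
          rw [geom_sum_eq hζ, ← pow_mul, mul_comm, pow_mul, inv_pow, hω.pow_eq_one]
          simp
        rw [h0, zero_mul]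
    have hg1 : g (∑ m ∈ Finset.range l, r m) = ∑ m ∈ Finset.range l, r m := by
      rw [map_sum]
      refine Finset.sum_congr rfl fun m _ => ?_
      rw [hrg]
      by_cases h1 : ω ^ m = 1
      · rw [h1, one_mul]
      · rw [hc m h1, mul_zero]
    rw [hs, map_mul, map_natCast] at hg1
    exact hgt (mul_left_cancel₀ (Nat.cast_ne_zero.2 hl.ne_zero) hg1)
  have hyl : ∀ u ∈ U, u (r m ^ l) = r m ^ l := by
    by_contra hc
    have := eq_of_le_of_relIndex_prime hl (V := V) (W := U ⊓ MulAction.stabilizer _ (r m ^ l))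
      (le_inf hVU fun v hv => by rw [mem_stabilizer, map_pow, hrV m v hv]) inf_le_left hi
      (fun hle => hc fun u hu => (hle hu).2)
    apply hgV
    rw [this]
    refine ⟨hg, ?_⟩
    change g (r m ^ l) = r m ^ l
    rw [map_pow, hrg, mul_pow, ← pow_mul, mul_comm m, pow_mul, hω.pow_eq_one,
      one_pow, one_mul]
  refine ⟨r m, hm0, hyl, eq_of_le_of_relIndex_prime hl
    (le_inf hVU fun v hv => hrV m v hv) inf_le_left hi fun hle => ?_⟩
  have : g (r m) = r m := (hle hg).2
  rw [hrg, mul_eq_right₀ hm0] at this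
  exact hm this

end Kummer

section ResidueCharacteristic

variable {Ω : Type*} [Field Ω] [CharZero Ω] [Algebra.IsAlgebraic ℚ Ω] [IsAlgClosed Ω]

attribute [local instance] isGalois_rat numberField_of_finiteDimensional

variable {O : ValuationSubring Ω} {U H : Subgroup (Ω ≃ₐ[ℚ] Ω)} {π ζ : Ω}

theorem IsLocalParameters.valuation_le (h : IsLocalParameters O U π ζ) {x : Ω}
    (hx : ∀ u ∈ U, u x = x) (hx1 : O.valuation x < 1) : O.valuation x ≤ O.valuation π := by
  by_cases hx0 : x = 0
  · simp [hx0]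
  have hπ0 : O.valuation π ≠ 0 := (Valuation.ne_zero_iff _).2 h.ne_zero
  obtain ⟨n, hn⟩ := h.exists_zpow x hx hx0
  rw [map_mul, map_zpow₀] at hn
  rcases n with n | n
  · rw [Int.ofNat_eq_natCast, zpow_natCast] at hn
    exact absurd hn (mul_lt_one_of_lt_of_le hx1 (pow_le_one' h.valuation_lt.le n)).ne
  · rw [zpow_negSucc, mul_inv_eq_one₀ (pow_ne_zero _ hπ0)] at hn
    rw [hn, pow_succ]
    exact mul_le_of_le_one_left' (pow_le_one' h.valuation_lt.le n)

theorem IsLocalParameters.pow_ne (h : IsLocalParameters O U π ζ) {p : ℕ} (hp : p.Prime) {t s : Ω}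
    (ht : ∀ u ∈ U, u t = t) (hs : O.valuation s = 1) : t ^ p ≠ π * s := by
  intro he
  have hs0 : s ≠ 0 := by rintro rfl; simp at hs
  have ht0 : t ≠ 0 := by
    rintro rfl
    rw [zero_pow hp.ne_zero] at he
    exact mul_ne_zero h.ne_zero hs0 he.symm
  obtain ⟨n, hn⟩ := h.exists_zpow t ht ht0
  have h1 : O.valuation (π ^ (n * p + 1)) = 1 := by
    have h2 := congrArg (· ^ p) hn
    simp only [one_pow] at h2
    rw [← map_pow, mul_pow, he, ← zpow_natCast, ← zpow_mul, mul_right_comm, map_mul, hs,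
      mul_one] at h2
    rw [zpow_add₀ h.ne_zero, zpow_one, mul_comm]
    exact h2
  have h3 := h.valuation_zpow_eq_one h1
  have : (p : ℤ) ∣ 1 := ⟨-n, by linear_combination h3⟩
  exact hp.one_lt.ne' (by exact_mod_cast Int.eq_one_of_dvd_one (by positivity) this)

theorem IsLocalParameters.pow_sub_one_le (h : IsLocalParameters O U π ζ) {p : ℕ} (hp : p.Prime)
    (hp3 : 3 ≤ p) (hv : O.valuation (p : Ω) ≤ O.valuation π ^ 3) {t : Ω} (ht : ∀ u ∈ U, u t = t)
    (ht1 : O.valuation (t ^ p - 1) < 1) : O.valuation (t ^ p - 1) ≤ O.valuation π ^ 3 := by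
  have hπ1 : O.valuation π ^ 3 < 1 := pow_lt_one₀ zero_le h.valuation_lt (by norm_num)
  have ht2 : O.valuation (t ^ p) = 1 := valuation_eq_one_of_near_one ht1
  have ht3 : O.valuation t ≤ 1 := by
    rw [map_pow] at ht2
    exact (pow_le_one_iff hp.ne_zero).1 ht2.le
  have hm : t - 1 ∈ O := sub_mem ((O.valuation_le_one_iff t).1 ht3) O.one_mem
  obtain ⟨r, hr⟩ := exists_add_pow_prime_eq hp (⟨t - 1, hm⟩ : O) 1
  have hr' : t ^ p = (t - 1) ^ p + 1 + p * (t - 1) * r := by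
    have := congrArg (fun z : O => (z : Ω)) hr
    push_cast at this
    simpa using this
  have hpx : O.valuation (p * (t - 1) * r) ≤ O.valuation π ^ 3 := by
    rw [mul_assoc, map_mul]
    refine (mul_le_of_le_one_right' ?_).trans hv
    rw [map_mul]
    exact mul_le_one' ((O.valuation_le_one_iff _).2 hm) ((O.valuation_le_one_iff _).2 r.2)
  have hx1 : O.valuation (t - 1) < 1 := by
    have : O.valuation ((t - 1) ^ p) < 1 := by
      have e : (t - 1) ^ p = (t ^ p - 1) - p * (t - 1) * r := by rw [hr']; ring
      rw [e]
      exact (Valuation.map_sub _ _ _).trans_lt (max_lt ht1 (hpx.trans_lt hπ1))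
    rw [map_pow] at this
    exact (pow_lt_one_iff hp.ne_zero).1 this
  have hx2 := h.valuation_le (x := t - 1) (fun u hu => by rw [map_sub, ht u hu, map_one]) hx1
  have e : t ^ p - 1 = (t - 1) ^ p + p * (t - 1) * r := by rw [hr']; ring
  rw [e]
  refine (Valuation.map_add _ _ _).trans (max_le ?_ hpx)
  rw [map_pow]
  calc O.valuation (t - 1) ^ p ≤ O.valuation π ^ p := pow_le_pow_left' hx2 p
    _ ≤ O.valuation π ^ 3 := pow_le_pow_right_of_le_one' h.valuation_lt.le hp3

theorem smallRank_of_valuation_eq_one (hO : O ≠ ⊤) (hH : IsClosed (H : Set (Ω ≃ₐ[ℚ] Ω)))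
    (hHO : H ≤ MulAction.stabilizer _ O) (hi : H.relIndex (MulAction.stabilizer _ O) ≠ 0) {l : ℕ}
    (hl : l.Prime) (hv : O.valuation (l : Ω) = 1) : SmallRank l H := by
  have : NeZero (l : Ω) := ⟨Nat.cast_ne_zero.2 hl.ne_zero⟩
  obtain ⟨ω, hω⟩ := HasEnoughRootsOfUnity.exists_primitiveRoot Ω l
  refine ⟨H ⊓ MulAction.stabilizer _ ω, inf_le_left, hH.inter (isClosed_stabilizer ω),
    relIndex_ne_zero_of_isOpen (isOpen_stabilizer ω) H, fun U hU₀ hU hUi V₁ V₂ V₃ h₁ h₂ h₃ hne => ?_⟩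
  have hUH := hU₀.trans inf_le_left
  have hωU : ∀ u ∈ U, u ω = ω := fun u hu => (hU₀ hu).2
  have hUO := hUH.trans hHO
  obtain ⟨π, ζ, h⟩ := exists_local_parameters hO hU hUO (Subgroup.relIndex_ne_zero_trans hUi hi)
  have hζ0 : ζ ≠ 0 := by
    have := h.valuation_eq
    rintro rfl
    simp at this
  obtain ⟨a, ha⟩ := IsAlgClosed.exists_pow_nat_eq π hl.pos
  obtain ⟨b, hb⟩ := IsAlgClosed.exists_pow_nat_eq ζ hl.pos
  have ha0 : a ≠ 0 := by rintro rfl; exact h.ne_zero (by rw [← ha, zero_pow hl.ne_zero])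
  have hb0 : b ≠ 0 := by rintro rfl; exact hζ0 (by rw [← hb, zero_pow hl.ne_zero])
  have hda := kummer_relIndex_dvd hl ha0 hω hωU (by rw [ha]; exact h.fixes_left)
  have hdb := kummer_relIndex_dvd hl hb0 hω hωU (by rw [hb]; exact h.fixes_right)
  set W := MulAction.stabilizer (Ω ≃ₐ[ℚ] Ω) a ⊓ MulAction.stabilizer (Ω ≃ₐ[ℚ] Ω) b with hW
  have hWi : W.relIndex U ≤ l * l := Subgroup.relIndex_inf_le.trans
    (Nat.mul_le_mul (Nat.le_of_dvd hl.pos hda) (Nat.le_of_dvd hl.pos hdb))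
  have hW0 : W.relIndex U ≠ 0 := Subgroup.relIndex_inf_ne_zero
    (fun hc => hl.ne_zero (zero_dvd_iff.1 (hc ▸ hda)))
    (fun hc => hl.ne_zero (zero_dvd_iff.1 (hc ▸ hdb)))
  have hWV : ∀ V, IsNormalIndex l V U → W ⊓ U ≤ V := by
    intro V hV
    obtain ⟨y, hy0, hyl, rfl⟩ := hV.exists_kummer hl hω hωU
    obtain ⟨n, k, hnk⟩ := h.exists_eq_pow hUO hyl (pow_ne_zero _ hy0)
    obtain ⟨w, hw0, hw, -, he⟩ := hnk l hv
    obtain ⟨x, hx⟩ : ∃ x, x = a ^ n * b ^ k * w := ⟨_, rfl⟩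
    have hx0 : x ≠ 0 := hx ▸
      mul_ne_zero (mul_ne_zero (zpow_ne_zero _ ha0) (pow_ne_zero _ hb0)) hw0
    have hyx : (y / x) ^ l = 1 := by
      rw [div_pow y x l, he, hx, mul_pow, mul_pow, ← pow_mul, mul_comm k, pow_mul, hb,
        ← zpow_natCast (a ^ n), ← zpow_mul, mul_comm n, zpow_mul, zpow_natCast, ha]
      exact div_self (mul_ne_zero (mul_ne_zero (zpow_ne_zero _ h.ne_zero) (pow_ne_zero _ hζ0))
        (pow_ne_zero _ hw0))
    have : NeZero l := ⟨hl.ne_zero⟩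
    obtain ⟨i, -, hi⟩ := hω.eq_pow_of_pow_eq_one hyx
    rw [eq_div_iff hx0] at hi
    rintro u ⟨⟨hua, hub⟩, hu⟩
    refine ⟨hu, ?_⟩
    change u y = y
    rw [← hi, hx, map_mul, map_pow, hωU u hu, map_mul, map_mul, map_pow, map_zpow₀,
      (show u a = a from hua), (show u b = b from hub), hw u hu]
  have h12 : (V₁ ⊓ V₂).relIndex U = l * l := by
    rw [← Subgroup.relIndex_mul_relIndex _ V₁ U inf_le_left h₁.1, h₁.2.2.2,
      Subgroup.inf_relIndex_left]
    congr 1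
    obtain ⟨y, hy0, hyl, hV⟩ := h₂.exists_kummer hl hω hωU
    have hd := kummer_relIndex_dvd (U := V₁) hl hy0 hω (fun u hu => hωU u (h₁.1 hu))
      (fun u hu => hyl u (h₁.1 hu))
    have e : V₂.relIndex V₁ = (MulAction.stabilizer _ y).relIndex V₁ := by
      rw [hV, ← Subgroup.inf_relIndex_left, ← inf_assoc, inf_eq_left.2 h₁.1,
        Subgroup.inf_relIndex_left]
    rw [e]
    refine ((Nat.dvd_prime hl).1 hd).resolve_left fun hc => hne ?_
    rw [← e, Subgroup.relIndex_eq_one] at hc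
    refine eq_of_le_of_relIndex_prime hl hc h₂.1 h₁.2.2.2 fun hle => ?_
    have := h₂.2.2.2
    rw [Subgroup.relIndex_eq_one.2 hle] at this
    exact hl.ne_one this.symm
  have hWle : W ⊓ U ≤ V₁ ⊓ V₂ := le_inf (hWV _ h₁) (hWV _ h₂)
  have hm := Subgroup.relIndex_mul_relIndex (W ⊓ U) (V₁ ⊓ V₂) U hWle (inf_le_left.trans h₁.1)
  rw [h12, Subgroup.inf_relIndex_right] at hm
  have h1 : (W ⊓ U).relIndex (V₁ ⊓ V₂) = 1 := by
    have hpos := Nat.mul_pos hl.pos hl.pos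
    rw [← hm] at hWi hW0
    have h1 := Nat.pos_of_ne_zero (left_ne_zero_of_mul hW0)
    have h2 := Nat.le_of_mul_le_mul_right (hWi.trans_eq (one_mul _).symm) hpos
    omega
  exact (Subgroup.relIndex_eq_one.1 h1).trans (hWV _ h₃)

theorem not_smallRank_of_valuation_lt_one (hO : O ≠ ⊤)
    (hHO : H ≤ MulAction.stabilizer _ O) (hi : H.relIndex (MulAction.stabilizer _ O) ≠ 0) {p : ℕ}
    (hp : p.Prime) (hp3 : 3 ≤ p) (hv : O.valuation (p : Ω) < 1) : ¬ SmallRank p H := by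
  rintro ⟨U₀, h₀, hc, h₀i, hr⟩
  have : NeZero (p : Ω) := ⟨Nat.cast_ne_zero.2 hp.ne_zero⟩
  obtain ⟨ω, hω⟩ := HasEnoughRootsOfUnity.exists_primitiveRoot Ω p
  obtain ⟨ρ, hρ⟩ := IsAlgClosed.exists_pow_nat_eq (p : Ω) (n := 3) (by norm_num)
  obtain ⟨U, hUd⟩ : ∃ U, U = U₀ ⊓ (MulAction.stabilizer (Ω ≃ₐ[ℚ] Ω) ω ⊓
    MulAction.stabilizer (Ω ≃ₐ[ℚ] Ω) ρ) := ⟨_, rfl⟩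
  have hU : IsClosed (U : Set (Ω ≃ₐ[ℚ] Ω)) := hUd ▸
    hc.inter ((isClosed_stabilizer ω).inter (isClosed_stabilizer ρ))
  have hU₀ : U ≤ U₀ := hUd ▸ inf_le_left
  have hUi : U.relIndex H ≠ 0 := by
    refine Subgroup.relIndex_ne_zero_trans ?_ h₀i
    rw [hUd]
    exact relIndex_ne_zero_of_isOpen ((isOpen_stabilizer ω).inter (isOpen_stabilizer ρ)) U₀
  have hr := hr U hU₀ hU hUi
  have hωU : ∀ u ∈ U, u ω = ω := fun u hu => (hUd ▸ hu).2.1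
  have hρU : ∀ u ∈ U, u ρ = ρ := fun u hu => (hUd ▸ hu).2.2
  obtain ⟨π, ζ, h⟩ := exists_local_parameters hO hU ((hU₀.trans h₀).trans hHO)
    (Subgroup.relIndex_ne_zero_trans hUi hi)
  have hπ0 : 0 < O.valuation π := zero_lt_iff.2 ((Valuation.ne_zero_iff _).2 h.ne_zero)
  have hπ1 := h.valuation_lt
  have hπO : π ∈ O := (O.valuation_le_one_iff _).1 hπ1.le
  have hpπ : O.valuation (p : Ω) ≤ O.valuation π ^ 3 := by
    rw [← hρ, map_pow] at hv ⊢
    exact pow_le_pow_left' (h.valuation_le hρU ((pow_lt_one_iff (by norm_num)).1 hv)) 3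
  have hx1 : O.valuation (1 + π ^ 2) = 1 := by
    apply valuation_eq_one_of_near_one
    rw [add_sub_cancel_left, map_pow]
    exact pow_lt_one₀ zero_le hπ1 (by norm_num)
  have hx2 : O.valuation (1 + π) = 1 := by
    apply valuation_eq_one_of_near_one
    rwa [add_sub_cancel_left]
  obtain ⟨y₁, hy₁⟩ := IsAlgClosed.exists_pow_nat_eq (1 + π ^ 2) hp.pos
  obtain ⟨y₂, hy₂⟩ := IsAlgClosed.exists_pow_nat_eq (1 + π) hp.pos
  obtain ⟨y₃, hy₃⟩ := IsAlgClosed.exists_pow_nat_eq π hp.pos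
  have hne0 : ∀ {y x : Ω}, y ^ p = x → x ≠ 0 → y ≠ 0 := by
    rintro y x h hx rfl
    exact hx (by rw [← h, zero_pow hp.ne_zero])
  have h10 : y₁ ≠ 0 := hne0 hy₁ (by intro h; simp [h] at hx1)
  have h20 : y₂ ≠ 0 := hne0 hy₂ (by intro h; simp [h] at hx2)
  have h30 : y₃ ≠ 0 := hne0 hy₃ h.ne_zero
  have hf₁ : ∀ u ∈ U, u (y₁ ^ p) = y₁ ^ p := fun u hu => by
    rw [hy₁, map_add, map_one, map_pow, h.fixes_left u hu]
  have hf₂ : ∀ u ∈ U, u (y₂ ^ p) = y₂ ^ p := fun u hu => by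
    rw [hy₂, map_add, map_one, h.fixes_left u hu]
  have hf₃ : ∀ u ∈ U, u (y₃ ^ p) = y₃ ^ p := fun u hu => by
    rw [hy₃, h.fixes_left u hu]
  have hn₁ : ¬ ∀ u ∈ U, u y₁ = y₁ := fun hc => by
    have := h.pow_sub_one_le hp hp3 hpπ hc (by
      rw [hy₁, add_sub_cancel_left, map_pow]
      exact pow_lt_one₀ zero_le hπ1 (by norm_num))
    rw [hy₁, add_sub_cancel_left, map_pow] at this
    exact absurd this (pow_lt_pow_right_of_lt_one₀ hπ0 hπ1 (by norm_num)).not_ge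
  have hpow : ∀ k : ℕ, ∃ c ∈ O, (1 + π ^ 2) ^ k = 1 + π ^ 2 * c := by
    intro k
    induction k with
    | zero => exact ⟨0, O.zero_mem, by ring⟩
    | succ k ih =>
      obtain ⟨c, hc, h⟩ := ih
      refine ⟨c + 1 + π ^ 2 * c, O.add_mem _ _ (O.add_mem _ _ hc O.one_mem)
        (O.mul_mem _ _ (pow_mem hπO 2) hc), ?_⟩
      rw [pow_succ, h]
      ring
  have hn₂₁ : ∀ k : ℕ, ¬ ∀ u ∈ U, u (y₂ * y₁ ^ k) = y₂ * y₁ ^ k := fun k hc => by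
    obtain ⟨c, hcO, hck⟩ := hpow k
    have he : (y₂ * y₁ ^ k) ^ p - 1 = π + π ^ 2 * ((1 + π) * c) := by
      rw [mul_pow, ← pow_mul, mul_comm k, pow_mul, hy₁, hy₂, hck]
      ring
    have hval : O.valuation (π + π ^ 2 * ((1 + π) * c)) = O.valuation π := by
      apply Valuation.map_add_eq_of_lt_left
      rw [map_mul, map_pow, sq, mul_assoc]
      refine mul_lt_of_lt_one_right hπ0 (mul_lt_one_of_lt_of_le hπ1 ?_)
      rw [map_mul, hx2, one_mul]
      exact (O.valuation_le_one_iff _).2 hcO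
    have := h.pow_sub_one_le hp hp3 hpπ hc (by rw [he, hval]; exact hπ1)
    rw [he, hval] at this
    refine absurd this (not_le_of_gt ?_)
    simpa using (pow_lt_pow_right_of_lt_one₀ hπ0 hπ1 (show 1 < 3 by norm_num))
  have hn₂ : ¬ ∀ u ∈ U, u y₂ = y₂ := by simpa using hn₂₁ 0
  have hn₃₂₁ : ∀ m k : ℕ, ¬ ∀ u ∈ U, u (y₃ * y₂ ^ m * y₁ ^ k) = y₃ * y₂ ^ m * y₁ ^ k := by
    intro m k hc
    refine h.pow_ne hp (s := (1 + π) ^ m * (1 + π ^ 2) ^ k) hc ?_ ?_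
    · rw [map_mul, map_pow, map_pow, hx1, hx2, one_pow, one_pow, one_mul]
    · rw [mul_pow, mul_pow, hy₃, ← pow_mul, ← pow_mul, mul_comm m, mul_comm k, pow_mul, pow_mul,
        hy₁, hy₂, mul_assoc]
  have hn₃ : ¬ ∀ u ∈ U, u y₃ = y₃ := by simpa using hn₃₂₁ 0 0
  have hV₁ := kummer_isNormalIndex hU hp h10 hω hωU hf₁ hn₁
  have hV₂ := kummer_isNormalIndex hU hp h20 hω hωU hf₂ hn₂
  have hV₃ := kummer_isNormalIndex hU hp h30 hω hωU hf₃ hn₃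
  have h12 : ¬ ∀ u ∈ U, u y₁ = y₁ → u y₂ = y₂ := fun hc => by
    obtain ⟨k, hk⟩ := kummer_mul_pow hp h10 h20 hω hωU hf₁ hf₂ hn₁ hc
    exact hn₂₁ k hk
  have hle := hr _ _ _ hV₁ hV₂ hV₃ fun he => h12 fun u hu hu1 => by
    have : u ∈ U ⊓ MulAction.stabilizer _ y₁ := ⟨hu, hu1⟩
    rw [he] at this
    exact this.2
  obtain ⟨m, hm⟩ := kummer_mul_pow (U := U ⊓ MulAction.stabilizer _ y₁) hp h20 h30 hω
    (fun u hu => hωU u hu.1) (fun u hu => hf₂ u hu.1) (fun u hu => hf₃ u hu.1)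
    (fun hc => h12 fun u hu hu1 => hc u ⟨hu, hu1⟩)
    (fun u hu hu2 => (hle ⟨hu, hu.1, hu2⟩).2)
  obtain ⟨k, hk⟩ := kummer_mul_pow hp h10 (mul_ne_zero h30 (pow_ne_zero m h20)) hω hωU hf₁
    (fun u hu => by
      rw [mul_pow, ← pow_mul, mul_comm m, pow_mul, map_mul, map_pow u (y₂ ^ p), hf₂ u hu, hf₃ u hu])
    hn₁ (fun u hu hu1 => hm u ⟨hu, hu1⟩)
  exact hn₃₂₁ m k hk

theorem smallRank_iff (h : IsOdd O) (hH : IsClosed (H : Set (Ω ≃ₐ[ℚ] Ω)))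
    (hHO : H ≤ MulAction.stabilizer _ O) (hi : H.relIndex (MulAction.stabilizer _ O) ≠ 0) {l : ℕ}
    (hl : l.Prime) (hl2 : l ≠ 2) : SmallRank l H ↔ ¬ O.valuation (l : Ω) < 1 := by
  refine ⟨fun hr hv => not_smallRank_of_valuation_lt_one h.1 hHO hi hl
    (hl.two_le.lt_of_ne' hl2) hv hr, fun hv => smallRank_of_valuation_eq_one h.1 hH hHO hi hl ?_⟩
  refine (not_lt.1 hv).antisymm' ?_
  exact_mod_cast valuation_int_le O l

/-- Isomorphisms between open subgroups preserve decomposition groups and residue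
characteristics. -/
theorem exists_place_of_continuousMulEquiv {U U' : Subgroup (Ω ≃ₐ[ℚ] Ω)}
    (hU : IsOpen (U : Set (Ω ≃ₐ[ℚ] Ω))) (hU' : IsOpen (U' : Set (Ω ≃ₐ[ℚ] Ω))) (α : U ≃ₜ* U')
    {O : ValuationSubring Ω} (h : IsOdd O) : ∃ O' : ValuationSubring Ω, IsOdd O' ∧
      transport α (MulAction.stabilizer _ O ⊓ U) = MulAction.stabilizer _ O' ⊓ U' ∧
      ∀ p : ℕ, p.Prime → (O'.valuation (p : Ω) < 1 ↔ O.valuation (p : Ω) < 1) := by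
  obtain ⟨O', h', ht⟩ := exists_eq_of_continuousMulEquiv hU hU' α h
  refine ⟨O', h', ht, fun p hp => ?_⟩
  by_cases hp2 : p = 2
  · subst hp2
    have h1 := h.2
    have h2 := h'.2
    push_cast
    simp [h1, h2]
  have hUc := Subgroup.isClosed_of_isOpen _ hU
  have hUc' := Subgroup.isClosed_of_isOpen _ hU'
  have e := smallRank_iff h ((isClosed_decomposition O).inter hUc) inf_le_left
    (relIndex_ne_zero_of_isOpen hU _) hp hp2
  have e' := smallRank_iff h' ((isClosed_decomposition O').inter hUc') inf_le_left
    (relIndex_ne_zero_of_isOpen hU' _) hp hp2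
  rw [← not_iff_not, ← e, ← e', ← ht]
  refine ⟨fun hr => ?_, fun hr => hr.transport α hUc hUc' inf_le_right⟩
  have := hr.transport α.symm hUc' hUc (transport_le α _)
  rwa [transport_symm_transport α inf_le_right] at this

end ResidueCharacteristic

section Zeta

open Filter Topology
variable (K : Type*) [Field K] [NumberField K]

theorem hasSum_dedekindZeta :
    ∀ᶠ s : ℝ in 𝓝[>] 1, ∃ Z : ℝ, (s - 1) * Z ∈ Set.Icc (dedekindZeta_residue K / 2)
      (2 * dedekindZeta_residue K) ∧
      HasSum (fun n : ℕ ↦ (Nat.card {I : Ideal (𝓞 K) // Ideal.absNorm I = n} : ℝ) *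
        (n : ℝ) ^ (-s)) Z := by
  have hρ := dedekindZeta_residue_pos K
  have h := (Complex.continuous_re.tendsto _).comp (tendsto_sub_one_mul_dedekindZeta_nhdsGT K)
  have h1 := h.eventually (Icc_mem_nhds (a := dedekindZeta_residue K / 2)
    (b := 2 * dedekindZeta_residue K) (by simp; linarith) (by simp; linarith))
  filter_upwards [h1, self_mem_nhdsWithin] with s hs hs1
  have hs1 : 1 < s := hs1
  have key : ((fun s : ℝ ↦ ((s - 1) * dedekindZeta K s : ℂ)) s).re =
      (s - 1) * (dedekindZeta K s).re := by
    have : ((s : ℂ) - 1) = ((s - 1 : ℝ) : ℂ) := by push_cast; ring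
    simp only [this, Complex.re_ofReal_mul]
  simp only [Function.comp_apply] at hs
  rw [key] at hs
  refine ⟨(dedekindZeta K s).re, hs, ?_⟩
  have hsum : LSeriesSummable (fun n ↦ (Nat.card {I : Ideal (𝓞 K) // Ideal.absNorm I = n} : ℂ)) s := by
    by_contra hc
    have : dedekindZeta K s = 0 := tsum_eq_zero_of_not_summable hc
    rw [this] at hs
    simp at hs
    linarith [hs.1]
  have h2 := Complex.hasSum_re hsum.hasSum
  have h2 : HasSum _ (dedekindZeta K s).re := h2
  refine Eq.mp (congrArg (fun f ↦ HasSum f (dedekindZeta K s).re) (funext fun n ↦ Eq.symm ?_)) h2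
  rcases eq_or_ne n 0 with rfl | hn
  · simp [Real.zero_rpow (show -s ≠ 0 by linarith)]
  · rw [LSeries.term_of_ne_zero hn, Real.rpow_neg (Nat.cast_nonneg n), ← div_eq_mul_inv]
    have : ((n : ℂ) ^ (s : ℂ)) = (((n : ℝ) ^ s : ℝ) : ℂ) := by
      rw [Complex.ofReal_cpow (Nat.cast_nonneg n)]; simp
    rw [this, ← Complex.ofReal_natCast, ← Complex.ofReal_div, Complex.ofReal_re]

/-- Two-sided bounds for the sums of `N(I) ^ (-s)` over finite sets of ideals. -/
theorem zeta_bounds :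
    ∃ c > 0, ∃ C > 0, ∀ᶠ s : ℝ in 𝓝[>] 1,
      (∀ T : Finset (Ideal (𝓞 K)), ∑ I ∈ T, (Ideal.absNorm I : ℝ) ^ (-s) ≤ C / (s - 1)) ∧
      ∃ T : Finset (Ideal (𝓞 K)), ⊥ ∉ T ∧
        c / (s - 1) ≤ ∑ I ∈ T, (Ideal.absNorm I : ℝ) ^ (-s) := by
  classical
  have hρ := dedekindZeta_residue_pos K
  refine ⟨dedekindZeta_residue K / 4, by positivity, 2 * dedekindZeta_residue K, by positivity, ?_⟩
  filter_upwards [hasSum_dedekindZeta K, self_mem_nhdsWithin] with s ⟨Z, hZ, hs⟩ hs1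
  have hs1 : 0 < s - 1 := sub_pos.mpr hs1
  have hfib : ∀ (T : Finset (Ideal (𝓞 K))) (n : ℕ),
      ∑ I ∈ T with Ideal.absNorm I = n, (Ideal.absNorm I : ℝ) ^ (-s) =
        ({I ∈ T | Ideal.absNorm I = n}.card : ℝ) * (n : ℝ) ^ (-s) := by
    intro T n
    rw [← nsmul_eq_mul, ← Finset.sum_const]
    refine Finset.sum_congr rfl fun I hI ↦ ?_
    rw [(Finset.mem_filter.mp hI).2]
  have hfin : ∀ n : ℕ, Finite {I : Ideal (𝓞 K) // Ideal.absNorm I = n} := fun n ↦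
    (Ideal.finite_setOfPred_absNorm_eq n).to_subtype
  constructor
  · intro T
    rw [← Finset.sum_fiberwise_of_maps_to (t := T.image Ideal.absNorm)
      (fun I hI ↦ Finset.mem_image_of_mem _ hI)]
    calc _ ≤ ∑ n ∈ T.image Ideal.absNorm,
          (Nat.card {I : Ideal (𝓞 K) // Ideal.absNorm I = n} : ℝ) * (n : ℝ) ^ (-s) := by
          refine Finset.sum_le_sum fun n _ ↦ ?_
          rw [hfib]
          refine mul_le_mul_of_nonneg_right ?_ (Real.rpow_nonneg (Nat.cast_nonneg n) _)
          have := Fintype.ofFinite {I : Ideal (𝓞 K) // Ideal.absNorm I = n}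
          rw [Nat.card_eq_fintype_card, ← Finset.card_univ,
            ← Finset.card_map (Function.Embedding.subtype _)]
          exact_mod_cast Finset.card_le_card fun I hI ↦ by simpa using (Finset.mem_filter.mp hI).2
      _ ≤ Z := sum_le_hasSum _ (fun n _ ↦ mul_nonneg (Nat.cast_nonneg _)
          (Real.rpow_nonneg (Nat.cast_nonneg n) _)) hs
      _ ≤ _ := by rw [le_div_iff₀ hs1]; linarith [hZ.2]
  · have hlt : dedekindZeta_residue K / 4 / (s - 1) < Z := by
      rw [div_lt_iff₀ hs1]; linarith [hZ.1]
    obtain ⟨S, hS⟩ := (hs.eventually (lt_mem_nhds hlt)).exists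
    have hfin' : ∀ n : ℕ, Set.Finite {I : Ideal (𝓞 K) | Ideal.absNorm I = n} := fun n ↦
      Ideal.finite_setOfPred_absNorm_eq n
    let T : Finset (Ideal (𝓞 K)) := S.biUnion fun n ↦ (hfin' n).toFinset
    have hT : ∀ I, I ∈ T ↔ Ideal.absNorm I ∈ S := by intro I; simp [T]
    refine ⟨T.erase ⊥, by simp, hS.le.trans ?_⟩
    have h0 : ∑ I ∈ T.erase ⊥, (Ideal.absNorm I : ℝ) ^ (-s) = ∑ I ∈ T, (Ideal.absNorm I : ℝ) ^ (-s) :=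
      Finset.sum_erase _ (by simp [Real.zero_rpow (show -s ≠ 0 by linarith)])
    rw [h0, ← Finset.sum_fiberwise_of_maps_to (t := S) (fun I hI ↦ (hT I).mp hI)]
    refine Finset.sum_le_sum fun n hn ↦ ?_
    rw [hfib]
    refine mul_le_mul_of_nonneg_right ?_ (Real.rpow_nonneg (Nat.cast_nonneg n) _)
    have := Fintype.ofFinite {I : Ideal (𝓞 K) // Ideal.absNorm I = n}
    rw [Nat.card_eq_fintype_card, ← Finset.card_univ,
      ← Finset.card_map (Function.Embedding.subtype _)]
    refine Nat.cast_le.mpr (Finset.card_le_card fun I hI ↦ ?_)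
    have hI : Ideal.absNorm I = n := by simpa using hI
    exact Finset.mem_filter.mpr ⟨(hT I).mpr (hI ▸ hn), hI⟩

end Zeta
section Zeta

open Filter Topology
variable (K : Type*) [Field K] [NumberField K]

/-- The completely multiplicative function `I ↦ N(I) ^ (-s)`. -/
noncomputable def idealWeight (s : ℝ) : Ideal (𝓞 K) →* ℝ where
  toFun I := (Ideal.absNorm I : ℝ) ^ (-s)
  map_one' := by simp
  map_mul' I J := by
    rw [map_mul, Nat.cast_mul, Real.mul_rpow (Nat.cast_nonneg _) (Nat.cast_nonneg _)]

variable {K}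

theorem idealWeight_apply (s : ℝ) (I : Ideal (𝓞 K)) :
    idealWeight K s I = (Ideal.absNorm I : ℝ) ^ (-s) := rfl

theorem idealWeight_nonneg (s : ℝ) (I : Ideal (𝓞 K)) : 0 ≤ idealWeight K s I :=
  Real.rpow_nonneg (Nat.cast_nonneg _) _

theorem idealWeight_le_half {s : ℝ} (hs : 1 < s) {P : Ideal (𝓞 K)} (hP : Prime P) :
    idealWeight K s P ≤ 1 / 2 := by
  have h2 : 2 ≤ Ideal.absNorm P := by
    have h0 : Ideal.absNorm P ≠ 0 := by
      rw [Ne, Ideal.absNorm_eq_zero_iff]; exact hP.ne_zero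
    have h1 : Ideal.absNorm P ≠ 1 := by
      rw [Ne, Ideal.absNorm_eq_one_iff, ← Ideal.one_eq_top]; exact fun h ↦ hP.not_isUnit (h ▸ isUnit_one)
    omega
  have h2' : (2 : ℝ) ≤ Ideal.absNorm P := by exact_mod_cast h2
  calc idealWeight K s P ≤ (Ideal.absNorm P : ℝ) ^ (-1 : ℝ) :=
        Real.rpow_le_rpow_of_exponent_le (by linarith) (by linarith)
    _ = 1 / Ideal.absNorm P := by rw [Real.rpow_neg_one, one_div]
    _ ≤ 1 / 2 := one_div_le_one_div_of_le (by norm_num) h2'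

theorem idealWeight_sq_le {s : ℝ} (hs : 1 < s) {P : Ideal (𝓞 K)} (hP : Prime P) :
    idealWeight K s P ^ 2 ≤ (Ideal.absNorm P : ℝ) ^ (-(2 : ℝ)) := by
  have h0 : Ideal.absNorm P ≠ 0 := by
    rw [Ne, Ideal.absNorm_eq_zero_iff]; exact hP.ne_zero
  have h1 : (1 : ℝ) ≤ Ideal.absNorm P := by exact_mod_cast Nat.one_le_iff_ne_zero.mpr h0
  rw [idealWeight_apply, ← Real.rpow_mul_natCast (Nat.cast_nonneg _)]
  exact Real.rpow_le_rpow_of_exponent_le h1 (by push_cast; linarith)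

variable (K) in
theorem exists_sum_sq_le :
    ∃ D : ℝ, ∀ T : Finset (Ideal (𝓞 K)), (∀ P ∈ T, Prime P) →
      ∑ P ∈ T, (Ideal.absNorm P : ℝ) ^ (-(2 : ℝ)) ≤ D := by
  obtain ⟨c, hc, C, hC, h⟩ := zeta_bounds K
  have h2 : ∀ᶠ s : ℝ in 𝓝[>] 1, s < 2 :=
    eventually_nhdsWithin_of_eventually_nhds (gt_mem_nhds (by norm_num))
  obtain ⟨s, ⟨h, -⟩, hs⟩ := (h.and h2).exists
  refine ⟨_, fun T hT ↦ le_trans (Finset.sum_le_sum fun P hP ↦ ?_) (h T)⟩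
  have h0 : Ideal.absNorm P ≠ 0 := by
    rw [Ne, Ideal.absNorm_eq_zero_iff]; exact (hT P hP).ne_zero
  have h1 : (1 : ℝ) ≤ Ideal.absNorm P := by exact_mod_cast Nat.one_le_iff_ne_zero.mpr h0
  exact Real.rpow_le_rpow_of_exponent_le h1 (by linarith)

theorem exp_le_one_add_mul {x : ℝ} (h0 : 0 ≤ x) : Real.exp x ≤ (1 + x) * Real.exp (x ^ 2) := by
  have h : Real.exp (x - x ^ 2) ≤ 1 + x := by
    have h1 := Real.add_one_le_exp (-(x - x ^ 2))
    rw [← neg_neg (x - x ^ 2), Real.exp_neg]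
    by_cases hx : 0 < -(x - x ^ 2) + 1
    · refine (inv_anti₀ hx h1).trans ?_
      rw [inv_le_iff_one_le_mul₀ hx]
      nlinarith [pow_nonneg h0 3]
    · nlinarith [sq_nonneg (x - 1)]
  have : Real.exp x = Real.exp (x - x ^ 2) * Real.exp (x ^ 2) := by rw [← Real.exp_add]; ring_nf
  rw [this]
  exact mul_le_mul_of_nonneg_right h (Real.exp_nonneg _)

theorem inv_one_sub_le_exp {x : ℝ} (h : x ≤ 1 / 2) :
    (1 - x)⁻¹ ≤ Real.exp (x + 2 * x ^ 2) := by
  rw [inv_le_iff_one_le_mul₀ (by linarith)]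
  have h1 := Real.add_one_le_exp (x + 2 * x ^ 2)
  calc (1 : ℝ) ≤ (x + 2 * x ^ 2 + 1) * (1 - x) := by nlinarith [mul_nonneg (sq_nonneg x) (by linarith : 0 ≤ 1 - 2 * x)]
    _ ≤ _ := mul_le_mul_of_nonneg_right h1 (by linarith)

theorem prod_injOn_primes {T : Finset (Ideal (𝓞 K))} (hT : ∀ P ∈ T, Prime P) :
    Set.InjOn (fun U : Finset (Ideal (𝓞 K)) ↦ ∏ P ∈ U, P) (T.powerset : Set _) := by
  have key : ∀ U ∈ T.powerset, ∀ P ∈ T, P ∈ U ↔ P ∣ ∏ Q ∈ U, Q := by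
    intro U hU P hP
    refine ⟨fun h ↦ Finset.dvd_prod_of_mem _ h, fun h ↦ ?_⟩
    obtain ⟨Q, hQ, hPQ⟩ := ((hT P hP).dvd_finsetProd_iff _).mp h
    have := (hT P hP).associated_of_dvd (hT Q (Finset.mem_powerset.mp hU hQ)) hPQ
    rw [associated_iff_eq] at this
    exact this ▸ hQ
  intro U hU V hV hUV
  have hUV : ∏ P ∈ U, P = ∏ P ∈ V, P := hUV
  ext P
  constructor
  · intro h
    have hP := Finset.mem_powerset.mp hU h
    rw [key V hV P hP, ← hUV, ← key U hU P hP]; exact h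
  · intro h
    have hP := Finset.mem_powerset.mp hV h
    rw [key U hU P hP, hUV, ← key V hV P hP]; exact h

variable (K) in
theorem exp_sum_primes_le :
    ∃ C > 0, ∀ᶠ s : ℝ in 𝓝[>] 1, ∀ T : Finset (Ideal (𝓞 K)), (∀ P ∈ T, Prime P) →
      Real.exp (∑ P ∈ T, idealWeight K s P) ≤ C / (s - 1) := by
  classical
  obtain ⟨c, hc, C, hC, h⟩ := zeta_bounds K
  obtain ⟨D, hD⟩ := exists_sum_sq_le K
  refine ⟨C * Real.exp D, by positivity, ?_⟩
  filter_upwards [h, self_mem_nhdsWithin] with s ⟨h, _⟩ hs T hT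
  have hs : 1 < s := hs
  rw [Real.exp_sum]
  calc ∏ P ∈ T, Real.exp (idealWeight K s P)
      ≤ ∏ P ∈ T, ((1 + idealWeight K s P) * Real.exp (idealWeight K s P ^ 2)) :=
        Finset.prod_le_prod (fun _ _ ↦ Real.exp_nonneg _) fun P _ ↦
          exp_le_one_add_mul (idealWeight_nonneg s P)
    _ = (∏ P ∈ T, (1 + idealWeight K s P)) * Real.exp (∑ P ∈ T, idealWeight K s P ^ 2) := by
        rw [Finset.prod_mul_distrib, Real.exp_sum]
    _ ≤ C / (s - 1) * Real.exp D := by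
        refine mul_le_mul ?_ (Real.exp_le_exp.mpr ?_) (Real.exp_nonneg _) (div_nonneg hC.le (by linarith))
        · rw [Finset.prod_one_add]
          refine le_trans (le_of_eq ?_) (h (T.powerset.image fun U ↦ ∏ P ∈ U, P))
          refine Eq.trans ?_ (Finset.sum_image (f := idealWeight K s) (prod_injOn_primes hT)).symm
          exact Finset.sum_congr rfl fun U _ ↦ (map_prod _ _ _).symm
        · exact (Finset.sum_le_sum fun P hP ↦ idealWeight_sq_le hs (hT P hP)).trans (hD T hT)
    _ = _ := by ring

theorem sum_idealWeight_le_prod {s : ℝ} (hs : 1 < s) {T : Finset (Ideal (𝓞 K))} (hT : ⊥ ∉ T) :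
    ∃ Q : Finset (Ideal (𝓞 K)), (∀ P ∈ Q, Prime P) ∧
      ∑ I ∈ T, idealWeight K s I ≤ ∏ P ∈ Q, (1 - idealWeight K s P)⁻¹ := by
  classical
  let m : Ideal (𝓞 K) → Multiset (Ideal (𝓞 K)) := UniqueFactorizationMonoid.normalizedFactors
  let Q : Finset (Ideal (𝓞 K)) := T.biUnion fun I ↦ (m I).toFinset
  have hQ : ∀ P ∈ Q, Prime P := by
    intro P hP
    obtain ⟨I, hI, hP⟩ := Finset.mem_biUnion.mp hP
    exact UniqueFactorizationMonoid.prime_of_normalized_factor P (Multiset.mem_toFinset.mp hP)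
  have hprod : ∀ I ∈ T, I = ∏ P ∈ Q, P ^ (m I).count P := by
    intro I hI
    have h1 : (m I).prod = I := Ideal.prod_normalizedFactors_eq_self (fun h ↦ hT (h ▸ hI))
    conv_lhs => rw [← h1]
    exact Finset.prod_multiset_count_of_subset _ _ fun P hP ↦ Finset.mem_biUnion.mpr ⟨I, hI, hP⟩
  obtain ⟨E, hE⟩ : ∃ E : ℕ, ∀ I ∈ T, (m I).card < E :=
    ⟨T.sup (fun I ↦ (m I).card) + 1, fun I hI ↦
      Nat.lt_succ_of_le (Finset.le_sup (f := fun I ↦ (m I).card) hI)⟩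
  refine ⟨Q, hQ, ?_⟩
  have hgeom : ∀ P ∈ Q, ∑ e ∈ Finset.range E, idealWeight K s P ^ e ≤ (1 - idealWeight K s P)⁻¹ := by
    intro P hP
    have h1 := idealWeight_le_half hs (hQ P hP)
    exact sum_le_hasSum _ (fun _ _ ↦ pow_nonneg (idealWeight_nonneg s P) _)
      (hasSum_geometric_of_lt_one (idealWeight_nonneg s P) (by linarith))
  refine le_trans ?_ (Finset.prod_le_prod (fun P _ ↦ Finset.sum_nonneg fun _ _ ↦
    pow_nonneg (idealWeight_nonneg s P) _) hgeom)
  rw [Finset.prod_sum]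
  let φ : Ideal (𝓞 K) → ((P : Ideal (𝓞 K)) → P ∈ Q → ℕ) := fun I P _ ↦ (m I).count P
  have hφ : Set.InjOn φ (T : Set (Ideal (𝓞 K))) := by
    intro I hI J hJ hIJ
    rw [hprod I hI, hprod J hJ]
    refine Finset.prod_congr rfl fun P hP ↦ ?_
    rw [show (m I).count P = (m J).count P from congrFun (congrFun hIJ P) hP]
  calc ∑ I ∈ T, idealWeight K s I
      = ∑ I ∈ T, ∏ x ∈ Q.attach, idealWeight K s x.1 ^ φ I x.1 x.2 := by
        refine Finset.sum_congr rfl fun I hI ↦ ?_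
        conv_lhs => rw [hprod I hI, map_prod, ← Finset.prod_attach]
        simp [φ]
    _ = ∑ f ∈ T.image φ, ∏ x ∈ Q.attach, idealWeight K s x.1 ^ f x.1 x.2 :=
        (Finset.sum_image (f := fun f : (P : Ideal (𝓞 K)) → P ∈ Q → ℕ ↦
          ∏ x ∈ Q.attach, idealWeight K s x.1 ^ f x.1 x.2) hφ).symm
    _ ≤ _ := by
        refine Finset.sum_le_sum_of_subset_of_nonneg ?_ fun f _ _ ↦ Finset.prod_nonneg fun x _ ↦
          pow_nonneg (idealWeight_nonneg s _) _
        intro f hf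
        obtain ⟨I, hI, rfl⟩ := Finset.mem_image.mp hf
        exact Finset.mem_pi.mpr fun P hP ↦ Finset.mem_range.mpr
          ((Multiset.count_le_card _ _).trans_lt (hE I hI))

variable (K) in
theorem exists_sum_not_prime_le :
    ∃ D : ℝ, ∀ s > 1, ∀ Q : Finset (Ideal (𝓞 K)),
      (∀ P ∈ Q, Prime P ∧ ¬ (Ideal.absNorm P).Prime) → ∑ P ∈ Q, idealWeight K s P ≤ D := by
  classical
  have hsum : Summable fun n : ℕ ↦ (n : ℝ) ^ (-(2 : ℝ)) := Real.summable_nat_rpow.mpr (by norm_num)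
  refine ⟨Module.finrank ℚ K * ∑' n : ℕ, (n : ℝ) ^ (-(2 : ℝ)), fun s hs Q hQ ↦ ?_⟩
  have key : ∀ P ∈ Q, (Ideal.absNorm (Ideal.under ℤ P)).Prime ∧
      Ideal.absNorm (Ideal.under ℤ P) ^ 2 ≤ Ideal.absNorm P ∧
      P ∈ IsDedekindDomain.primesOverFinset
        (Ideal.span {((Ideal.absNorm (Ideal.under ℤ P) : ℕ) : ℤ)}) (𝓞 K) := by
    intro P hP
    obtain ⟨h1, h2⟩ := hQ P hP
    have hne : P ≠ ⊥ := h1.ne_zero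
    have := Ideal.isPrime_of_prime h1
    have : NeZero P := ⟨hne⟩
    have hp := Nat.absNorm_under_prime P
    have hspan : Ideal.span {((Ideal.absNorm (Ideal.under ℤ P) : ℕ) : ℤ)} = Ideal.under ℤ P :=
      Int.ideal_span_absNorm_eq_self _
    have hmax : (Ideal.under ℤ P).IsMaximal := by
      have : P.IsMaximal := Ideal.IsPrime.isMaximal ‹_› hne
      infer_instance
    refine ⟨hp, ?_, ?_⟩
    · have hN := Ideal.absNorm_pow_inertiaDeg (R := ℤ) (Ideal.under ℤ P) P
      rw [← hN] at h2 ⊢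
      refine Nat.pow_le_pow_right hp.pos ?_
      by_contra hf
      have : P.inertiaDeg ℤ = 0 ∨ P.inertiaDeg ℤ = 1 := by omega
      rcases this with hf | hf
      · exact (Ideal.inertiaDeg_pos P ℤ).ne' hf
      · rw [hf, pow_one] at h2
        exact h2 hp
    · rw [hspan]
      have h0 : Ideal.under ℤ P ≠ ⊥ := by
        intro h
        rw [h, Ideal.absNorm_bot] at hp
        exact Nat.not_prime_zero hp
      rw [IsDedekindDomain.mem_primesOverFinset_iff h0]
      exact ⟨inferInstance, inferInstance⟩
  rw [← Finset.sum_fiberwise_of_maps_to (t := Q.image fun P ↦ Ideal.absNorm (Ideal.under ℤ P))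
    (fun I hI ↦ Finset.mem_image_of_mem _ hI), ← tsum_mul_left]
  refine le_trans (Finset.sum_le_sum fun p hp ↦ ?_)
    ((hsum.mul_left _).sum_le_tsum (Q.image fun P ↦ Ideal.absNorm (Ideal.under ℤ P))
      fun n _ ↦ mul_nonneg (Nat.cast_nonneg _) (Real.rpow_nonneg (Nat.cast_nonneg n) _))
  calc _ ≤ ∑ P ∈ Q with Ideal.absNorm (Ideal.under ℤ P) = p, (p : ℝ) ^ (-(2 : ℝ)) := by
        refine Finset.sum_le_sum fun P hP ↦ ?_
        obtain ⟨hPQ, rfl⟩ := Finset.mem_filter.mp hP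
        obtain ⟨h1, h2, -⟩ := key P hPQ
        set p := Ideal.absNorm (Ideal.under ℤ P)
        have hp0 : (1 : ℝ) ≤ p := by exact_mod_cast h1.one_le
        have h2' : (p : ℝ) ^ 2 ≤ Ideal.absNorm P := by exact_mod_cast h2
        have hN : (1 : ℝ) ≤ Ideal.absNorm P := by nlinarith
        calc idealWeight K s P ≤ (Ideal.absNorm P : ℝ) ^ (-1 : ℝ) :=
              Real.rpow_le_rpow_of_exponent_le hN (by linarith)
          _ = (Ideal.absNorm P : ℝ)⁻¹ := Real.rpow_neg_one _
          _ ≤ ((p : ℝ) ^ 2)⁻¹ := inv_anti₀ (by positivity) h2'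
          _ = _ := by rw [Real.rpow_neg (by linarith)]; norm_num
    _ ≤ _ := by
        rw [Finset.sum_const, nsmul_eq_mul]
        refine mul_le_mul_of_nonneg_right ?_ (Real.rpow_nonneg (Nat.cast_nonneg p) _)
        obtain ⟨P, hP, rfl⟩ := Finset.mem_image.mp hp
        set p := Ideal.absNorm (Ideal.under ℤ P) with hpdef
        have hpp := (key P hP).1
        have : (Ideal.span {(p : ℤ)}).IsMaximal :=
          have := Fact.mk hpp
          Int.ideal_span_isMaximal_of_prime p
        have h0 : Ideal.span {(p : ℤ)} ≠ ⊥ := by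
          simpa using hpp.ne_zero
        have := Ideal.card_primesOverFinset_le_finrank (R := ℤ) (𝓞 K) ℚ K h0
        refine Nat.cast_le.mpr (le_trans (Finset.card_le_card fun P' hP' ↦ ?_) this)
        obtain ⟨hP', h⟩ := Finset.mem_filter.mp hP'
        have := (key P' hP').2.2
        rwa [h] at this

variable (K) in
theorem le_exp_sum_primes :
    ∃ c > 0, ∀ᶠ s : ℝ in 𝓝[>] 1, ∃ T : Finset (Ideal (𝓞 K)),
      (∀ P ∈ T, (Ideal.absNorm P).Prime) ∧
      c / (s - 1) ≤ Real.exp (∑ P ∈ T, idealWeight K s P) := by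
  classical
  obtain ⟨c, hc, C, hC, h⟩ := zeta_bounds K
  obtain ⟨D, hD⟩ := exists_sum_sq_le K
  obtain ⟨D', hD'⟩ := exists_sum_not_prime_le K
  refine ⟨c * Real.exp (-(D' + 2 * D)), by positivity, ?_⟩
  filter_upwards [h, self_mem_nhdsWithin] with s ⟨_, T, hT, h⟩ hs
  have hs : 1 < s := hs
  obtain ⟨Q, hQ, hle⟩ := sum_idealWeight_le_prod hs hT
  refine ⟨Q.filter fun P ↦ (Ideal.absNorm P).Prime, fun P hP ↦ (Finset.mem_filter.mp hP).2, ?_⟩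
  have h1 : c / (s - 1) ≤ Real.exp (∑ P ∈ Q, (idealWeight K s P + 2 * idealWeight K s P ^ 2)) := by
    rw [Real.exp_sum]
    refine h.trans (hle.trans (Finset.prod_le_prod (fun P hP ↦ ?_) fun P hP ↦ ?_))
    · have := idealWeight_le_half hs (hQ P hP)
      exact inv_nonneg.mpr (by linarith)
    · exact inv_one_sub_le_exp (idealWeight_le_half hs (hQ P hP))
  have h2 : ∑ P ∈ Q, (idealWeight K s P + 2 * idealWeight K s P ^ 2) ≤
      ∑ P ∈ Q with (Ideal.absNorm P).Prime, idealWeight K s P + (D' + 2 * D) := by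
    rw [Finset.sum_add_distrib, ← Finset.sum_filter_add_sum_filter_not Q
      (fun P ↦ (Ideal.absNorm P).Prime) (fun P ↦ idealWeight K s P), ← Finset.mul_sum]
    have h3 := hD' s hs (Q.filter fun P ↦ ¬ (Ideal.absNorm P).Prime) fun P hP ↦
      ⟨hQ P (Finset.mem_filter.mp hP).1, (Finset.mem_filter.mp hP).2⟩
    have h4 := (Finset.sum_le_sum fun P hP ↦ idealWeight_sq_le hs (hQ P hP)).trans (hD Q hQ)
    linarith
  have h5 := h1.trans (Real.exp_le_exp.mpr h2)
  rw [Real.exp_add] at h5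
  rw [Real.exp_neg, mul_div_right_comm, ← div_eq_mul_inv, div_le_iff₀ (Real.exp_pos _)]
  exact h5

end Zeta
section Zeta

open Filter Topology
variable {K N : Type*} [Field K] [NumberField K] [Field N] [NumberField N]

/-- If almost all primes of degree one of `K` lie below at least `n` primes of degree one of `N`,
then `n ≤ 1`. -/
theorem le_one_of_forall_card_eq (n : ℕ) (B : Finset (Ideal (𝓞 K)))
    (φ : Ideal (𝓞 N) → Ideal (𝓞 K))
    (h : ∀ P ∉ B, (Ideal.absNorm P).Prime → ∃ A : Finset (Ideal (𝓞 N)), A.card = n ∧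
      ∀ Q ∈ A, φ Q = P ∧ Ideal.absNorm Q = Ideal.absNorm P) : n ≤ 1 := by
  classical
  by_contra! hn
  obtain ⟨c, hc, hK⟩ := le_exp_sum_primes K
  obtain ⟨C, hC, hN⟩ := exp_sum_primes_le N
  choose! A hA using h
  set c' := c * Real.exp (-(B.card : ℝ)) with hc'
  have hc'0 : 0 < c' := by positivity
  have hlim : Tendsto (fun s : ℝ ↦ (s - 1)⁻¹) (𝓝[>] 1) atTop := by
    refine tendsto_inv_nhdsGT_zero.comp ?_
    refine tendsto_nhdsWithin_iff.mpr ⟨?_, ?_⟩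
    · have : Tendsto (fun s : ℝ ↦ s - 1) (𝓝 1) (𝓝 (1 - 1)) := tendsto_id.sub_const 1
      rw [sub_self] at this
      exact this.mono_left nhdsWithin_le_nhds
    · filter_upwards [self_mem_nhdsWithin] with s hs
      exact sub_pos.mpr (Set.mem_Ioi.mp hs)
  obtain ⟨s, ⟨⟨⟨hK, hN⟩, h1⟩, h2⟩, hs⟩ := ((((hK.and hN).and
    (hlim.eventually (eventually_ge_atTop (c'⁻¹)))).and
    (hlim.eventually (eventually_gt_atTop (C / c' ^ 2)))).and
    (self_mem_nhdsWithin (a := (1 : ℝ)) (s := Set.Ioi 1))).exists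
  have hs : 1 < s := hs
  obtain ⟨T, hT, hT'⟩ := hK
  set X := (s - 1)⁻¹ with hX
  have hA' : ∀ P ∈ T \ B, (A P).card = n ∧ ∀ Q ∈ A P, φ Q = P ∧ Ideal.absNorm Q = Ideal.absNorm P :=
    fun P hP ↦ hA P (Finset.mem_sdiff.mp hP).2 (hT P (Finset.mem_sdiff.mp hP).1)
  have hdisj : ((T \ B : Finset _) : Set (Ideal (𝓞 K))).PairwiseDisjoint A := by
    intro P hP P' hP' hne
    refine Finset.disjoint_left.mpr fun Q hQ hQ' ↦ hne ?_
    rw [← ((hA' P hP).2 Q hQ).1, ← ((hA' P' hP').2 Q hQ').1]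
  have hsum : ∑ Q ∈ (T \ B).biUnion A, idealWeight N s Q = n * ∑ P ∈ T \ B, idealWeight K s P := by
    rw [Finset.sum_biUnion hdisj, Finset.mul_sum]
    refine Finset.sum_congr rfl fun P hP ↦ ?_
    rw [← (hA' P hP).1, ← nsmul_eq_mul, ← Finset.sum_const]
    refine Finset.sum_congr rfl fun Q hQ ↦ ?_
    rw [idealWeight_apply, idealWeight_apply, ((hA' P hP).2 Q hQ).2]
  have hN := hN ((T \ B).biUnion A) fun Q hQ ↦ by
    obtain ⟨P, hP, hQ⟩ := Finset.mem_biUnion.mp hQ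
    have hp : (Ideal.absNorm Q).Prime := by
      rw [((hA' P hP).2 Q hQ).2]; exact hT P (Finset.mem_sdiff.mp hP).1
    have h0 : Q ≠ ⊥ := by
      rintro rfl
      rw [Ideal.absNorm_bot] at hp
      exact Nat.not_prime_zero hp
    exact Ideal.prime_of_isPrime h0 (Ideal.isPrime_of_irreducible_absNorm hp)
  rw [hsum, Real.exp_nat_mul] at hN
  have hle : ∑ P ∈ T, idealWeight K s P ≤ ∑ P ∈ T \ B, idealWeight K s P + B.card := by
    rw [← Finset.sum_inter_add_sum_sdiff T B, add_comm]
    refine add_le_add le_rfl ?_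
    calc ∑ P ∈ T ∩ B, idealWeight K s P ≤ ∑ P ∈ T ∩ B, (1 : ℝ) := by
          refine Finset.sum_le_sum fun P hP ↦ ?_
          have hp := hT P (Finset.mem_inter.mp hP).1
          exact Real.rpow_le_one_of_one_le_of_nonpos (by exact_mod_cast hp.one_le) (by linarith)
      _ = (T ∩ B).card := by simp
      _ ≤ B.card := by exact_mod_cast Finset.card_le_card Finset.inter_subset_right
  have hlow : c' * X ≤ Real.exp (∑ P ∈ T \ B, idealWeight K s P) := by
    have := hT'.trans (Real.exp_le_exp.mpr hle)
    rw [Real.exp_add] at this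
    rw [hc', Real.exp_neg, hX, mul_right_comm, ← div_eq_mul_inv, ← div_eq_mul_inv,
      div_le_iff₀ (Real.exp_pos _)]
    exact this
  have hXpos : 0 < X := inv_pos.mpr (by linarith)
  have h1' : 1 ≤ c' * X := by
    rwa [inv_le_iff_one_le_mul₀' hc'0] at h1
  have h3 : (c' * X) ^ 2 ≤ C * X :=
    calc (c' * X) ^ 2 ≤ (c' * X) ^ n := pow_le_pow_right₀ h1' hn
      _ ≤ _ := pow_le_pow_left₀ (by positivity) hlow n
      _ ≤ C * X := by rw [hX, ← div_eq_mul_inv]; exact hN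
  rw [div_lt_iff₀ (by positivity)] at h2
  nlinarith [mul_lt_mul_of_pos_right h2 hXpos]

end Zeta
section DegreeOne

variable {K : Type*} [Field K] [NumberField K]

theorem exists_int_sub_mem {P : Ideal (𝓞 K)} (hP : (Ideal.absNorm P).Prime) (x : 𝓞 K) :
    ∃ a : ℤ, x - a ∈ P := by
  have hc : Nat.card (𝓞 K ⧸ P) = Ideal.absNorm P := by
    rw [Ideal.absNorm_apply, Submodule.cardQuot_apply]
  have hf := Fact.mk hP
  have hne : (1 : 𝓞 K ⧸ P) ≠ 0 := by
    intro h
    have : P = ⊤ := by rw [Ideal.eq_top_iff_one, ← Ideal.Quotient.eq_zero_iff_mem, map_one, h]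
    rw [this, Ideal.absNorm_top] at hP
    exact Nat.not_prime_one hP
  have hmem : Ideal.Quotient.mk P x ∈ AddSubgroup.zmultiples (1 : 𝓞 K ⧸ P) :=
    mem_zmultiples_of_prime_card hc hne
  obtain ⟨a, ha⟩ := AddSubgroup.mem_zmultiples_iff.mp hmem
  refine ⟨a, ?_⟩
  rw [← Ideal.Quotient.eq_zero_iff_mem, map_sub, ← ha]
  simp

theorem absNorm_eq_of_forall_exists_int {P : Ideal (𝓞 K)} {p : ℕ} (hp : p.Prime)
    (hpP : (p : 𝓞 K) ∈ P) (hP : P ≠ ⊤) (h : ∀ x : 𝓞 K, ∃ a : ℤ, x - a ∈ P) :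
    Ideal.absNorm P = p := by
  have hz : (p : 𝓞 K ⧸ P) = 0 := by
    rw [← map_natCast (Ideal.Quotient.mk P), Ideal.Quotient.eq_zero_iff_mem]; exact hpP
  have hsurj : Function.Surjective (Int.castAddHom (𝓞 K ⧸ P)) := by
    intro y
    obtain ⟨x, rfl⟩ := Ideal.Quotient.mk_surjective y
    obtain ⟨a, ha⟩ := h x
    refine ⟨a, ?_⟩
    rw [← Ideal.Quotient.eq_zero_iff_mem, map_sub, sub_eq_zero, map_intCast] at ha
    exact ha.symm
  let f : ZMod p →+ 𝓞 K ⧸ P := ZMod.lift p ⟨Int.castAddHom _, by simpa using hz⟩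
  have hf : Function.Surjective f := fun y ↦ by
    obtain ⟨a, ha⟩ := hsurj y
    exact ⟨(a : ZMod p), by rw [← ha]; exact ZMod.lift_coe p _ a⟩
  have hd := AddSubgroup.card_dvd_of_surjective f hf
  rw [Nat.card_zmod] at hd
  have hc : Nat.card (𝓞 K ⧸ P) = Ideal.absNorm P := by
    rw [Ideal.absNorm_apply, Submodule.cardQuot_apply]
  rw [hc] at hd
  exact ((Nat.dvd_prime hp).mp hd).resolve_left fun h1 ↦ hP (Ideal.absNorm_eq_one_iff.mp h1)

end DegreeOne

section Density

variable {Ω : Type*} [Field Ω] [CharZero Ω] [Algebra.IsAlgebraic ℚ Ω] [IsAlgClosed Ω]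

attribute [local instance] isGalois_rat numberField_of_finiteDimensional

theorem valuation_mul_lt_one {O : ValuationSubring Ω} {x y : Ω} (hx : O.valuation x ≤ 1)
    (hy : O.valuation y < 1) : O.valuation (x * y) < 1 := by
  rw [mul_comm, map_mul]
  exact mul_lt_one_of_lt_of_le hy hx

theorem valuation_intCast_le (O : ValuationSubring Ω) (a : ℤ) : O.valuation (a : Ω) ≤ 1 :=
  (O.valuation_le_one_iff _).mpr (intCast_mem O a)

theorem exists_multiple_isIntegral (x : Ω) : ∃ m : ℕ, m ≠ 0 ∧ IsIntegral ℤ ((m : Ω) * x) := by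
  obtain ⟨⟨m, hm⟩, h⟩ := IsIntegral.exists_multiple_integral_of_isLocalization
    (nonZeroDivisors ℤ) (Rₘ := ℚ) x (Algebra.IsAlgebraic.isAlgebraic x).isIntegral
  have hm0 : m ≠ 0 := nonZeroDivisors.ne_zero hm
  have h : IsIntegral ℤ ((m : Ω) * x) := by
    have e : ((⟨m, hm⟩ : nonZeroDivisors ℤ) • x) = (m : Ω) * x := by
      rw [Submonoid.smul_def, zsmul_eq_mul]
    rwa [e] at h
  refine ⟨m.natAbs, by simpa using hm0, ?_⟩
  rcases Int.natAbs_eq m with e | e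
  · rw [e] at h
    simpa using h
  · rw [e] at h
    simpa using h.neg

theorem exists_valuation_natCast_lt {x : Ω} (hx : x ≠ 0) :
    ∃ m : ℕ, m ≠ 0 ∧ ∀ O : ValuationSubring Ω, O.valuation x < 1 → O.valuation (m : Ω) < 1 := by
  obtain ⟨m, hm, h⟩ := exists_multiple_isIntegral x⁻¹
  refine ⟨m, hm, fun O hO ↦ ?_⟩
  have h1 := (O.valuation_le_one_iff _).mpr (mem_of_isIntegral O h)
  have e : (m : Ω) = (m * x⁻¹) * x := by field_simp
  rw [e]
  exact valuation_mul_lt_one h1 hO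

theorem le_of_valuation_natCast_lt {O : ValuationSubring Ω} {p m : ℕ} (hp : p.Prime)
    (hO : O.valuation (p : Ω) < 1) (hm : m ≠ 0) (h : O.valuation (m : Ω) < 1) : p ≤ m := by
  refine Nat.le_of_dvd (Nat.pos_of_ne_zero hm) ?_
  by_contra hd
  obtain ⟨a, b, e⟩ := Nat.isCoprime_iff_coprime.mpr ((Nat.Prime.coprime_iff_not_dvd hp).mpr hd)
  have e' : (a : Ω) * p + b * m = 1 := by exact_mod_cast congrArg (Int.cast (R := Ω)) e
  have h2 := O.valuation.map_add_lt (valuation_mul_lt_one (valuation_intCast_le O a) hO)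
    (valuation_mul_lt_one (valuation_intCast_le O b) h)
  rw [e', map_one] at h2
  exact lt_irrefl _ h2

/-- Only finitely many residue characteristics are bad for a finite set of nonzero elements. -/
theorem exists_bound (S : Finset Ω) (hS : ∀ x ∈ S, x ≠ 0) :
    ∃ X : ℕ, ∀ (O : ValuationSubring Ω) (p : ℕ), p.Prime → O.valuation (p : Ω) < 1 → X < p →
      ∀ x ∈ S, ¬ O.valuation x < 1 := by
  classical
  choose! m hm0 hm using fun (x : Ω) (hx : x ≠ 0) ↦ exists_valuation_natCast_lt hx
  refine ⟨S.sup m, fun O p hp hO hX x hx h ↦ ?_⟩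
  have h1 := le_of_valuation_natCast_lt hp hO (hm0 x (hS x hx)) (hm x (hS x hx) O h)
  have h2 : m x ≤ S.sup m := Finset.le_sup hx
  omega

theorem exists_int_near {O : ValuationSubring Ω} {p : ℕ} (hp : p.Prime)
    (hO : O.valuation (p : Ω) < 1) {q : ℚ} (hq : O.valuation (q : Ω) ≤ 1) :
    ∃ a : ℤ, O.valuation ((q : Ω) - a) < 1 := by
  have hqd : (q : Ω) * (q.den : Ω) = (q.num : Ω) := by
    exact_mod_cast congrArg (Rat.cast (K := Ω)) (Rat.mul_den_eq_num q)
  have hpd : ¬ p ∣ q.den := by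
    intro hd
    have h1 : O.valuation (q.den : Ω) < 1 := by
      obtain ⟨k, hk⟩ := hd
      rw [hk, Nat.cast_mul, map_mul]
      exact mul_lt_one_of_lt_of_le hO ((O.valuation_le_one_iff _).mpr (natCast_mem O k))
    have h2 : O.valuation (q.num : Ω) < 1 := by
      rw [← hqd]; exact valuation_mul_lt_one hq h1
    obtain ⟨a, b, e⟩ := Int.isCoprime_iff_gcd_eq_one.mpr
      (show Int.gcd q.num q.den = 1 by simpa [Int.gcd] using q.reduced)
    have e' : (a : Ω) * q.num + b * q.den = 1 := by
      exact_mod_cast congrArg (Int.cast (R := Ω)) e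
    have h4 := O.valuation.map_add_lt (valuation_mul_lt_one (valuation_intCast_le O a) h2)
      (valuation_mul_lt_one (valuation_intCast_le O b) h1)
    rw [e', map_one] at h4
    exact lt_irrefl _ h4
  obtain ⟨a, b, e⟩ := Nat.isCoprime_iff_coprime.mpr ((Nat.Prime.coprime_iff_not_dvd hp).mpr hpd)
  have e' : (a : Ω) * p + b * q.den = 1 := by exact_mod_cast congrArg (Int.cast (R := Ω)) e
  refine ⟨b * q.num, ?_⟩
  have : (q : Ω) - ((b * q.num : ℤ) : Ω) = q * a * p := by
    push_cast
    rw [← hqd]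
    linear_combination (-(q : Ω)) * e'
  rw [this]
  refine valuation_mul_lt_one ?_ hO
  rw [map_mul]
  exact mul_le_one' hq (valuation_intCast_le O a)

end Density
section Density

variable {Ω : Type*} [Field Ω] [CharZero Ω] [Algebra.IsAlgebraic ℚ Ω] [IsAlgClosed Ω]

attribute [local instance] isGalois_rat numberField_of_finiteDimensional

theorem exists_primeUnder_eq (E : IntermediateField ℚ Ω) [FiniteDimensional ℚ E]
    (P : HeightOneSpectrum (𝓞 E)) :
    ∃ O : ValuationSubring Ω, O ≠ ⊤ ∧ primeUnder (restrictPlace O E) = P.asIdeal := by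
  obtain ⟨O, hO⟩ := exists_extension E (P.valuation E).valuationSubring
  have hlt : ∀ x : E, O.valuation (x : Ω) < 1 ↔ P.valuation E x < 1 := by
    intro x
    by_cases hx : x = 0
    · simp [hx]
    · have hx' : (x : Ω) ≠ 0 := by simpa using hx
      have h0 : 0 < P.valuation E x := zero_lt_iff.mpr ((Valuation.ne_zero_iff _).mpr hx)
      have h1 := hO x⁻¹
      rw [valuation_lt_iff_inv O hx', O.valuation_le_one_iff]
      rw [show ((x⁻¹ : E) : Ω) = (x : Ω)⁻¹ from rfl, Valuation.mem_valuationSubring_iff, map_inv₀] at h1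
      rw [h1, inv_le_one₀ h0, not_le]
  have hmem : ∀ x : 𝓞 E, x ∈ primeUnder (restrictPlace O E) ↔ x ∈ P.asIdeal := by
    intro x
    rw [mem_primeUnder, restrictPlace_lt, hlt]
    exact P.valuation_lt_one_iff_mem x
  refine ⟨O, ?_, Ideal.ext hmem⟩
  rintro rfl
  apply P.ne_bot
  rw [eq_bot_iff]
  intro x hx
  rw [← hmem, mem_primeUnder, restrictPlace_lt] at hx
  by_contra hx0
  have hx0' : (((x : 𝓞 E) : E) : Ω) ≠ 0 := by
    intro h
    exact hx0 (by simpa using h)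
  rw [valuation_lt_iff_inv _ hx0', ValuationSubring.valuation_le_one_iff] at hx
  exact hx (ValuationSubring.mem_top _)

theorem exists_isIntegral_stabilizer_eq {U : Subgroup (Ω ≃ₐ[ℚ] Ω)}
    (hU : IsOpen (U : Set (Ω ≃ₐ[ℚ] Ω))) :
    ∃ θ : Ω, IsIntegral ℤ θ ∧ θ ∈ IntermediateField.fixedField U ∧ ∀ g, g θ = θ → g ∈ U := by
  have := finiteDimensional_fixedField hU
  obtain ⟨θ, hθ⟩ := Field.exists_primitive_element ℚ (IntermediateField.fixedField U)
  obtain ⟨m, hm, h⟩ := exists_multiple_isIntegral (θ : Ω)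
  have hm' : (m : Ω) ≠ 0 := Nat.cast_ne_zero.mpr hm
  refine ⟨m * θ, h, mul_mem (natCast_mem _ m) θ.2, fun g hg ↦ ?_⟩
  have hg' : g (θ : Ω) = θ := by
    rw [map_mul, map_natCast] at hg
    exact mul_left_cancel₀ hm' hg
  rw [← fixingSubgroup_fixedField_of_isClosed (U.isClosed_of_isOpen hU)]
  rw [IntermediateField.mem_fixingSubgroup_iff]
  intro x hx
  have h1 : (⟨x, hx⟩ : IntermediateField.fixedField U) ∈ (IntermediateField.adjoin ℚ {θ}) := by
    rw [hθ]; exact IntermediateField.mem_top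
  have h2 : ∀ y ∈ IntermediateField.adjoin ℚ {θ}, g (y : Ω) = y := by
    intro y hy
    induction hy using IntermediateField.adjoin_induction with
    | mem y hy => rw [Set.mem_singleton_iff.mp hy, hg']
    | algebraMap q => rw [eq_ratCast]; simp
    | add y z _ _ h h' => simp [h, h']
    | inv y _ h => simp [h]
    | mul y z _ _ h h' => simp [h, h']
  exact h2 _ h1

/-- Integers of `fixedField W` are congruent to rational integers at places whose decomposition
group is contained in `W`. -/
theorem absNorm_primeUnder_eq {W : Subgroup (Ω ≃ₐ[ℚ] Ω)}
    [FiniteDimensional ℚ (IntermediateField.fixedField W)]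
    {O : ValuationSubring Ω} (hO : O ≠ ⊤) (hOW : MulAction.stabilizer (Ω ≃ₐ[ℚ] Ω) O ≤ W) {p : ℕ} (hp : p.Prime)
    (hpO : O.valuation (p : Ω) < 1) :
    Ideal.absNorm (primeUnder (restrictPlace O (IntermediateField.fixedField W))) = p := by
  refine absNorm_eq_of_forall_exists_int hp ?_ (Ideal.IsPrime.ne_top inferInstance) fun x ↦ ?_
  · rw [mem_primeUnder, restrictPlace_lt]
    simpa using hpO
  · have hb : FiniteDimensional ℚ (⊥ : IntermediateField ℚ Ω) := inferInstance
    have hfix : ∀ g ∈ (⊥ : IntermediateField ℚ Ω).fixingSubgroup, g • O = O →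
        g (((x : 𝓞 _) : IntermediateField.fixedField W) : Ω) = (x : IntermediateField.fixedField W) :=
      fun g _ hg ↦ (x : IntermediateField.fixedField W).2 ⟨g, hOW hg⟩
    obtain ⟨f, hf, h⟩ := exists_near (⊥ : IntermediateField ℚ Ω) hO (one_mem _) hfix
    rw [mul_one] at h
    obtain ⟨q, rfl⟩ := IntermediateField.mem_bot.mp hf
    have hx1 : O.valuation (((x : 𝓞 _) : IntermediateField.fixedField W) : Ω) ≤ 1 := by
      rw [← restrictPlace_le]; exact valuation_int_le _ x
    have hq : O.valuation (q : Ω) ≤ 1 := by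
      have e : (q : Ω) = (((x : 𝓞 _) : IntermediateField.fixedField W) : Ω) -
        ((((x : 𝓞 _) : IntermediateField.fixedField W) : Ω) - algebraMap ℚ Ω q) := by simp
      rw [e]
      exact (O.valuation.map_sub _ _).trans (max_le hx1 h.le)
    obtain ⟨a, ha⟩ := exists_int_near hp hpO hq
    refine ⟨a, ?_⟩
    rw [mem_primeUnder, restrictPlace_lt]
    have h2 := O.valuation.map_add_lt h ha
    have e : ((((x - (a : 𝓞 (IntermediateField.fixedField W)) : 𝓞 (IntermediateField.fixedField W)) : IntermediateField.fixedField W)) : Ω) =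
      ((((x : 𝓞 _) : IntermediateField.fixedField W) : Ω) - algebraMap ℚ Ω q) + ((q : Ω) - a) := by
      simp
    rw [e]
    exact h2

end Density
section Density

variable {Ω : Type*} [Field Ω] [CharZero Ω] [Algebra.IsAlgebraic ℚ Ω] [IsAlgClosed Ω]

attribute [local instance] isGalois_rat numberField_of_finiteDimensional

theorem mem_iff_of_primeUnder_eq {O O' : ValuationSubring Ω} (E : IntermediateField ℚ Ω)
    [FiniteDimensional ℚ E] (hO : O ≠ ⊤) (hO' : O' ≠ ⊤)
    (h : primeUnder (restrictPlace O E) = primeUnder (restrictPlace O' E)) :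
    ∀ x ∈ E, x ∈ O ↔ x ∈ O' := by
  intro x hx
  obtain ⟨P, h1, h2, -⟩ := exists_prime_place E hO
  obtain ⟨P', h1', h2', -⟩ := exists_prime_place E hO'
  have : P = P' := HeightOneSpectrum.ext (by rw [h1, h1', h])
  subst this
  have := (h2 ⟨x, hx⟩).trans (h2' ⟨x, hx⟩).symm
  rwa [O.valuation_le_one_iff, O'.valuation_le_one_iff] at this

theorem mem_stabilizer_smul {O : ValuationSubring Ω} {g h : Ω ≃ₐ[ℚ] Ω} :
    h ∈ MulAction.stabilizer (Ω ≃ₐ[ℚ] Ω) (g • O) ↔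
      g⁻¹ * h * g ∈ MulAction.stabilizer (Ω ≃ₐ[ℚ] Ω) O := by
  rw [MulAction.mem_stabilizer_iff, MulAction.mem_stabilizer_iff, mul_smul, mul_smul,
    inv_smul_eq_iff]

theorem stabilizer_smul_le {U : Subgroup (Ω ≃ₐ[ℚ] Ω)} {O : ValuationSubring Ω} {g : Ω ≃ₐ[ℚ] Ω}
    (h : MulAction.stabilizer (Ω ≃ₐ[ℚ] Ω) O ≤ U) (hg : g ∈ U) :
    MulAction.stabilizer (Ω ≃ₐ[ℚ] Ω) (g • O) ≤ U := by
  intro x hx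
  have := U.mul_mem (U.mul_mem hg (h (mem_stabilizer_smul.mp hx))) (U.inv_mem hg)
  rwa [show g * (g⁻¹ * x * g) * g⁻¹ = x by group] at this

/-- At almost every prime of degree one of `fixedField U`, the decomposition group of any place
above it is contained in `U`. -/
theorem exists_stabilizer_le_of_prime {U : Subgroup (Ω ≃ₐ[ℚ] Ω)}
    (hU : IsOpen (U : Set (Ω ≃ₐ[ℚ] Ω))) [FiniteDimensional ℚ (IntermediateField.fixedField U)] :
    ∃ X : ℕ, 2 ≤ X ∧ ∀ (O : ValuationSubring Ω),
      (Ideal.absNorm (primeUnder (restrictPlace O (IntermediateField.fixedField U)))).Prime →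
      X < Ideal.absNorm (primeUnder (restrictPlace O (IntermediateField.fixedField U))) →
      MulAction.stabilizer (Ω ≃ₐ[ℚ] Ω) O ≤ U := by
  classical
  obtain ⟨θ, hθ, hθU, hθs⟩ := exists_isIntegral_stabilizer_eq hU
  have hθ' : IsIntegral ℚ θ := hθ.tower_top
  let S : Finset Ω := (((minpoly ℚ θ).aroots Ω).toFinset.erase θ).image fun a ↦ a - θ
  obtain ⟨X, hX⟩ := exists_bound S (by
    intro x hx
    obtain ⟨a, ha, rfl⟩ := Finset.mem_image.mp hx
    exact sub_ne_zero.mpr (Finset.ne_of_mem_erase ha))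
  refine ⟨max 2 X, le_max_left _ _, fun O hp hlt g hg ↦ ?_⟩
  have hpO : O.valuation ((Ideal.absNorm (primeUnder
      (restrictPlace O (IntermediateField.fixedField U))) : ℕ) : Ω) < 1 := by
    have := Ideal.absNorm_mem (primeUnder (restrictPlace O (IntermediateField.fixedField U)))
    rw [mem_primeUnder, restrictPlace_lt] at this
    simpa using this
  apply hθs
  by_contra hne
  have hroot : g θ ∈ (minpoly ℚ θ).aroots Ω := by
    rw [Polynomial.mem_aroots]
    refine ⟨minpoly.ne_zero hθ', ?_⟩
    have h : Polynomial.aeval (g.toAlgHom θ) (minpoly ℚ θ) = 0 := by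
      rw [Polynomial.aeval_algHom_apply, minpoly.aeval, map_zero]
    exact h
  refine hX O _ hp hpO (lt_of_le_of_lt (le_max_right _ _) hlt) (g θ - θ)
    (Finset.mem_image_of_mem _ (Finset.mem_erase.mpr ⟨hne, Multiset.mem_toFinset.mpr hroot⟩)) ?_
  have hInt : IsIntegral ℤ (⟨θ, hθU⟩ : IntermediateField.fixedField U) :=
    (isIntegral_algebraMap_iff (B := Ω) (IntermediateField.fixedField U).val.injective).mp hθ
  obtain ⟨t, ht⟩ : ∃ t : 𝓞 (IntermediateField.fixedField U),
      ((t : IntermediateField.fixedField U) : Ω) = θ := ⟨⟨⟨θ, hθU⟩, hInt⟩, rfl⟩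
  obtain ⟨a, ha⟩ := exists_int_sub_mem hp t
  rw [mem_primeUnder, restrictPlace_lt] at ha
  have ha' : O.valuation (θ - a) < 1 := by
    have e : ((((t - (a : 𝓞 (IntermediateField.fixedField U)) : 𝓞 (IntermediateField.fixedField U)) :
        IntermediateField.fixedField U)) : Ω) = θ - a := by
      simp [← ht]
    rwa [e] at ha
  have hga : O.valuation (g (θ - a)) < 1 := (valuation_smul_lt_iff hg _).mpr ha'
  have e : g θ - θ = g (θ - a) - (θ - a) := by
    rw [map_sub, map_intCast]; ring
  rw [e]
  exact O.valuation.map_sub_lt hga ha'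

theorem eq_of_forall_stabilizer_le {U W : Subgroup (Ω ≃ₐ[ℚ] Ω)}
    (hU : IsOpen (U : Set (Ω ≃ₐ[ℚ] Ω))) (hW : IsOpen (W : Set (Ω ≃ₐ[ℚ] Ω))) (hWU : W ≤ U)
    (h : ∀ O : ValuationSubring Ω, IsOdd O → MulAction.stabilizer (Ω ≃ₐ[ℚ] Ω) O ≤ U →
      MulAction.stabilizer (Ω ≃ₐ[ℚ] Ω) O ≤ W) : W = U := by
  classical
  have := finiteDimensional_fixedField hU
  have := finiteDimensional_fixedField hW
  obtain ⟨X, hX2, hX⟩ := exists_stabilizer_le_of_prime hU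
  have hKN : IntermediateField.fixedField U ≤ IntermediateField.fixedField W := by
    rintro x hx ⟨g, hg⟩
    exact hx ⟨g, hWU hg⟩
  let f := RingOfIntegers.mapRingHom (IntermediateField.inclusion hKN).toRingHom
  have hri : W.relIndex U ≠ 0 := by
    have := relIndex_ne_zero_of_isOpen hW U
    rwa [inf_of_le_right hWU] at this
  have hfi : (W.subgroupOf U).FiniteIndex := ⟨hri⟩
  have : Fintype (U ⧸ W.subgroupOf U) := Fintype.ofFinite _
  have hn := le_one_of_forall_card_eq (W.relIndex U)
    (Ideal.finite_setOfPred_absNorm_le (S := 𝓞 (IntermediateField.fixedField U)) X).toFinset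
    (fun Q : Ideal (𝓞 (IntermediateField.fixedField W)) ↦ Ideal.comap f Q) (by
      intro P hPB hP
      rw [Set.Finite.mem_toFinset, Set.mem_ofPred_eq, not_le] at hPB
      have hPne : P ≠ ⊥ := by
        rintro rfl
        rw [Ideal.absNorm_bot] at hP
        exact Nat.not_prime_zero hP
      have hPp : P.IsPrime := Ideal.isPrime_of_irreducible_absNorm hP
      obtain ⟨O, hO, hOP⟩ := exists_primeUnder_eq _ (⟨P, hPp, hPne⟩ : HeightOneSpectrum _)
      replace hOP : primeUnder (restrictPlace O (IntermediateField.fixedField U)) = P := hOP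
      have hOU : MulAction.stabilizer (Ω ≃ₐ[ℚ] Ω) O ≤ U := hX O (by rwa [hOP]) (by rwa [hOP])
      have hpO : O.valuation ((Ideal.absNorm P : ℕ) : Ω) < 1 := by
        have := Ideal.absNorm_mem P
        rw [← hOP, mem_primeUnder, restrictPlace_lt, hOP] at this
        simpa using this
      have hodd : IsOdd O := by
        refine ⟨hO, ?_⟩
        exact_mod_cast valuation_prime_eq_one hP Nat.prime_two hpO (by omega)
      have hle : ∀ u ∈ U, MulAction.stabilizer (Ω ≃ₐ[ℚ] Ω) (u • O) ≤ W := fun u hu ↦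
        h _ (hodd.smul u) (stabilizer_smul_le hOU hu)
      let F : U ⧸ W.subgroupOf U → Ideal (𝓞 (IntermediateField.fixedField W)) := fun q ↦
        primeUnder (restrictPlace (((q.out : U) : Ω ≃ₐ[ℚ] Ω)⁻¹ • O) (IntermediateField.fixedField W))
      have hF : Function.Injective F := by
        intro q q' hqq
        obtain ⟨w, hw, hwe⟩ := exists_smul_eq _ (smul_ne_top hO _) (smul_ne_top hO _)
          (mem_iff_of_primeUnder_eq _ (smul_ne_top hO _) (smul_ne_top hO _) hqq)
        rw [fixingSubgroup_fixedField_of_isClosed (W.isClosed_of_isOpen hW)] at hw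
        rw [← q.out_eq', ← q'.out_eq']
        refine QuotientGroup.eq.mpr (Subgroup.mem_subgroupOf.mpr ?_)
        have h1 := hle _ (U.inv_mem q.out.2) (x := ((q.out : U) : Ω ≃ₐ[ℚ] Ω)⁻¹ * (q'.out : U) * w) (by
          rw [MulAction.mem_stabilizer_iff, mul_smul, hwe, mul_smul, smul_inv_smul])
        have h2 := W.mul_mem h1 (W.inv_mem hw)
        rw [mul_inv_cancel_right] at h2
        exact h2
      refine ⟨Finset.univ.image F, ?_, ?_⟩
      · rw [Finset.card_image_of_injective _ hF, Finset.card_univ, ← Nat.card_eq_fintype_card]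
        rfl
      · intro Q hQ
        obtain ⟨q, -, rfl⟩ := Finset.mem_image.mp hQ
        obtain ⟨u, hu⟩ : ∃ u, u = ((q.out : U) : Ω ≃ₐ[ℚ] Ω)⁻¹ := ⟨_, rfl⟩
        have huU : u ∈ U := hu ▸ U.inv_mem q.out.2
        simp only [F, ← hu]
        constructor
        · rw [← hOP]
          ext x
          rw [Ideal.mem_comap, mem_primeUnder, mem_primeUnder, restrictPlace_lt, restrictPlace_lt]
          have e : u (((x : 𝓞 _) : IntermediateField.fixedField U) : Ω) =
            (x : IntermediateField.fixedField U) := (x : IntermediateField.fixedField U).2 ⟨u, huU⟩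
          rw [← valuation_smul_lt (g := u) (O := O), e]
          rfl
        · refine absNorm_primeUnder_eq (smul_ne_top hO u) (hle u huU) hP ?_
          rw [← map_natCast u, valuation_smul_lt]
          exact hpO)
  have h1 : W.relIndex U = 1 := by omega
  exact le_antisymm hWU (Subgroup.relIndex_eq_one.mp h1)

theorem exists_place (Ω : Type*) [Field Ω] [CharZero Ω] [Algebra.IsAlgebraic ℚ Ω]
    [IsAlgClosed Ω] : ∃ O : ValuationSubring Ω, O ≠ ⊤ := by
  obtain ⟨M, hM⟩ := Ideal.exists_maximal (𝓞 (⊥ : IntermediateField ℚ Ω))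
  have hne : M ≠ ⊥ := Ring.ne_bot_of_isMaximal_of_not_isField hM (RingOfIntegers.not_isField _)
  obtain ⟨O, hO, -⟩ := exists_primeUnder_eq _ (⟨M, hM.isPrime, hne⟩ : HeightOneSpectrum _)
  exact ⟨O, hO⟩

theorem not_finiteDimensional_top : ¬ FiniteDimensional ℚ (⊤ : IntermediateField ℚ Ω) := by
  intro _
  obtain ⟨O, hO⟩ := exists_place Ω
  obtain ⟨π, -, hπ0, hπ, h⟩ := exists_uniformizer (⊤ : IntermediateField ℚ Ω) hO
  obtain ⟨x, hx⟩ := IsAlgClosed.exists_pow_nat_eq π (n := 2) (by norm_num)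
  have hx0 : x ≠ 0 := by
    rintro rfl
    simp at hx
    exact hπ0 hx.symm
  obtain ⟨n, hn⟩ := h x IntermediateField.mem_top hx0
  have h1 : O.valuation (π ^ (2 * n + 1)) = 1 := by
    have e : π ^ (2 * n + 1) = (x * π ^ n) ^ 2 := by
      rw [mul_pow, hx, zpow_add₀ hπ0, mul_comm 2 n, zpow_mul]
      norm_cast
      ring
    rw [e, map_pow, hn, one_pow]
  rw [map_zpow₀] at h1
  have h0 : O.valuation π ≠ 0 := (Valuation.ne_zero_iff _).mpr hπ0
  have := (zpow_eq_one_iff_right₀ zero_le hπ.ne).mp h1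
  omega

theorem exists_isOdd_stabilizer_le {U : Subgroup (Ω ≃ₐ[ℚ] Ω)}
    (hU : IsOpen (U : Set (Ω ≃ₐ[ℚ] Ω))) : ∃ O : ValuationSubring Ω, IsOdd O ∧
      MulAction.stabilizer (Ω ≃ₐ[ℚ] Ω) O ≤ U := by
  by_contra! hc
  have h : ∀ x : Ω, ∀ u ∈ U, u x = x := by
    intro x u hu
    have := eq_of_forall_stabilizer_le (W := U ⊓ MulAction.stabilizer (Ω ≃ₐ[ℚ] Ω) x) hU
      (hU.inter (isOpen_stabilizer x)) inf_le_left (fun O hO hOU ↦ absurd hOU (hc O hO))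
    rw [← this] at hu
    exact hu.2
  have hf := finiteDimensional_fixedField hU
  have htop : IntermediateField.fixedField U = ⊤ := by
    rw [eq_top_iff]
    rintro x - ⟨u, hu⟩
    exact h x u hu
  rw [htop] at hf
  exact not_finiteDimensional_top hf

end Density
section Rigidity

variable {Ω : Type*} [Field Ω] [CharZero Ω] [Algebra.IsAlgebraic ℚ Ω] [IsAlgClosed Ω]

attribute [local instance] isGalois_rat numberField_of_finiteDimensional

theorem exists_smul_eq_of_prime {O O' : ValuationSubring Ω} (hO : O ≠ ⊤) (hO' : O' ≠ ⊤) {p : ℕ}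
    (hp : p.Prime) (h : O.valuation (p : Ω) < 1) (h' : O'.valuation (p : Ω) < 1) :
    ∃ g : Ω ≃ₐ[ℚ] Ω, g • O = O' := by
  have key : ∀ {O O' : ValuationSubring Ω}, O.valuation (p : Ω) < 1 → O'.valuation (p : Ω) < 1 →
      ∀ x ∈ (⊥ : IntermediateField ℚ Ω), x ∈ O → x ∈ O' := by
    intro O O' h h' x hx hxO
    obtain ⟨q, rfl⟩ := IntermediateField.mem_bot.mp hx
    rw [← O.valuation_le_one_iff] at hxO
    rw [← O'.valuation_le_one_iff]
    by_cases hd : p ∣ q.den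
    · exfalso
      have hnum : ¬ O.valuation (q.num : Ω) < 1 := by
        intro hn
        have hcop : IsCoprime (p : ℤ) q.num := by
          rw [Int.isCoprime_iff_gcd_eq_one]
          have h1 := q.reduced
          exact Nat.Coprime.coprime_dvd_left hd h1.symm
        obtain ⟨a, b, hab⟩ := hcop
        have h2 : O.valuation ((a : Ω) * (p : Ω) + (b : Ω) * (q.num : Ω)) < 1 :=
          O.valuation.map_add_lt (valuation_mul_lt_one (valuation_intCast_le O a) h)
            (valuation_mul_lt_one (valuation_intCast_le O b) hn)
        rw [show (a : Ω) * (p : Ω) + (b : Ω) * (q.num : Ω) = 1 by exact_mod_cast congrArg (Int.cast : ℤ → Ω) hab] at h2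
        simp at h2
      apply hnum
      have hden : O.valuation (q.den : Ω) < 1 := by
        obtain ⟨m, hm⟩ := hd
        rw [hm, Nat.cast_mul, mul_comm]
        have := valuation_intCast_le O (m : ℤ)
        exact valuation_mul_lt_one (by exact_mod_cast this) h
      have hq : (q.num : Ω) = algebraMap ℚ Ω q * (q.den : Ω) := by
        have := congrArg (algebraMap ℚ Ω) (Rat.mul_den_eq_num q)
        rw [map_mul, map_natCast, map_intCast] at this
        exact this.symm
      rw [hq]
      exact valuation_mul_lt_one hxO hden
    · have hden : O'.valuation (q.den : Ω) = 1 := by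
        by_contra hne
        have hlt : O'.valuation (q.den : Ω) < 1 :=
          lt_of_le_of_ne (by exact_mod_cast valuation_intCast_le O' (q.den : ℤ)) hne
        have hcop : IsCoprime (p : ℤ) (q.den : ℤ) :=
          Nat.isCoprime_iff_coprime.mpr ((Nat.Prime.coprime_iff_not_dvd hp).mpr hd)
        obtain ⟨a, b, hab⟩ := hcop
        have h2 : O'.valuation ((a : Ω) * (p : Ω) + (b : Ω) * (q.den : Ω)) < 1 :=
          O'.valuation.map_add_lt (valuation_mul_lt_one (valuation_intCast_le O' a) h')
            (valuation_mul_lt_one (valuation_intCast_le O' b) hlt)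
        rw [show (a : Ω) * (p : Ω) + (b : Ω) * (q.den : Ω) = 1 by exact_mod_cast congrArg (Int.cast : ℤ → Ω) hab] at h2
        simp at h2
      have hq : algebraMap ℚ Ω q * (q.den : Ω) = (q.num : Ω) := by
        have := congrArg (algebraMap ℚ Ω) (Rat.mul_den_eq_num q)
        rwa [map_mul, map_natCast, map_intCast] at this
      have h3 := congrArg O'.valuation hq
      rw [map_mul, hden, mul_one] at h3
      rw [h3]
      exact valuation_intCast_le O' _
  obtain ⟨g, -, hg⟩ := exists_smul_eq (⊥ : IntermediateField ℚ Ω) hO hO'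
    (fun x hx ↦ ⟨key h h' x hx, key h' h x hx⟩)
  exact ⟨g, hg⟩

theorem eq_one_of_mem_openNormal {g : Ω ≃ₐ[ℚ] Ω}
    (h : ∀ R : Subgroup (Ω ≃ₐ[ℚ] Ω), R.Normal → IsOpen (R : Set (Ω ≃ₐ[ℚ] Ω)) → g ∈ R) : g = 1 := by
  ext x
  obtain ⟨N, hN, hNo, hNx⟩ := exists_openNormal x
  exact hNx g (h N hN hNo)

/-- An automorphism commuting with an open subgroup is trivial. -/
theorem eq_one_of_commute {U : Subgroup (Ω ≃ₐ[ℚ] Ω)} (hU : IsOpen (U : Set (Ω ≃ₐ[ℚ] Ω)))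
    {τ : Ω ≃ₐ[ℚ] Ω} (h : ∀ u ∈ U, τ * u = u * τ) : τ = 1 := by
  refine eq_one_of_mem_openNormal fun R _ hRo ↦ ?_
  obtain ⟨O, hO, hOR⟩ := exists_isOdd_stabilizer_le (U := R ⊓ U) (hRo.inter hU)
  have : O = τ • O := by
    refine hO.eq_of_le (hO.smul τ) hU fun g hg ↦ ?_
    rw [mem_stabilizer_smul]
    have e : τ⁻¹ * g * τ = g := by
      rw [mul_assoc, ← h g hg.2, inv_mul_cancel_left]
    rw [e]
    exact hg.1
  exact (hOR (show τ ∈ MulAction.stabilizer (Ω ≃ₐ[ℚ] Ω) O from this.symm)).1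

/-- Distinct places of a number field are distinguished by a quadratic extension. -/
theorem exists_sqrt_of_ne {R : Subgroup (Ω ≃ₐ[ℚ] Ω)} (hR : IsOpen (R : Set (Ω ≃ₐ[ℚ] Ω)))
    {O O' : ValuationSubring Ω} (hO : IsOdd O) (hO' : IsOdd O')
    (hOR : MulAction.stabilizer (Ω ≃ₐ[ℚ] Ω) O ≤ R) (hOR' : MulAction.stabilizer (Ω ≃ₐ[ℚ] Ω) O' ≤ R)
    (h : ∀ r ∈ R, r • O ≠ O') :
    ∃ y : Ω, (∀ r ∈ R, r (y ^ 2) = y ^ 2) ∧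
      (∀ g ∈ MulAction.stabilizer (Ω ≃ₐ[ℚ] Ω) O, g y = y) ∧
      ∃ g ∈ MulAction.stabilizer (Ω ≃ₐ[ℚ] Ω) O', g y ≠ y := by
  have hfin := finiteDimensional_fixedField hR
  have hfs := fixingSubgroup_fixedField_of_isClosed (R.isClosed_of_isOpen hR)
  have hne : ∃ x ∈ IntermediateField.fixedField R, ¬ (x ∈ O ↔ x ∈ O') := by
    by_contra! hc
    obtain ⟨r, hr, hrO⟩ := exists_smul_eq _ hO.1 hO'.1 hc
    rw [hfs] at hr
    exact h r hr hrO
  obtain ⟨π, hπR, hπ0, hπ, hπe⟩ := exists_uniformizer (IntermediateField.fixedField R) hO'.1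
  obtain ⟨b, hbR, n, hn, hb, hb'⟩ := exists_approx_two _ hO.1 hO'.1 hne hπR hπ0
  have hfix : ∀ x ∈ IntermediateField.fixedField R, ∀ r ∈ R, r x = x := fun x hx r hr ↦ hx ⟨r, hr⟩
  obtain ⟨y, hy, hyb, -⟩ := exists_fixed_root (O := O) (U := MulAction.stabilizer _ O) le_rfl (l := 2)
    (by exact_mod_cast hO.2) (fun u hu ↦ hfix b hbR u (hOR hu)) hb
  refine ⟨y, fun r hr ↦ by rw [hyb]; exact hfix b hbR r hr, hy, ?_⟩
  by_contra! hc
  have hc' : b / (π * (n : Ω) ^ 2) ∈ IntermediateField.fixedField R :=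
    div_mem hbR (mul_mem hπR (pow_mem (natCast_mem _ n) 2))
  obtain ⟨t, ht, htb, ht1⟩ := exists_fixed_root (O := O') (U := MulAction.stabilizer _ O') le_rfl
    (l := 2) (by exact_mod_cast hO'.2) (fun u hu ↦ hfix _ hc' u (hOR' hu)) hb'
  have hn0 : (n : Ω) ≠ 0 := Nat.cast_ne_zero.mpr hn
  have ht0 : t ≠ 0 := by
    rintro rfl
    simp at ht1
  have hb0 : b ≠ 0 := by
    rintro rfl
    simp at hb
  obtain ⟨s, hs⟩ : ∃ s, s = y / (t * n) := ⟨_, rfl⟩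
  have hs2 : s ^ 2 = π := by
    rw [hs, div_pow, mul_pow, hyb, htb]
    field_simp
  have hsfix : ∀ g ∈ MulAction.stabilizer (Ω ≃ₐ[ℚ] Ω) O', g s = s := by
    intro g hg
    rw [hs, map_div₀, map_mul, map_natCast, ht g hg, hc g hg]
  have hs0 : s ≠ 0 := by
    rintro rfl
    apply hπ0
    rw [← hs2]; simp
  have hvs0 : O'.valuation s ≠ 0 := (Valuation.ne_zero_iff _).mpr hs0
  have hvs : O'.valuation s < 1 := by
    rw [← hs2, map_pow] at hπ
    by_contra hge
    exact absurd hπ (not_lt.mpr (one_le_pow₀ (not_lt.mp hge)))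
  obtain ⟨f, hf, hfs'⟩ := exists_near (IntermediateField.fixedField R) hO'.1 (inv_mem hπR)
    (fun g _ hg ↦ hsfix g hg)
  have h1 : O'.valuation (f - s) < O'.valuation s := by
    have e : f - s = -(((s - f) * π⁻¹) * s * s) := by
      rw [mul_assoc ((s - f) * π⁻¹), ← pow_two, hs2]
      field_simp
      ring
    rw [e, Valuation.map_neg, map_mul]
    refine lt_of_lt_of_le (mul_lt_mul_of_pos_right ?_ (zero_lt_iff.mpr hvs0)) (one_mul _).le
    rw [mul_comm]
    exact valuation_mul_lt_one hvs.le hfs'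
  have hvf : O'.valuation f = O'.valuation s := by
    have := Valuation.map_add_eq_of_lt_right O'.valuation h1
    rwa [sub_add_cancel] at this
  have hf0 : f ≠ 0 := by
    rintro rfl
    rw [map_zero] at hvf
    exact hvs0 hvf.symm
  obtain ⟨k, hk⟩ := hπe f hf hf0
  rw [map_mul, hvf, ← map_mul, ← hs2] at hk
  have e : s * (s ^ 2) ^ k = s ^ (2 * k + 1) := by
    rw [zpow_add₀ hs0, zpow_mul, zpow_one, mul_comm]
    norm_cast
  rw [e, map_zpow₀] at hk
  have := (zpow_eq_one_iff_right₀ zero_le hvs.ne).mp hk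
  omega

/-- The elements of `R` acting trivially on the square roots of elements fixed by `R`. -/
def kummerSubgroup (R : Subgroup (Ω ≃ₐ[ℚ] Ω)) : Subgroup (Ω ≃ₐ[ℚ] Ω) where
  carrier := {g | g ∈ R ∧ ∀ y : Ω, (∀ r ∈ R, r (y ^ 2) = y ^ 2) → g y = y}
  one_mem' := ⟨R.one_mem, fun _ _ ↦ rfl⟩
  mul_mem' := fun {a b} ha hb ↦ ⟨R.mul_mem ha.1 hb.1, fun y hy ↦ by
    rw [AlgEquiv.mul_apply, hb.2 y hy, ha.2 y hy]⟩
  inv_mem' := fun {a} ha ↦ ⟨R.inv_mem ha.1, fun y hy ↦ by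
    have := congrArg (fun t ↦ a⁻¹ t) (ha.2 y hy)
    have e : a⁻¹ (a y) = y := AlgEquiv.symm_apply_apply a y
    rw [← this]
    exact e⟩

theorem mem_kummerSubgroup {R : Subgroup (Ω ≃ₐ[ℚ] Ω)} {g : Ω ≃ₐ[ℚ] Ω} :
    g ∈ kummerSubgroup R ↔ g ∈ R ∧ ∀ y : Ω, (∀ r ∈ R, r (y ^ 2) = y ^ 2) → g y = y := Iff.rfl

theorem eq_or_eq_neg_of_fixed_sq {R : Subgroup (Ω ≃ₐ[ℚ] Ω)} {y : Ω} (hy : ∀ r ∈ R, r (y ^ 2) = y ^ 2)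
    {g : Ω ≃ₐ[ℚ] Ω} (hg : g ∈ R) : g y = y ∨ g y = -y :=
  sq_eq_sq_iff_eq_or_eq_neg.mp (by rw [← map_pow g y 2, hy g hg])

theorem commutator_mem_kummerSubgroup {R : Subgroup (Ω ≃ₐ[ℚ] Ω)} {g h : Ω ≃ₐ[ℚ] Ω} (hg : g ∈ R)
    (hh : h ∈ R) : g * h * g⁻¹ * h⁻¹ ∈ kummerSubgroup R := by
  refine ⟨R.mul_mem (R.mul_mem (R.mul_mem hg hh) (R.inv_mem hg)) (R.inv_mem hh), fun y hy ↦ ?_⟩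
  rw [AlgEquiv.mul_apply, AlgEquiv.mul_apply, AlgEquiv.mul_apply]
  have hgi : ∀ z, g (g⁻¹ z) = z := fun z ↦ AlgEquiv.apply_symm_apply g z
  have hhi : ∀ z, h (h⁻¹ z) = z := fun z ↦ AlgEquiv.apply_symm_apply h z
  have h1 := eq_or_eq_neg_of_fixed_sq hy (R.inv_mem hg)
  have h2 := eq_or_eq_neg_of_fixed_sq hy (R.inv_mem hh)
  have hg' := hgi y
  have hh' := hhi y
  rcases h1 with h1 | h1 <;> rcases h2 with h2 | h2 <;> rw [h1] at hg' <;> rw [h2] at hh' <;>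
    simp_all
  rw [neg_eq_iff_eq_neg.mp hh', map_neg, hg']

theorem sq_mem_kummerSubgroup {R : Subgroup (Ω ≃ₐ[ℚ] Ω)} {g : Ω ≃ₐ[ℚ] Ω} (hg : g ∈ R) :
    g ^ 2 ∈ kummerSubgroup R := by
  refine ⟨R.pow_mem hg 2, fun y hy ↦ ?_⟩
  rw [pow_two, AlgEquiv.mul_apply]
  rcases eq_or_eq_neg_of_fixed_sq hy hg with h | h <;> simp [h]

theorem kummerSubgroup_normal (R : Subgroup (Ω ≃ₐ[ℚ] Ω)) [hR : R.Normal] :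
    (kummerSubgroup R).Normal := by
  refine ⟨fun n hn g ↦ ⟨hR.conj_mem n hn.1 g, fun y hy ↦ ?_⟩⟩
  have h1 : n (g⁻¹ y) = g⁻¹ y := hn.2 _ fun r hr ↦ by
    rw [← map_pow g⁻¹ y 2]
    have h2 := hy _ (hR.conj_mem r hr g)
    rw [AlgEquiv.mul_apply, AlgEquiv.mul_apply] at h2
    have h3 := congrArg (fun t ↦ g⁻¹ t) h2
    have e : g⁻¹ (g (r (g⁻¹ (y ^ 2)))) = r (g⁻¹ (y ^ 2)) := AlgEquiv.symm_apply_apply g _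
    rw [← e]
    exact h3
  rw [AlgEquiv.mul_apply, AlgEquiv.mul_apply, h1]
  exact AlgEquiv.apply_symm_apply g y

theorem isClosed_kummerSubgroup {R : Subgroup (Ω ≃ₐ[ℚ] Ω)} (hR : IsClosed (R : Set (Ω ≃ₐ[ℚ] Ω))) :
    IsClosed (kummerSubgroup R : Set (Ω ≃ₐ[ℚ] Ω)) := by
  have e : (kummerSubgroup R : Set (Ω ≃ₐ[ℚ] Ω)) = (R : Set (Ω ≃ₐ[ℚ] Ω)) ∩
      ⋂ y ∈ {y : Ω | ∀ r ∈ R, r (y ^ 2) = y ^ 2},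
        (MulAction.stabilizer (Ω ≃ₐ[ℚ] Ω) y : Set (Ω ≃ₐ[ℚ] Ω)) := by
    ext g
    simp only [SetLike.mem_coe, mem_kummerSubgroup, Set.mem_inter_iff, Set.mem_iInter,
      Set.mem_ofPred_eq, mem_stabilizer]
  rw [e]
  exact hR.inter (isClosed_biInter fun y _ ↦ isClosed_stabilizer y)

theorem exists_openNormal_of_notMem_kummerSubgroup {R : Subgroup (Ω ≃ₐ[ℚ] Ω)} [hR : R.Normal]
    (hRo : IsOpen (R : Set (Ω ≃ₐ[ℚ] Ω))) {g : Ω ≃ₐ[ℚ] Ω} (hg : g ∉ kummerSubgroup R) :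
    ∃ N : Subgroup (Ω ≃ₐ[ℚ] Ω), N.Normal ∧ IsOpen (N : Set (Ω ≃ₐ[ℚ] Ω)) ∧ kummerSubgroup R ≤ N ∧
      N ≤ R ∧ g ∉ N := by
  by_cases hgR : g ∈ R
  · obtain ⟨y, hy, hgy⟩ : ∃ y : Ω, (∀ r ∈ R, r (y ^ 2) = y ^ 2) ∧ g y ≠ y := by
      by_contra! hc
      exact hg ⟨hgR, hc⟩
    obtain ⟨N, hN, hNo, hNy⟩ := exists_openNormal y
    have hΦ := kummerSubgroup_normal R
    refine ⟨kummerSubgroup R ⊔ (N ⊓ R), inferInstance, ?_, le_sup_left,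
      sup_le (fun _ h ↦ h.1) inf_le_right, fun hmem ↦ ?_⟩
    · exact Subgroup.isOpen_mono (H₁ := N ⊓ R) le_sup_right (hNo.inter hRo)
    · obtain ⟨a, ha, b, hb, rfl⟩ := Subgroup.mem_sup_of_normal_left.mp hmem
      apply hgy
      rw [AlgEquiv.mul_apply, hNy b hb.1, ha.2 y hy]
  · exact ⟨R, hR, hRo, fun _ h ↦ h.1, le_rfl, hgR⟩

/-- An automorphism acting by conjugation trivially on `R / kummerSubgroup R` near the identity
lies in `R`. -/
theorem mem_of_forall_conj_mem {R W : Subgroup (Ω ≃ₐ[ℚ] Ω)} [hR : R.Normal]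
    (hRo : IsOpen (R : Set (Ω ≃ₐ[ℚ] Ω))) (hW : IsOpen (W : Set (Ω ≃ₐ[ℚ] Ω)))
    {γ : Ω ≃ₐ[ℚ] Ω} (h : ∀ v ∈ W, γ * v * γ⁻¹ * v⁻¹ ∈ kummerSubgroup R) : γ ∈ R := by
  have ho : IsOpen ((R ⊓ W : Subgroup (Ω ≃ₐ[ℚ] Ω)) : Set (Ω ≃ₐ[ℚ] Ω)) := by
    rw [Subgroup.coe_inf]
    exact hRo.inter hW
  obtain ⟨O, hO, hOW⟩ := exists_isOdd_stabilizer_le ho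
  have hOR : MulAction.stabilizer (Ω ≃ₐ[ℚ] Ω) O ≤ R := hOW.trans inf_le_left
  by_contra hγ
  have hOR' : MulAction.stabilizer (Ω ≃ₐ[ℚ] Ω) (γ • O) ≤ R := by
    intro g hg
    have h1 := hR.conj_mem _ (hOR (mem_stabilizer_smul.mp hg)) γ
    have e : γ * (γ⁻¹ * g * γ) * γ⁻¹ = g := by group
    rwa [e] at h1
  have hne : ∀ r ∈ R, r • O ≠ γ • O := by
    intro r hr hrO
    apply hγ
    have h1 : γ⁻¹ * r ∈ MulAction.stabilizer (Ω ≃ₐ[ℚ] Ω) O := by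
      rw [MulAction.mem_stabilizer_iff, mul_smul, hrO, inv_smul_smul]
    have h2 := R.mul_mem hr (R.inv_mem (hOR h1))
    have e : r * (γ⁻¹ * r)⁻¹ = γ := by group
    rwa [e] at h2
  obtain ⟨y, hy, hy1, g, hg, hgy⟩ := exists_sqrt_of_ne hRo hO (hO.smul γ) hOR hOR' hne
  have hv := mem_stabilizer_smul.mp hg
  obtain ⟨v, hve⟩ : ∃ v, v = γ⁻¹ * g * γ := ⟨_, rfl⟩
  rw [← hve] at hv
  have h1 := (h v (hOW hv).2).2 y hy
  have e : γ * v * γ⁻¹ * v⁻¹ = g * v⁻¹ := by rw [hve]; group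
  rw [e, AlgEquiv.mul_apply, hy1 _ (inv_mem hv)] at h1
  exact hgy h1

end Rigidity
section Transport

variable {Ω : Type*} [Field Ω] [CharZero Ω] [Algebra.IsAlgebraic ℚ Ω] [IsAlgClosed Ω]
  {U U' : Subgroup (Ω ≃ₐ[ℚ] Ω)}

attribute [local instance] isGalois_rat numberField_of_finiteDimensional

/-- An isomorphism of open subgroups induces an equivariant map on places. -/
theorem exists_placeMap (hU : IsOpen (U : Set (Ω ≃ₐ[ℚ] Ω))) (hU' : IsOpen (U' : Set (Ω ≃ₐ[ℚ] Ω)))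
    (α : U ≃ₜ* U') : ∃ φ : ValuationSubring Ω → ValuationSubring Ω,
      (∀ O, IsOdd O → IsOdd (φ O) ∧
        transport α (MulAction.stabilizer _ O ⊓ U) = MulAction.stabilizer _ (φ O) ⊓ U' ∧
        ∀ p : ℕ, p.Prime → ((φ O).valuation (p : Ω) < 1 ↔ O.valuation (p : Ω) < 1)) ∧
      (∀ O', IsOdd O' → ∃ O, IsOdd O ∧ φ O = O') ∧
      ∀ O, IsOdd O → ∀ u : U, φ ((u : Ω ≃ₐ[ℚ] Ω) • O) = (α u : Ω ≃ₐ[ℚ] Ω) • φ O := by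
  choose! φ hφ using fun (O : ValuationSubring Ω) (h : IsOdd O) ↦
    exists_place_of_continuousMulEquiv hU hU' α h
  refine ⟨φ, hφ, fun O' hO' ↦ ?_, fun O hO u ↦ ?_⟩
  · obtain ⟨O, hO, h, -⟩ := exists_place_of_continuousMulEquiv hU' hU α.symm hO'
    refine ⟨O, hO, (hφ O hO).1.eq_of_le hO' hU' ?_⟩
    rw [← (hφ O hO).2.1, ← h, transport_transport_symm α inf_le_right]
    exact inf_le_left
  · refine (hφ _ (hO.smul u)).1.eq_of_le ((hφ O hO).1.smul _) hU' ?_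
    rw [← (hφ _ (hO.smul u)).2.1]
    intro g hg
    obtain ⟨hgU, hg'⟩ := mem_transport.mp hg
    rw [mem_stabilizer_smul]
    obtain ⟨v, hv⟩ : ∃ v, v = α.symm ⟨g, hgU⟩ := ⟨_, rfl⟩
    rw [← hv] at hg'
    have e : g = (α v : Ω ≃ₐ[ℚ] Ω) := by rw [hv, ContinuousMulEquiv.apply_symm_apply]
    have h1 : ((u⁻¹ * v * u : U) : Ω ≃ₐ[ℚ] Ω) ∈ MulAction.stabilizer _ O ⊓ U :=
      ⟨mem_stabilizer_smul.mp hg'.1, (u⁻¹ * v * u).2⟩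
    rw [← apply_mem_transport (α := α), (hφ O hO).2.1] at h1
    rw [e]
    simpa using h1.1

theorem exists_odd_prime_valuation_lt {O : ValuationSubring Ω} (hO : IsOdd O) :
    ∃ p : ℕ, p.Prime ∧ O.valuation (p : Ω) < 1 ∧
      ∀ O' : ValuationSubring Ω, O' ≠ ⊤ → O'.valuation (p : Ω) < 1 → IsOdd O' := by
  obtain ⟨p, hp, h⟩ := exists_resChar hO.1
  refine ⟨p, hp, h, fun O' hO' h' ↦ ⟨hO', ?_⟩⟩
  have hne : (2 : ℕ) ≠ p := by
    rintro rfl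
    have := hO.2
    rw [Nat.cast_ofNat] at h
    exact h.ne this
  exact_mod_cast valuation_prime_eq_one hp Nat.prime_two h' hne

theorem index_ne_zero_of_isOpen {R : Subgroup (Ω ≃ₐ[ℚ] Ω)}
    (hR : IsOpen (R : Set (Ω ≃ₐ[ℚ] Ω))) : R.index ≠ 0 := by
  have := relIndex_ne_zero_of_isOpen hR ⊤
  rwa [top_inf_eq, Subgroup.relIndex_top_right] at this

/-- Counting places above a prime that splits completely in the field of `R`. -/
theorem exists_surjective_quotient (hU : IsOpen (U : Set (Ω ≃ₐ[ℚ] Ω)))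
    (hU' : IsOpen (U' : Set (Ω ≃ₐ[ℚ] Ω))) (α : U ≃ₜ* U') {R : Subgroup (Ω ≃ₐ[ℚ] Ω)}
    [hR : R.Normal] {O : ValuationSubring Ω} (hO : IsOdd O)
    (hOR : MulAction.stabilizer (Ω ≃ₐ[ℚ] Ω) O ≤ R) :
    ∃ f : (Ω ≃ₐ[ℚ] Ω) ⧸ transport α R → (Ω ≃ₐ[ℚ] Ω) ⧸ R, Function.Surjective f ∧
      ∀ g z, z ∈ MulAction.stabilizer (Ω ≃ₐ[ℚ] Ω) O →
        f (QuotientGroup.mk (z * g)) = f (QuotientGroup.mk g) := by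
  obtain ⟨p, hp, hpO, hodd⟩ := exists_odd_prime_valuation_lt hO
  obtain ⟨φ, hφ, -, hφe⟩ := exists_placeMap hU' hU α.symm
  obtain ⟨ψ, hψ, hψs, hψe⟩ := exists_placeMap hU hU' α
  have hpg : ∀ g : Ω ≃ₐ[ℚ] Ω, (g • O).valuation (p : Ω) < 1 := by
    intro g
    have := (valuation_smul_lt (g := g) (O := O) (p : Ω)).mpr hpO
    rwa [map_natCast] at this
  have hex : ∀ g : Ω ≃ₐ[ℚ] Ω, ∃ k : Ω ≃ₐ[ℚ] Ω, k • O = φ (g⁻¹ • O) := fun g ↦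
    exists_smul_eq_of_prime hO.1 (hφ _ (hO.smul _)).1.1 hp hpO
      (((hφ _ (hO.smul _)).2.2 p hp).mpr (hpg _))
  have huniq : ∀ k k' r : Ω ≃ₐ[ℚ] Ω, r ∈ R → k • O = r • k' • O →
      (QuotientGroup.mk k : (Ω ≃ₐ[ℚ] Ω) ⧸ R) = QuotientGroup.mk k' := by
    intro k k' r hr h
    rw [QuotientGroup.eq]
    have h1 : k⁻¹ * (r * k') ∈ R := hOR (by
      rw [MulAction.mem_stabilizer_iff, mul_smul, mul_smul, ← h, inv_smul_smul])
    have h2 : k'⁻¹ * r * k' ∈ R := by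
      have := hR.conj_mem r hr k'⁻¹
      rwa [inv_inv] at this
    have h3 := R.mul_mem h1 (R.inv_mem h2)
    have e : k⁻¹ * (r * k') * (k'⁻¹ * r * k')⁻¹ = k⁻¹ * k' := by group
    rwa [e] at h3
  choose k hk using hex
  have hwd : ∀ g g' : Ω ≃ₐ[ℚ] Ω, g⁻¹ * g' ∈ transport α R →
      (QuotientGroup.mk (k g) : (Ω ≃ₐ[ℚ] Ω) ⧸ R) = QuotientGroup.mk (k g') := by
    intro g g' h
    obtain ⟨hU1, h1⟩ := mem_transport.mp h
    refine huniq _ _ _ h1 ?_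
    rw [hk, hk, ← hφe _ (hO.smul _) ⟨g⁻¹ * g', hU1⟩]
    change _ = φ ((g⁻¹ * g') • g'⁻¹ • O)
    rw [mul_smul, smul_inv_smul]
  refine ⟨Quotient.lift (fun g ↦ QuotientGroup.mk (k g)) fun g g' h ↦
    hwd g g' (QuotientGroup.leftRel_apply.mp h), ?_, ?_⟩
  · intro q
    obtain ⟨g, rfl⟩ := QuotientGroup.mk_surjective q
    obtain ⟨h, hh⟩ := exists_smul_eq_of_prime hO.1 (hψ _ (hO.smul g)).1.1 hp hpO
      (((hψ _ (hO.smul g)).2.2 p hp).mpr (hpg g))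
    refine ⟨QuotientGroup.mk h⁻¹, ?_⟩
    change (QuotientGroup.mk (k h⁻¹) : (Ω ≃ₐ[ℚ] Ω) ⧸ R) = _
    refine huniq _ _ 1 R.one_mem ?_
    rw [one_smul, hk, inv_inv, hh]
    refine (hφ _ (hψ _ (hO.smul g)).1).1.eq_of_le (hO.smul g) hU ?_
    rw [← (hφ _ (hψ _ (hO.smul g)).1).2.1, ← (hψ _ (hO.smul g)).2.1,
      transport_symm_transport α inf_le_right]
    exact inf_le_left
  · intro g z hz
    change (QuotientGroup.mk (k (z * g)) : (Ω ≃ₐ[ℚ] Ω) ⧸ R) = QuotientGroup.mk (k g)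
    refine huniq _ _ 1 R.one_mem ?_
    have hz' : z⁻¹ • O = O := (MulAction.stabilizer _ O).inv_mem hz
    rw [one_smul, hk, hk, mul_inv_rev, mul_smul, hz']

theorem index_transport_le (hU : IsOpen (U : Set (Ω ≃ₐ[ℚ] Ω)))
    (hU' : IsOpen (U' : Set (Ω ≃ₐ[ℚ] Ω))) (α : U ≃ₜ* U') {R : Subgroup (Ω ≃ₐ[ℚ] Ω)}
    [hR : R.Normal] (hRo : IsOpen (R : Set (Ω ≃ₐ[ℚ] Ω))) (hRU : R ≤ U) :
    U.index ≤ U'.index := by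
  obtain ⟨O, hO, hOR⟩ := exists_isOdd_stabilizer_le hRo
  obtain ⟨f, hf, -⟩ := exists_surjective_quotient hU hU' α hO hOR
  have hi := index_ne_zero_of_isOpen (isOpen_transport α hU' hRo)
  have : Finite ((Ω ≃ₐ[ℚ] Ω) ⧸ transport α R) := Nat.finite_of_card_ne_zero hi
  have h1 : R.index ≤ (transport α R).index := Nat.card_le_card_of_surjective f hf
  rw [← Subgroup.relIndex_mul_index hRU, ← Subgroup.relIndex_mul_index (transport_le α R)] at h1
  have h2 := relIndex_transport α (V := R) (W := U) le_rfl
  rw [transport_self] at h2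
  rw [h2] at h1
  refine Nat.le_of_mul_le_mul_left h1 (Nat.pos_of_ne_zero fun h ↦ ?_)
  apply index_ne_zero_of_isOpen hRo
  rw [← Subgroup.relIndex_mul_index hRU, h, zero_mul]

theorem transport_eq_of_normal (hU : IsOpen (U : Set (Ω ≃ₐ[ℚ] Ω)))
    (hU' : IsOpen (U' : Set (Ω ≃ₐ[ℚ] Ω))) (α : U ≃ₜ* U') {R : Subgroup (Ω ≃ₐ[ℚ] Ω)}
    [hR : R.Normal] (hRo : IsOpen (R : Set (Ω ≃ₐ[ℚ] Ω))) (hRU : R ≤ U) (hRU' : R ≤ U') :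
    transport α R = R := by
  have hUU : U.index = U'.index := le_antisymm (index_transport_le hU hU' α hRo hRU)
    (index_transport_le hU' hU α.symm hRo hRU')
  have hTo := isOpen_transport α hU' hRo
  have hTi := index_ne_zero_of_isOpen hTo
  have hRi := index_ne_zero_of_isOpen hRo
  have : Finite ((Ω ≃ₐ[ℚ] Ω) ⧸ transport α R) := Nat.finite_of_card_ne_zero hTi
  have : Finite ((Ω ≃ₐ[ℚ] Ω) ⧸ R) := Nat.finite_of_card_ne_zero hRi
  have hidx : (transport α R).index = R.index := by
    rw [← Subgroup.relIndex_mul_index hRU, ← Subgroup.relIndex_mul_index (transport_le α R)]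
    have h2 := relIndex_transport α (V := R) (W := U) le_rfl
    rw [transport_self] at h2
    rw [h2, hUU]
  have hle : R ≤ transport α R := by
    have ho : IsOpen ((R ⊓ transport α R : Subgroup (Ω ≃ₐ[ℚ] Ω)) : Set (Ω ≃ₐ[ℚ] Ω)) := by
      rw [Subgroup.coe_inf]
      exact hRo.inter hTo
    have := eq_of_forall_stabilizer_le (W := R ⊓ transport α R) hRo ho inf_le_left
      (fun O hO hOR ↦ by
        obtain ⟨f, hf, hfz⟩ := exists_surjective_quotient hU hU' α hO hOR
        have hinj : Function.Injective f :=
          ((Nat.bijective_iff_surjective_and_card f).mpr ⟨hf, hidx⟩).1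
        intro z hz
        refine ⟨hOR hz, ?_⟩
        have h1 := hinj (hfz 1 z hz)
        rw [mul_one, eq_comm, QuotientGroup.eq, inv_one, one_mul] at h1
        exact h1)
    exact this.ge.trans inf_le_right
  have h1 := Subgroup.relIndex_mul_index hle
  rw [hidx, mul_eq_right₀ hRi, Subgroup.relIndex_eq_one] at h1
  exact le_antisymm h1 hle

end Transport
section Conjugation

variable {Ω : Type*} [Field Ω] [CharZero Ω] [Algebra.IsAlgebraic ℚ Ω] [IsAlgClosed Ω]
  {U U' : Subgroup (Ω ≃ₐ[ℚ] Ω)}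

attribute [local instance] isGalois_rat numberField_of_finiteDimensional

theorem isClosed_setOf_twist {N : Subgroup (Ω ≃ₐ[ℚ] Ω)} (hN : IsOpen (N : Set (Ω ≃ₐ[ℚ] Ω)))
    (a b : Ω ≃ₐ[ℚ] Ω) : IsClosed {g : Ω ≃ₐ[ℚ] Ω | a * g * b * g⁻¹ ∈ N} := by
  have hc : Continuous fun g : Ω ≃ₐ[ℚ] Ω ↦ a * g * b * g⁻¹ := by fun_prop
  exact (N.isClosed_of_isOpen hN).preimage hc

theorem exists_forall_mem_of_directed {𝒩 : Set (Subgroup (Ω ≃ₐ[ℚ] Ω))} (hne : 𝒩.Nonempty)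
    (hinf : ∀ N ∈ 𝒩, ∀ N' ∈ 𝒩, N ⊓ N' ∈ 𝒩) {T : Subgroup (Ω ≃ₐ[ℚ] Ω) → Set (Ω ≃ₐ[ℚ] Ω)}
    (hmono : ∀ N N', N ≤ N' → T N ⊆ T N') (hcl : ∀ N ∈ 𝒩, IsClosed (T N))
    (hT : ∀ N ∈ 𝒩, (T N).Nonempty) : ∃ g, ∀ N ∈ 𝒩, g ∈ T N := by
  have : Nonempty 𝒩 := hne.to_subtype
  have := IsCompact.nonempty_iInter_of_directed_nonempty_isCompact_isClosed
    (fun N : 𝒩 ↦ T N) (fun N N' ↦ ⟨⟨_, hinf N N.2 N' N'.2⟩, hmono _ _ inf_le_left,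
      hmono _ _ inf_le_right⟩) (fun N ↦ hT N N.2) (fun N ↦ (hcl N N.2).isCompact) (fun N ↦ hcl N N.2)
  obtain ⟨g, hg⟩ := this
  exact ⟨g, fun N hN ↦ Set.mem_iInter.mp hg ⟨N, hN⟩⟩

theorem exists_conj_mem_openNormal (hU : IsOpen (U : Set (Ω ≃ₐ[ℚ] Ω)))
    (hU' : IsOpen (U' : Set (Ω ≃ₐ[ℚ] Ω))) (α : U ≃ₜ* U') {R N : Subgroup (Ω ≃ₐ[ℚ] Ω)}
    [hR : R.Normal] (hRo : IsOpen (R : Set (Ω ≃ₐ[ℚ] Ω))) (hRU : R ≤ U) (hRU' : R ≤ U')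
    [hN : N.Normal] (hNo : IsOpen (N : Set (Ω ≃ₐ[ℚ] Ω))) (hNR : N ≤ R) (hΦN : kummerSubgroup R ≤ N)
    {v : U} (hv : (v : Ω ≃ₐ[ℚ] Ω) ∈ R) :
    ∃ g : Ω ≃ₐ[ℚ] Ω, (α v : Ω ≃ₐ[ℚ] Ω) * g * (v : Ω ≃ₐ[ℚ] Ω)⁻¹ * g⁻¹ ∈ N := by
  have hαR := transport_eq_of_normal hU hU' α hRo hRU hRU'
  have hαN := transport_eq_of_normal hU hU' α hNo (hNR.trans hRU) (hNR.trans hRU')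
  have hmemN : ∀ u : U, (α u : Ω ≃ₐ[ℚ] Ω) ∈ N ↔ (u : Ω ≃ₐ[ℚ] Ω) ∈ N := by
    intro u
    rw [← apply_mem_transport (α := α), hαN]
  by_cases hvN : (v : Ω ≃ₐ[ℚ] Ω) ∈ N
  · refine ⟨1, ?_⟩
    rw [mul_one, inv_one, mul_one]
    exact N.mul_mem ((hmemN v).mpr hvN) (N.inv_mem hvN)
  obtain ⟨w, hw⟩ : ∃ w, w = (v : Ω ≃ₐ[ℚ] Ω) := ⟨_, rfl⟩
  have hw2 : w ^ 2 ∈ N := hΦN (sq_mem_kummerSubgroup (hw ▸ hv))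
  obtain ⟨B, hB⟩ : ∃ B, B = Subgroup.zpowers w ⊔ N := ⟨_, rfl⟩
  have hBR : B ≤ R := by
    rw [hB]
    refine sup_le ?_ hNR
    rw [Subgroup.zpowers_le, hw]
    exact hv
  have hNB : N ≤ B := hB ▸ le_sup_right
  have hwB : w ∈ B := hB ▸ (le_sup_left : Subgroup.zpowers w ≤ _) (Subgroup.mem_zpowers w)
  have hBdich : ∀ x ∈ B, x ∉ N → w⁻¹ * x ∈ N := by
    intro x hx hxN
    rw [hB, Subgroup.mem_sup_of_normal_right] at hx
    obtain ⟨y, hy, n, hn, rfl⟩ := hx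
    obtain ⟨k, rfl⟩ := Subgroup.mem_zpowers_iff.mp hy
    have h2 : ∀ m : ℤ, w ^ (2 * m) ∈ N := fun m ↦ by
      rw [zpow_mul]
      exact N.zpow_mem (by exact_mod_cast hw2) m
    obtain ⟨m, rfl | rfl⟩ := Int.even_or_odd' k
    · exact absurd (N.mul_mem (h2 m) hn) hxN
    · have e : w⁻¹ * (w ^ (2 * m + 1) * n) = w ^ (2 * m) * n := by
        rw [zpow_add_one, ← mul_assoc, ← mul_assoc, ← zpow_neg_one, ← zpow_add, mul_assoc _ w n,
          ← zpow_one w, ← mul_assoc]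
        group
      rw [e]
      exact N.mul_mem (h2 m) hn
  have hBo : IsOpen (B : Set (Ω ≃ₐ[ℚ] Ω)) := Subgroup.isOpen_mono (H₁ := N) hNB hNo
  obtain ⟨O, hO, hOB, hON⟩ : ∃ O : ValuationSubring Ω, IsOdd O ∧
      MulAction.stabilizer (Ω ≃ₐ[ℚ] Ω) O ≤ B ∧ ¬ MulAction.stabilizer (Ω ≃ₐ[ℚ] Ω) O ≤ N := by
    by_contra! hc
    have := eq_of_forall_stabilizer_le hBo hNo hNB hc
    rw [this, ← hw] at hvN
    exact hvN hwB
  obtain ⟨z, hz, hzN⟩ := SetLike.not_le_iff_exists.mp hON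
  obtain ⟨O', hO', htr, hchar⟩ := exists_place_of_continuousMulEquiv hU hU' α hO
  obtain ⟨p, hp, hpO⟩ := exists_resChar hO.1
  obtain ⟨g, rfl⟩ := exists_smul_eq_of_prime hO.1 hO'.1 hp hpO ((hchar p hp).mpr hpO)
  obtain ⟨u, rfl⟩ : ∃ u : U, (u : Ω ≃ₐ[ℚ] Ω) = z := ⟨⟨z, hRU (hBR (hOB hz))⟩, rfl⟩
  have h1 : (α u : Ω ≃ₐ[ℚ] Ω) ∈ MulAction.stabilizer (Ω ≃ₐ[ℚ] Ω) (g • O) ⊓ U' := by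
    rw [← htr, apply_mem_transport]
    exact ⟨hz, u.2⟩
  have h2 : g⁻¹ * (α u : Ω ≃ₐ[ℚ] Ω) * g ∈ B := hOB (mem_stabilizer_smul.mp h1.1)
  have h3 : g⁻¹ * (α u : Ω ≃ₐ[ℚ] Ω) * g ∉ N := by
    intro h
    have := hN.conj_mem _ h g
    have e : g * (g⁻¹ * (α u : Ω ≃ₐ[ℚ] Ω) * g) * g⁻¹ = α u := by group
    rw [e, hmemN] at this
    exact hzN this
  have h4 := hBdich _ h2 h3
  have h5 : ((v⁻¹ * u : U) : Ω ≃ₐ[ℚ] Ω) ∈ N := by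
    have := hBdich _ (hOB hz) hzN
    rwa [hw] at this
  rw [← hmemN, map_mul, map_inv] at h5
  refine ⟨g, ?_⟩
  rw [hw] at h4
  obtain ⟨a, ha⟩ : ∃ a, a = (α u : Ω ≃ₐ[ℚ] Ω) := ⟨_, rfl⟩
  obtain ⟨b, hb⟩ : ∃ b, b = (α v : Ω ≃ₐ[ℚ] Ω) := ⟨_, rfl⟩
  obtain ⟨c, hc⟩ : ∃ c, c = (v : Ω ≃ₐ[ℚ] Ω) := ⟨_, rfl⟩
  have h5' : b⁻¹ * a ∈ N := by rw [ha, hb]; exact h5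
  rw [← ha, ← hc] at h4
  rw [← hb, ← hc]
  have h6 := hN.conj_mem _ (N.inv_mem h5') b
  have h7 := hN.conj_mem _ h4 (g * c)
  have h8 := hN.conj_mem _ (N.mul_mem h6 h7) (g * c * g⁻¹)⁻¹
  have h9 := N.mul_mem h7 h6
  have e : g * c * (c⁻¹ * (g⁻¹ * a * g)) * (g * c)⁻¹ = a * (g * c⁻¹ * g⁻¹) := by group
  have e' : b * (b⁻¹ * a)⁻¹ * b⁻¹ = b * a⁻¹ := by group
  rw [e] at h7
  rw [e'] at h6
  have h10 := N.mul_mem h6 h7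
  have e'' : b * a⁻¹ * (a * (g * c⁻¹ * g⁻¹)) = b * g * c⁻¹ * g⁻¹ := by group
  rwa [e''] at h10

theorem exists_conj_mem_kummerSubgroup (hU : IsOpen (U : Set (Ω ≃ₐ[ℚ] Ω)))
    (hU' : IsOpen (U' : Set (Ω ≃ₐ[ℚ] Ω))) (α : U ≃ₜ* U') {R : Subgroup (Ω ≃ₐ[ℚ] Ω)}
    [hR : R.Normal] (hRo : IsOpen (R : Set (Ω ≃ₐ[ℚ] Ω))) (hRU : R ≤ U) (hRU' : R ≤ U')
    {v : U} (hv : (v : Ω ≃ₐ[ℚ] Ω) ∈ R) :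
    ∃ g : Ω ≃ₐ[ℚ] Ω, (α v : Ω ≃ₐ[ℚ] Ω) * g * (v : Ω ≃ₐ[ℚ] Ω)⁻¹ * g⁻¹ ∈ kummerSubgroup R := by
  obtain ⟨g, hg⟩ := exists_forall_mem_of_directed
    (𝒩 := {N : Subgroup (Ω ≃ₐ[ℚ] Ω) | N.Normal ∧ IsOpen (N : Set (Ω ≃ₐ[ℚ] Ω)) ∧
      kummerSubgroup R ≤ N ∧ N ≤ R})
    (T := fun N ↦ {g | (α v : Ω ≃ₐ[ℚ] Ω) * g * (v : Ω ≃ₐ[ℚ] Ω)⁻¹ * g⁻¹ ∈ N})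
    ⟨R, hR, hRo, fun _ h ↦ h.1, le_rfl⟩
    (by
      rintro N ⟨h1, h2, h3, h4⟩ N' ⟨h1', h2', h3', h4'⟩
      refine ⟨inferInstance, ?_, le_inf h3 h3', inf_le_left.trans h4⟩
      rw [Subgroup.coe_inf]
      exact h2.inter h2')
    (fun N N' h g hg ↦ h hg)
    (by
      rintro N ⟨h1, h2, h3, h4⟩
      exact isClosed_setOf_twist h2 _ _)
    (by
      rintro N ⟨h1, h2, h3, h4⟩
      exact exists_conj_mem_openNormal hU hU' α hRo hRU hRU' h2 h4 h3 hv)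
  refine ⟨g, ?_⟩
  by_contra hc
  obtain ⟨N, h1, h2, h3, h4, h5⟩ := exists_openNormal_of_notMem_kummerSubgroup hRo hc
  exact h5 (hg N ⟨h1, h2, h3, h4⟩)

/-- By B. H. Neumann's lemma a single conjugation describes the isomorphism modulo
`kummerSubgroup R` on an open subgroup. -/
theorem exists_isOpen_forall_conj_mem (hU : IsOpen (U : Set (Ω ≃ₐ[ℚ] Ω)))
    (hU' : IsOpen (U' : Set (Ω ≃ₐ[ℚ] Ω))) (α : U ≃ₜ* U') {R : Subgroup (Ω ≃ₐ[ℚ] Ω)}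
    [hR : R.Normal] (hRo : IsOpen (R : Set (Ω ≃ₐ[ℚ] Ω))) (hRU : R ≤ U) (hRU' : R ≤ U') :
    ∃ (g : Ω ≃ₐ[ℚ] Ω) (W : Subgroup (Ω ≃ₐ[ℚ] Ω)), IsOpen (W : Set (Ω ≃ₐ[ℚ] Ω)) ∧
      ∀ v : U, (v : Ω ≃ₐ[ℚ] Ω) ∈ W →
        (α v : Ω ≃ₐ[ℚ] Ω) * g * (v : Ω ≃ₐ[ℚ] Ω)⁻¹ * g⁻¹ ∈ kummerSubgroup R := by
  classical
  have hΦ := kummerSubgroup_normal R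
  have : Finite ((Ω ≃ₐ[ℚ] Ω) ⧸ R) := Nat.finite_of_card_ne_zero (index_ne_zero_of_isOpen hRo)
  have : Fintype ((Ω ≃ₐ[ℚ] Ω) ⧸ R) := Fintype.ofFinite _
  let f : R →* (Ω ≃ₐ[ℚ] Ω) := (U'.subtype.comp (α : U →* U')).comp (Subgroup.inclusion hRU)
  let C : (Ω ≃ₐ[ℚ] Ω) → Subgroup R := fun g ↦
    ((QuotientGroup.mk' (kummerSubgroup R)).comp f).eqLocus
      ((QuotientGroup.mk' (kummerSubgroup R)).comp ((MulAut.conj g).toMonoidHom.comp R.subtype))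
  have hC : ∀ g (v : R), v ∈ C g ↔
      f v * g * (v : Ω ≃ₐ[ℚ] Ω)⁻¹ * g⁻¹ ∈ kummerSubgroup R := by
    intro g v
    change (QuotientGroup.mk (f v) : (Ω ≃ₐ[ℚ] Ω) ⧸ kummerSubgroup R) =
      QuotientGroup.mk (g * (v : Ω ≃ₐ[ℚ] Ω) * g⁻¹) ↔ _
    rw [QuotientGroup.eq_iff_div_mem]
    have e : f v / (g * (v : Ω ≃ₐ[ℚ] Ω) * g⁻¹) = f v * g * (v : Ω ≃ₐ[ℚ] Ω)⁻¹ * g⁻¹ := by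
      rw [div_eq_mul_inv, mul_inv_rev, mul_inv_rev, inv_inv]
      simp only [mul_assoc]
    rw [e]
  have hcov : ⋃ q ∈ (Finset.univ : Finset ((Ω ≃ₐ[ℚ] Ω) ⧸ R)), (1 : R) • (C q.out : Set R) =
      Set.univ := by
    refine Set.eq_univ_of_forall fun v ↦ ?_
    obtain ⟨g, hg⟩ := exists_conj_mem_kummerSubgroup hU hU' α hRo hRU hRU' (v := ⟨v, hRU v.2⟩) v.2
    simp only [Finset.mem_univ, Set.iUnion_true, one_smul, Set.mem_iUnion, SetLike.mem_coe]
    refine ⟨QuotientGroup.mk g, (hC _ _).mpr ?_⟩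
    obtain ⟨k, hk⟩ : ∃ k, k = (QuotientGroup.mk g : (Ω ≃ₐ[ℚ] Ω) ⧸ R).out := ⟨_, rfl⟩
    rw [← hk]
    have hr : k⁻¹ * g ∈ R := by
      rw [← QuotientGroup.eq, hk]
      exact QuotientGroup.out_eq' _
    have h1 := hΦ.conj_mem _ (commutator_mem_kummerSubgroup hr v.2) k
    have h2 := (kummerSubgroup R).mul_mem hg h1
    obtain ⟨w, hw⟩ : ∃ w, w = (v : Ω ≃ₐ[ℚ] Ω) := ⟨_, rfl⟩
    change f v * g * (v : Ω ≃ₐ[ℚ] Ω)⁻¹ * g⁻¹ * _ ∈ _ at h2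
    rw [← hw] at h2 ⊢
    have e : f v * g * w⁻¹ * g⁻¹ * (k * (k⁻¹ * g * w * (k⁻¹ * g)⁻¹ * w⁻¹) * k⁻¹) =
      f v * k * w⁻¹ * k⁻¹ := by group
    rwa [e] at h2
  obtain ⟨q, -, hq⟩ := Subgroup.exists_finiteIndex_of_leftCoset_cover hcov
  have hf : Continuous f := by
    change Continuous fun v : R ↦ (α (Subgroup.inclusion hRU v) : Ω ≃ₐ[ℚ] Ω)
    exact continuous_subtype_val.comp (α.continuous.comp
      (Continuous.subtype_mk continuous_subtype_val _))
  have hcl : IsClosed (C q.out : Set R) := by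
    have : (C q.out : Set R) = (fun v : R ↦ f v * q.out * (v : Ω ≃ₐ[ℚ] Ω)⁻¹ * q.out⁻¹) ⁻¹'
        (kummerSubgroup R : Set (Ω ≃ₐ[ℚ] Ω)) := by
      ext v
      exact hC _ v
    rw [this]
    exact (isClosed_kummerSubgroup (R.isClosed_of_isOpen hRo)).preimage (by fun_prop)
  have hop := Subgroup.isOpen_of_isClosed_of_finiteIndex _ hcl
  refine ⟨q.out, (C q.out).map R.subtype, ?_, ?_⟩
  · rw [Subgroup.coe_map]
    exact hRo.isOpenEmbedding_subtypeVal.isOpenMap _ hop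
  · rintro v ⟨r, hr, hrv⟩
    have h1 := (hC _ _).mp hr
    have h2 : Subgroup.inclusion hRU r = v := Subtype.ext hrv
    change (α (Subgroup.inclusion hRU r) : Ω ≃ₐ[ℚ] Ω) * _ * (R.subtype r)⁻¹ * _ ∈ _ at h1
    rwa [h2, hrv] at h1

theorem exists_forall_conj_mem (hU : IsOpen (U : Set (Ω ≃ₐ[ℚ] Ω)))
    (hU' : IsOpen (U' : Set (Ω ≃ₐ[ℚ] Ω))) (α : U ≃ₜ* U') {R : Subgroup (Ω ≃ₐ[ℚ] Ω)}
    [hR : R.Normal] (hRo : IsOpen (R : Set (Ω ≃ₐ[ℚ] Ω))) (hRU : R ≤ U) (hRU' : R ≤ U') :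
    ∃ g : Ω ≃ₐ[ℚ] Ω, ∀ h : U, (α h : Ω ≃ₐ[ℚ] Ω) * g * (h : Ω ≃ₐ[ℚ] Ω)⁻¹ * g⁻¹ ∈ R := by
  have hΦ := kummerSubgroup_normal R
  obtain ⟨g, W, hW, hWα⟩ := exists_isOpen_forall_conj_mem hU hU' α hRo hRU hRU'
  refine ⟨g, fun h ↦ ?_⟩
  obtain ⟨W', hW'⟩ : ∃ W', W' = W ⊓ R ⊓ W.comap (MulAut.conj (h : Ω ≃ₐ[ℚ] Ω)).toMonoidHom := ⟨_, rfl⟩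
  have hW'o : IsOpen (W' : Set (Ω ≃ₐ[ℚ] Ω)) := by
    rw [hW', Subgroup.coe_inf, Subgroup.coe_inf, Subgroup.coe_comap]
    refine (hW.inter hRo).inter (hW.preimage ?_)
    change Continuous fun x : Ω ≃ₐ[ℚ] Ω ↦ (h : Ω ≃ₐ[ℚ] Ω) * x * (h : Ω ≃ₐ[ℚ] Ω)⁻¹
    fun_prop
  obtain ⟨c, hc⟩ : ∃ c, c = (h : Ω ≃ₐ[ℚ] Ω) := ⟨_, rfl⟩
  obtain ⟨a, ha⟩ : ∃ a, a = (α h : Ω ≃ₐ[ℚ] Ω) := ⟨_, rfl⟩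
  have key : (g * c)⁻¹ * a * g ∈ R := by
    refine mem_of_forall_conj_mem hRo hW'o fun v hv ↦ ?_
    rw [hW'] at hv
    obtain ⟨v', hv'⟩ : ∃ v' : U, (v' : Ω ≃ₐ[ℚ] Ω) = v := ⟨⟨v, hRU hv.1.2⟩, rfl⟩
    have h1 := hWα v' (by rw [hv']; exact hv.1.1)
    have h2 := hWα (h * v' * h⁻¹) (by
      have := hv.2
      rw [← hv'] at this
      exact this)
    rw [map_mul, map_mul, map_inv] at h2
    obtain ⟨b, hb⟩ : ∃ b, b = (α v' : Ω ≃ₐ[ℚ] Ω) := ⟨_, rfl⟩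
    rw [hv', ← hb] at h1
    change (α h : Ω ≃ₐ[ℚ] Ω) * α v' * (α h : Ω ≃ₐ[ℚ] Ω)⁻¹ * g * ((h : Ω ≃ₐ[ℚ] Ω) * v' *
      (h : Ω ≃ₐ[ℚ] Ω)⁻¹)⁻¹ * g⁻¹ ∈ _ at h2
    rw [hv', ← hb, ← ha, ← hc] at h2
    have h3 := hΦ.conj_mem _ ((kummerSubgroup R).inv_mem h1) a
    have h4 := hΦ.conj_mem _ ((kummerSubgroup R).mul_mem h3 h2) (g * c)⁻¹
    have e : (g * c)⁻¹ * (a * (b * g * v⁻¹ * g⁻¹)⁻¹ * a⁻¹ *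
        (a * b * a⁻¹ * g * (c * v * c⁻¹)⁻¹ * g⁻¹)) * (g * c)⁻¹⁻¹ =
      (g * c)⁻¹ * a * g * v * ((g * c)⁻¹ * a * g)⁻¹ * v⁻¹ := by group
    rwa [e] at h4
  have h1 := hR.conj_mem _ key (g * c)
  have e : g * c * ((g * c)⁻¹ * a * g) * (g * c)⁻¹ = a * g * c⁻¹ * g⁻¹ := by group
  rw [← ha, ← hc]
  rwa [e] at h1

/-- Every isomorphism between open subgroups is induced by conjugation. -/
theorem exists_eq_conj (hU : IsOpen (U : Set (Ω ≃ₐ[ℚ] Ω)))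
    (hU' : IsOpen (U' : Set (Ω ≃ₐ[ℚ] Ω))) (α : U ≃ₜ* U') :
    ∃ g : Ω ≃ₐ[ℚ] Ω, ∀ h : U, (α h : Ω ≃ₐ[ℚ] Ω) = g * h * g⁻¹ := by
  obtain ⟨N, hN, hNo, hNU⟩ := exists_openNormal_le (hU.inter hU') ⟨U.one_mem, U'.one_mem⟩
  obtain ⟨g, hg⟩ := exists_forall_mem_of_directed
    (𝒩 := {R : Subgroup (Ω ≃ₐ[ℚ] Ω) | R.Normal ∧ IsOpen (R : Set (Ω ≃ₐ[ℚ] Ω)) ∧ R ≤ U ∧ R ≤ U'})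
    (T := fun R ↦ ⋂ h : U, {g | (α h : Ω ≃ₐ[ℚ] Ω) * g * (h : Ω ≃ₐ[ℚ] Ω)⁻¹ * g⁻¹ ∈ R})
    ⟨N, hN, hNo, fun _ h ↦ (hNU h).1, fun _ h ↦ (hNU h).2⟩
    (by
      rintro N ⟨h1, h2, h3, h4⟩ N' ⟨h1', h2', h3', h4'⟩
      refine ⟨inferInstance, ?_, inf_le_left.trans h3, inf_le_left.trans h4⟩
      rw [Subgroup.coe_inf]
      exact h2.inter h2')
    (fun N N' h ↦ Set.iInter_mono fun u g hg ↦ h hg)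
    (by
      rintro N ⟨h1, h2, h3, h4⟩
      exact isClosed_iInter fun u ↦ isClosed_setOf_twist h2 _ _)
    (by
      rintro R ⟨h1, h2, h3, h4⟩
      obtain ⟨g, hg⟩ := exists_forall_conj_mem hU hU' α h2 h3 h4
      exact ⟨g, Set.mem_iInter.mpr hg⟩)
  refine ⟨g, fun h ↦ ?_⟩
  have h1 : (α h : Ω ≃ₐ[ℚ] Ω) * g * (h : Ω ≃ₐ[ℚ] Ω)⁻¹ * g⁻¹ = 1 := by
    refine eq_one_of_mem_openNormal fun R hR hRo ↦ ?_
    have h2 := hg (R ⊓ N) ⟨inferInstance, by rw [Subgroup.coe_inf]; exact hRo.inter hNo,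
      fun _ h ↦ (hNU h.2).1, fun _ h ↦ (hNU h.2).2⟩
    exact (Set.mem_iInter.mp h2 h).1
  have e : (α h : Ω ≃ₐ[ℚ] Ω) = (α h : Ω ≃ₐ[ℚ] Ω) * g * (h : Ω ≃ₐ[ℚ] Ω)⁻¹ * g⁻¹ *
      (g * h * g⁻¹) := by group
  rw [e, h1, one_mul]

end Conjugation
section AlgebraicClosures

theorem continuous_of_isOpen_setOf_apply_eq {k M G : Type*} [Field k] [Field M] [Algebra k M]
    [Group G] [TopologicalSpace G] [IsTopologicalGroup G] (f : G →* (M ≃ₐ[k] M))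
    (h : ∀ x, IsOpen {g | f g x = x}) : Continuous f := by
  refine continuous_of_continuousAt_one f ?_
  rw [ContinuousAt, map_one]
  intro s hs
  obtain ⟨E, hE, hEs⟩ := (krullTopology_mem_nhds_one_iff k M s).mp hs
  let b := Module.finBasis k E
  have hb : (⋂ i, {g | f g (b i) = b i}) ∈ nhds (1 : G) :=
    (isOpen_iInter_of_finite fun i ↦ h _).mem_nhds (Set.mem_iInter.mpr fun i ↦ by
      rw [Set.mem_ofPred_eq, map_one, AlgEquiv.one_apply])
  rw [Filter.mem_map]
  refine Filter.mem_of_superset hb fun g hg ↦ hEs ?_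
  rw [SetLike.mem_coe, IntermediateField.mem_fixingSubgroup_iff]
  have e : (f g).toLinearMap ∘ₗ E.val.toLinearMap = E.val.toLinearMap :=
    b.ext fun i ↦ Set.mem_iInter.mp hg i
  exact fun x hx ↦ LinearMap.congr_fun e ⟨x, hx⟩

variable {K k A B : Type*} [Field K] [Field k] [Field A] [Field B] [Algebra K A] [Algebra k B]

/-- Conjugation by `ψ : A ≃+* B`, from the automorphisms of `A / K` to those of `B / k`. -/
noncomputable def conjHom (ψ : A ≃+* B) (h : ∀ (g : A ≃ₐ[K] A) (a : k),
    ψ (g (ψ.symm (algebraMap k B a))) = algebraMap k B a) : (A ≃ₐ[K] A) →* (B ≃ₐ[k] B) where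
  toFun g := AlgEquiv.ofRingEquiv (f := (ψ.symm.trans g.toRingEquiv).trans ψ) (h g)
  map_one' := by
    ext x
    exact ψ.apply_symm_apply x
  map_mul' g g' := by
    ext x
    change ψ (g (g' (ψ.symm x))) = ψ (g (ψ.symm (ψ (g' (ψ.symm x)))))
    rw [ψ.symm_apply_apply]

theorem conjHom_apply (ψ : A ≃+* B) (h : ∀ (g : A ≃ₐ[K] A) (a : k),
    ψ (g (ψ.symm (algebraMap k B a))) = algebraMap k B a) (g : A ≃ₐ[K] A) (x : B) :
    conjHom ψ h g x = ψ (g (ψ.symm x)) := rfl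

theorem continuous_conjHom [Algebra.IsIntegral K A] (ψ : A ≃+* B)
    (h : ∀ (g : A ≃ₐ[K] A) (a : k),
      ψ (g (ψ.symm (algebraMap k B a))) = algebraMap k B a) : Continuous (conjHom ψ h) := by
  refine continuous_of_isOpen_setOf_apply_eq _ fun x ↦ ?_
  convert stabilizer_isOpen_of_isIntegral (K := K) (ψ.symm x) using 1
  ext g
  rw [Set.mem_ofPred_eq, conjHom_apply, SetLike.mem_coe, MulAction.mem_stabilizer_iff,
    AlgEquiv.smul_def, ψ.eq_symm_apply]

theorem apply_algebraMap_rat [CharZero A] [CharZero B] (ψ : A ≃+* B) (g : A ≃ₐ[K] A) (a : ℚ) :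
    ψ (g (ψ.symm (algebraMap ℚ B a))) = algebraMap ℚ B a := by
  simp

theorem injective_conjHom (ψ : A ≃+* B) (h : ∀ (g : A ≃ₐ[K] A) (a : k),
    ψ (g (ψ.symm (algebraMap k B a))) = algebraMap k B a) : Function.Injective (conjHom ψ h) := by
  intro g g' hgg
  ext x
  have := AlgEquiv.congr_fun hgg (ψ x)
  rwa [conjHom_apply, conjHom_apply, ψ.symm_apply_apply, ψ.injective.eq_iff] at this

theorem isOpen_range_conjHom [NumberField K] [CharZero A] [CharZero B]
    (ψ : A ≃+* B) : IsOpen ((conjHom (K := K) ψ (apply_algebraMap_rat ψ)).range :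
      Set (B ≃ₐ[ℚ] B)) := by
  let f : K →ₐ[ℚ] B := ((ψ : A →+* B).comp (algebraMap K A)).toRatAlgHom
  have : FiniteDimensional ℚ f.fieldRange := f.toLinearMap.finiteDimensional_range
  refine Subgroup.isOpen_mono (H₁ := f.fieldRange.fixingSubgroup) ?_
    f.fieldRange.fixingSubgroup_isOpen
  intro u hu
  rw [IntermediateField.mem_fixingSubgroup_iff] at hu
  refine ⟨AlgEquiv.ofRingEquiv (f := (ψ.trans u.toRingEquiv).trans ψ.symm) fun a ↦ ?_, ?_⟩
  · exact ψ.symm_apply_eq.mpr (hu _ ⟨a, rfl⟩)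
  · ext x
    change ψ (ψ.symm (u (ψ (ψ.symm x)))) = u x
    rw [ψ.apply_symm_apply, ψ.apply_symm_apply]

theorem isGalois_of_isAlgClosure [CharZero K] [IsAlgClosure K A] : IsGalois K A := by
  have := IsAlgClosure.normal K A
  exact ⟨⟩

/-- The identification of `Gal(A / K)` with an open subgroup of `Gal(B / ℚ)`. -/
noncomputable def conjEquiv [CharZero K] [IsAlgClosure K A] [CharZero A] [CharZero B]
    [Algebra.IsIntegral ℚ B] (ψ : A ≃+* B) :
    (A ≃ₐ[K] A) ≃ₜ* (conjHom (K := K) ψ (apply_algebraMap_rat ψ)).range where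
  toMulEquiv := MonoidHom.ofInjective (injective_conjHom ψ (apply_algebraMap_rat ψ))
  continuous_toFun := by
    have := (IsAlgClosure.isAlgebraic (R := K) (K := A)).isIntegral
    exact (continuous_conjHom ψ _).subtype_mk _
  continuous_invFun := by
    have := isGalois_of_isAlgClosure (K := K) (A := A)
    have := (IsAlgClosure.isAlgebraic (R := K) (K := A)).isIntegral
    exact Continuous.continuous_symm_of_equiv_compact_to_t2 (f := (MonoidHom.ofInjective
      (injective_conjHom ψ (apply_algebraMap_rat ψ))).toEquiv)
      ((continuous_conjHom ψ _).subtype_mk _)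

theorem isAlgClosure_rat [NumberField K] [CharZero A] [IsAlgClosure K A] : IsAlgClosure ℚ A := by
  have := IsAlgClosure.isAlgebraic (R := K) (K := A)
  have : IsScalarTower ℚ K A := IsScalarTower.of_algebraMap_eq' (Subsingleton.elim _ _)
  exact ⟨IsAlgClosure.isAlgClosed K, Algebra.IsAlgebraic.trans ℚ K A⟩

theorem exists_ringEquiv_of_continuousMulEquiv [NumberField K] [NumberField k] [IsAlgClosure K A]
    [IsAlgClosure k B] (e : (A ≃ₐ[K] A) ≃ₜ* (B ≃ₐ[k] B)) :
    ∃ ψ : A ≃+* B, ∀ g x, e g x = ψ (g (ψ.symm x)) := by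
  have : CharZero A := charZero_of_injective_algebraMap (algebraMap K A).injective
  have : CharZero B := charZero_of_injective_algebraMap (algebraMap k B).injective
  have : IsAlgClosure ℚ A := isAlgClosure_rat (K := K)
  have : IsAlgClosure ℚ B := isAlgClosure_rat (K := k)
  have : Algebra.IsAlgebraic ℚ B := IsAlgClosure.isAlgebraic
  have : IsAlgClosed B := IsAlgClosure.isAlgClosed ℚ
  let ψ₀ : A ≃+* B := (IsAlgClosure.equiv ℚ A B).toRingEquiv
  let α := ((conjEquiv (K := K) ψ₀).symm.trans e).trans (conjEquiv (RingEquiv.refl B))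
  obtain ⟨τ, hτ⟩ := exists_eq_conj (isOpen_range_conjHom (K := K) ψ₀)
    (isOpen_range_conjHom (K := k) (RingEquiv.refl B)) α
  refine ⟨ψ₀.trans τ.toRingEquiv, fun g x ↦ ?_⟩
  have h1 := AlgEquiv.congr_fun (hτ (conjEquiv ψ₀ g)) x
  have h2 : α (conjEquiv ψ₀ g) = conjEquiv (RingEquiv.refl B) (e g) := by
    change conjEquiv (RingEquiv.refl B) (e ((conjEquiv ψ₀).symm (conjEquiv ψ₀ g))) = _
    rw [ContinuousMulEquiv.symm_apply_apply]
  rw [h2] at h1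
  exact h1

theorem eq_of_forall_apply_comm [NumberField K] [IsAlgClosure K A] (τ : A ≃+* A)
    (h : ∀ (g : A ≃ₐ[K] A) (x : A), τ (g x) = g (τ x)) (x : A) : τ x = x := by
  have : CharZero A := charZero_of_injective_algebraMap (algebraMap K A).injective
  have : IsAlgClosure ℚ A := isAlgClosure_rat (K := K)
  have : Algebra.IsAlgebraic ℚ A := IsAlgClosure.isAlgebraic
  have : IsAlgClosed A := IsAlgClosure.isAlgClosed ℚ
  let t : A ≃ₐ[ℚ] A := AlgEquiv.ofRingEquiv (f := τ) fun a ↦ by simp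
  have ht : t = 1 := by
    refine eq_one_of_commute (isOpen_range_conjHom (K := K) (RingEquiv.refl A)) ?_
    rintro _ ⟨g, rfl⟩
    ext y
    exact h g y
  exact AlgEquiv.congr_fun ht x

theorem apply_algebraMap_mem_range [CharZero k] [IsAlgClosure k B] (e : (A ≃ₐ[K] A) ≃* (B ≃ₐ[k] B))
    (ψ : A ≃+* B) (he : ∀ g x, e g x = ψ (g (ψ.symm x))) (a : K) :
    ∃ b, algebraMap k B b = ψ (algebraMap K A a) := by
  have := isGalois_of_isAlgClosure (K := k) (A := B)
  refine (InfiniteGalois.mem_range_algebraMap_iff_fixed _).mpr fun h ↦ ?_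
  obtain ⟨g, rfl⟩ := e.surjective h
  rw [he, ψ.symm_apply_apply, AlgEquiv.commutes]

theorem exists_ringEquiv_extends [CharZero K] [IsAlgClosure K A] [CharZero k] [IsAlgClosure k B]
    (e : (A ≃ₐ[K] A) ≃* (B ≃ₐ[k] B)) (ψ : A ≃+* B) (he : ∀ g x, e g x = ψ (g (ψ.symm x))) :
    ∃ σ : K ≃+* k, ∀ a, ψ (algebraMap K A a) = algebraMap k B (σ a) := by
  choose s hs using apply_algebraMap_mem_range e ψ he
  choose t ht using apply_algebraMap_mem_range e.symm ψ.symm fun g x ↦ by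
    obtain ⟨h, rfl⟩ := e.surjective g
    rw [MulEquiv.symm_apply_apply, RingEquiv.symm_symm, he, ψ.symm_apply_apply, ψ.symm_apply_apply]
  refine ⟨{ toFun := s, invFun := t, left_inv := fun a ↦ ?_, right_inv := fun b ↦ ?_,
            map_mul' := fun a b ↦ ?_, map_add' := fun a b ↦ ?_ }, fun a ↦ (hs a).symm⟩
  · refine (algebraMap K A).injective ?_
    rw [ht, hs, ψ.symm_apply_apply]
  · refine (algebraMap k B).injective ?_
    rw [hs, ht, ψ.apply_symm_apply]
  · refine (algebraMap k B).injective ?_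
    simp only [map_mul, hs]
  · refine (algebraMap k B).injective ?_
    simp only [map_add, hs]

end AlgebraicClosures
end NU

/-- Neukirch–Uchida: the natural map `Isom(F, L) → Isom(G_F, G_L)/Inn(G_L)` is
well defined and bijective; in particular, number fields with isomorphic absolute
Galois groups (as topological groups) are isomorphic as fields. -/
theorem neukirch_uchida (F L : Type) [Field F] [NumberField F] [Field L] [NumberField L] :
    (∀ σ : F ≃+* L, ∃! c : GaloisIsomClasses F L, natGaloisRel F L σ c) ∧
    (∀ c : GaloisIsomClasses F L, ∃! σ : F ≃+* L, natGaloisRel F L σ c) ∧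
    (Nonempty (ContinuousGroupIso (absGaloisGroup F) (absGaloisGroup L)) →
      Nonempty (F ≃+* L)) := by
  have existence : ∀ c : GaloisIsomClasses F L, ∃ σ : F ≃+* L, natGaloisRel F L σ c := by
    intro c
    obtain ⟨e, rfl⟩ := Quotient.exists_rep c
    obtain ⟨ψ, hψ⟩ := NU.exists_ringEquiv_of_continuousMulEquiv
      (⟨e.toMulEquiv, e.continuous_toFun, e.continuous_invFun⟩ :
        absGaloisGroup F ≃ₜ* absGaloisGroup L)
    obtain ⟨σ, hσ⟩ := NU.exists_ringEquiv_extends e.toMulEquiv ψ hψ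
    exact ⟨σ, ψ, hσ, e, hψ, rfl⟩
  refine ⟨fun σ ↦ ?_, fun c ↦ ?_, ?_⟩
  · let ψ : AlgebraicClosure F ≃+* AlgebraicClosure L := IsAlgClosure.equivOfEquiv _ _ σ
    have hψ : ∀ a, ψ (algebraMap F _ a) = algebraMap L _ (σ a) :=
      IsAlgClosure.equivOfEquiv_algebraMap _ _ σ
    have hψ' : ∀ b, ψ.symm (algebraMap L _ b) = algebraMap F _ (σ.symm b) :=
      IsAlgClosure.equivOfEquiv_symm_algebraMap _ _ σ
    let u := NU.conjHom (K := F) (k := L) ψ fun g a ↦ by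
      rw [hψ', AlgEquiv.commutes, hψ, σ.apply_symm_apply]
    let v := NU.conjHom (K := L) (k := F) ψ.symm fun g a ↦ by
      rw [RingEquiv.symm_symm, hψ, AlgEquiv.commutes, hψ', σ.symm_apply_apply]
    let e : ContinuousGroupIso (absGaloisGroup F) (absGaloisGroup L) :=
      { u with
        invFun := v
        left_inv := fun g ↦ by
          ext x
          change ψ.symm (ψ (g (ψ.symm (ψ x)))) = g x
          rw [ψ.symm_apply_apply, ψ.symm_apply_apply]
        right_inv := fun g ↦ by
          ext x
          change ψ (ψ.symm (g (ψ (ψ.symm x)))) = g x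
          rw [ψ.apply_symm_apply, ψ.apply_symm_apply]
        continuous_toFun := NU.continuous_conjHom ψ _
        continuous_invFun := NU.continuous_conjHom ψ.symm _ }
    refine ⟨⟦e⟧, ⟨ψ, hψ, e, fun _ _ ↦ rfl, rfl⟩, ?_⟩
    rintro _ ⟨ψ', hψ'', e', he', rfl⟩
    refine Quotient.sound ⟨AlgEquiv.ofRingEquiv (f := ψ'.symm.trans ψ) fun b ↦ ?_, fun g ↦ ?_⟩
    · obtain ⟨a, rfl⟩ := σ.surjective b
      rw [RingEquiv.trans_apply, ← hψ'', ψ'.symm_apply_apply, hψ, hψ'']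
    · rw [eq_mul_inv_iff_mul_eq]
      ext x
      change ψ (g (ψ.symm (ψ (ψ'.symm x)))) = ψ (ψ'.symm (e'.toMulEquiv g x))
      rw [he', ψ.symm_apply_apply, ψ'.symm_apply_apply]
  · obtain ⟨σ, hσ⟩ := existence c
    refine ⟨σ, hσ, fun σ' hσ' ↦ ?_⟩
    obtain ⟨ψ, hψ, e, he, rfl⟩ := hσ
    obtain ⟨ψ', hψ', e', he', hee⟩ := hσ'
    obtain ⟨h, hh⟩ := Quotient.exact hee
    have key := NU.eq_of_forall_apply_comm (K := F) ((ψ.trans h.toRingEquiv).trans ψ'.symm)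
      fun g x ↦ by
        have h1 := AlgEquiv.congr_fun (eq_mul_inv_iff_mul_eq.mp (hh g)) (ψ x)
        rw [AlgEquiv.mul_apply, AlgEquiv.mul_apply, he, he', ψ.symm_apply_apply] at h1
        change ψ'.symm (h (ψ (g x))) = g (ψ'.symm (h (ψ x)))
        rw [← h1, ψ'.symm_apply_apply]
    ext a
    refine (algebraMap L (AlgebraicClosure L)).injective ?_
    have h2 : ψ'.symm (h (ψ (algebraMap F _ a))) = algebraMap F _ a := key _
    rw [ψ'.symm_apply_eq, hψ, AlgEquiv.commutes, hψ'] at h2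
    exact h2.symm
  · rintro ⟨e⟩
    obtain ⟨σ, -⟩ := existence ⟦e⟧
    exact ⟨σ⟩
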